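/- arXiv:2305.02154 — 5 statements merged into one kernel-verified Lean document; each statement's English description precedes it below -/
import Mathlib

section
/- Let k ≥ 2, d ≥ 1, n = 2^k − 1, and let s₁,…,s_d be independent uniform random elements of GL_k(F₂). Form the bipartite Schreier graph on two copies of the nonzero vectors of F₂^k, joining x on the left to sᵢ·x on the right for i = 1,…,d, and let μ be the third largest (in absolute value) eigenvalue of its normalized adjacency matrix (i.e., the second largest ignoring the trivial pair ±1). Define Y_p(c,ℓ,d') recursively by: Y_p(0,0,d') = 1; Y_p(c,ℓ,d') = 0 if p > ℓ (and (c,ℓ) ≠ (0,0)); otherwise Y_p(c,ℓ,d') = Σ_{i=c}^{⌊ℓ/p⌋} C(d',i)·(p!)^{−i}·(ℓ!/(ℓ−pi)!)·Y_{p+1}(0, ℓ−pi, d'−i). Set y₃(i) = Y₃(1, 2m−2i, d−i) and y₄(i) = Y₄(0, 2m−2i, d−i). Then for every positive integer m, E(|μ|) ≤ ( (1/d)^{2m} · n · [ Y₁(1,2m,d)·(1/n) + Y₂(1,2m,d)·(2/n) + Σ_{i=1}^{m} C(d,i)·(1/2)^i·((2m)!/(2m−2i)!)·(2^i/(i+1)!)·(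 y₃(i)·(5/n) + y₄(i) ) + y₃(0)·(5/n) + y₄(0) ] − 1 )^{1/(2m)}. -/
open scoped BigOperators

/-- The recursively defined quantity `Y_p(c, ℓ, d)` from the statement:
`Y_p(0,0,d) = 1`; `Y_p(c,ℓ,d) = 0` if `p > ℓ` (and `(c,ℓ) ≠ (0,0)`); otherwise
`Y_p(c,ℓ,d) = Σ_{i=c}^{⌊ℓ/p⌋} C(d,i)·(p!)^{−i}·(ℓ!/(ℓ−p·i)!)·Y_{p+1}(0, ℓ−p·i, d−i)`. -/
noncomputable def Yrec : ℕ → ℕ → ℕ → ℕ → ℝ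
  | p, c, l, d =>
    if c = 0 ∧ l = 0 then 1
    else if h : p > l then 0
    else ∑ i ∈ Finset.Icc c (l / p),
      (d.choose i : ℝ) * ((Nat.factorial p : ℝ))⁻¹ ^ i *
        ((Nat.factorial l : ℝ) / (Nat.factorial (l - p * i) : ℝ)) *
        Yrec (p + 1) 0 (l - p * i) (d - i)
termination_by p c l d => l + 1 - p
decreasing_by
  have h1 : l - p * i ≤ l := Nat.sub_le _ _
  omega

/-- The words of length `l` over the alphabet `B`. -/
def wordsOver {α : Type*} [DecidableEq α] (B : Finset α) : ℕ → Finset (List α)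
  | 0 => {[]}
  | l + 1 => (B ×ˢ wordsOver B l).image fun q => q.1 :: q.2

theorem eq_of_map_eq_of_filter_eq {α : Type*} (p : α → Bool) {w v : List α} (hm : w.map p = v.map p)
    (h1 : w.filter p = v.filter p) (h2 : w.filter (fun x => !p x) = v.filter (fun x => !p x)) :
    w = v := by
  induction w generalizing v with
  | nil => simpa using hm.symm
  | cons a w ih =>
    rcases v with _ | ⟨b, v⟩
    · simp at hm
    · simp only [List.map_cons, List.cons.injEq] at hm
      obtain ⟨hab, hm⟩ := hm
      cases ha : p a
      · have hb : p b = false := by rw [← hab, ha]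
        simp only [List.filter_cons, ha, hb] at h1 h2
        simp only [Bool.not_false, if_true, List.cons.injEq] at h2
        rw [h2.1, ih hm (by simpa using h1) h2.2]
      · have hb : p b = true := by rw [← hab, ha]
        simp only [List.filter_cons, ha, hb] at h1 h2
        simp only [if_true, List.cons.injEq] at h1
        rw [h1.1, ih hm h1.2 (by simpa using h2)]

section Words

variable {α : Type*} [DecidableEq α]

theorem mem_wordsOver {B : Finset α} {l : ℕ} {w : List α} :
    w ∈ wordsOver B l ↔ w.length = l ∧ ∀ x ∈ w, x ∈ B := by
  induction l generalizing w with
  | zero => cases w <;> simp [wordsOver]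
  | succ l ih =>
    cases w with
    | nil => simp [wordsOver]
    | cons a w => simp [wordsOver, ih]; tauto

theorem sum_wordsOver_succ {R : Type*} [AddCommMonoid R] (B : Finset α) (l : ℕ)
    (f : List α → R) :
    ∑ w ∈ wordsOver B (l + 1), f w = ∑ a ∈ B, ∑ w ∈ wordsOver B l, f (a :: w) := by
  rw [wordsOver, Finset.sum_image, Finset.sum_product]
  rintro ⟨a, w⟩ _ ⟨b, v⟩ _ h
  simpa using h

end Words

theorem card_boolWords_count_le (l j : ℕ) :
    ((wordsOver (Finset.univ : Finset Bool) l).filter fun w => w.count true = j).card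
      ≤ l.choose j := by
  simp only [Finset.card_filter]
  induction l generalizing j with
  | zero =>
    rcases j with _ | j <;> simp [wordsOver, Finset.filter_singleton]
  | succ l ih =>
    rw [sum_wordsOver_succ]
    simp only [Fintype.univ_bool, Finset.mem_singleton, Bool.true_eq_false, not_false_eq_true,
      Finset.sum_insert, List.count_cons_self, Finset.sum_singleton] at ih ⊢
    rcases j with _ | j
    · simpa [List.count_cons] using ih 0
    · have h1 := ih j
      have h2 := ih (j + 1)
      simp only [Nat.choose_succ_succ, List.count_cons, Nat.add_right_cancel_iff] at *
      simpa using Nat.add_le_add h1 h2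

/-- A word is determined by the positions of the letters satisfying `p` and by the two subwords
of letters satisfying, respectively not satisfying, `p`. -/
theorem card_le_choose_mul_of_filter_mem {α : Type*} (p : α → Bool) (S U V : Finset (List α)) {l j : ℕ}
    (hl : ∀ w ∈ S, w.length = l) (hU : ∀ w ∈ S, w.filter p ∈ U)
    (hV : ∀ w ∈ S, w.filter (fun x => !p x) ∈ V) (hj : ∀ u ∈ U, u.length = j) :
    S.card ≤ l.choose j * (U.card * V.card) := by
  calc S.card
      ≤ (((wordsOver (Finset.univ : Finset Bool) l).filter fun w => w.count true = j) ×ˢ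
          (U ×ˢ V)).card := by
        refine Finset.card_le_card_of_injOn
          (fun w => (w.map p, w.filter p, w.filter (fun x => !p x))) ?_ ?_
        · intro w hw
          simp only [Finset.coe_product, Set.mem_prod, Finset.mem_coe, Finset.mem_filter,
            mem_wordsOver]
          refine ⟨⟨⟨by simp [hl w hw], by simp⟩, ?_⟩, hU w hw, hV w hw⟩
          rw [← hj _ (hU w hw), List.count, List.countP_map, List.countP_eq_length_filter]
          congr 2
          funext x
          simp
        · intro w _ v _ h
          simp only [Prod.mk.injEq] at h
          exact eq_of_map_eq_of_filter_eq p h.1 h.2.1 h.2.2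
    _ ≤ _ := by
        rw [Finset.card_product, Finset.card_product]
        exact Nat.mul_le_mul_right _ (card_boolWords_count_le l j)

section WordSplitting

variable {α : Type*} [DecidableEq α]

theorem count_filter_mem (T : Finset α) (w : List α) {x : α} (hx : x ∈ T) :
    (w.filter (· ∈ T)).count x = w.count x :=
  List.count_filter (by simpa using hx)

theorem count_filter_notMem (T : Finset α) (w : List α) {x : α} (hx : x ∉ T) :
    (w.filter (fun x => !decide (x ∈ T))).count x = w.count x :=
  List.count_filter (by simpa using hx)

theorem length_eq_of_count_eq {T : Finset α} {p : ℕ} {w : List α} (hw : ∀ x ∈ w, x ∈ T)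
    (hc : ∀ a ∈ T, w.count a = p) : w.length = p * T.card := by
  have h := Multiset.sum_count_eq_card (s := T) (m := (w : Multiset α)) (by simpa using hw)
  simp only [Multiset.coe_count, Multiset.coe_card] at h
  rw [← h, Finset.sum_congr rfl hc, Finset.sum_const, smul_eq_mul, mul_comm]

/-- The words in which each letter of `T` occurs exactly `p` times, and no other letter occurs. -/
def exactWords (p : ℕ) (T : Finset α) : Finset (List α) :=
  (wordsOver T (p * T.card)).filter fun w => ∀ a ∈ T, w.count a = p

theorem mem_exactWords {p : ℕ} {T : Finset α} {w : List α} :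
    w ∈ exactWords p T ↔ (∀ x ∈ w, x ∈ T) ∧ ∀ a ∈ T, w.count a = p := by
  rw [exactWords, Finset.mem_filter, mem_wordsOver]
  exact ⟨fun h => ⟨h.1.2, h.2⟩, fun h => ⟨⟨length_eq_of_count_eq h.1 h.2, h.1⟩, h.2⟩⟩

theorem filter_mem_exactWords {T : Finset α} {p : ℕ} {w : List α} (hc : ∀ a ∈ T, w.count a = p) :
    w.filter (· ∈ T) ∈ exactWords p T := by
  rw [mem_exactWords]
  exact ⟨fun x hx => by simpa using (List.mem_filter.mp hx).2,
    fun a ha => by rw [count_filter_mem T w ha, hc a ha]⟩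

theorem card_exactWords_mul_le (p : ℕ) (T : Finset α) :
    (exactWords p T).card * p.factorial ^ T.card ≤ (p * T.card).factorial := by
  induction T using Finset.induction_on with
  | empty =>
    have : exactWords p (∅ : Finset α) = {[]} := by
      ext w
      simp [mem_exactWords, List.eq_nil_iff_forall_not_mem]
    simp [this]
  | insert a T ha ih =>
    have h := card_le_choose_mul_of_filter_mem (fun x => decide (x ∈ ({a} : Finset α)))
      (exactWords p (insert a T)) {List.replicate p a} (exactWords p T)
      (l := p * (T.card + 1)) (j := p) ?_ ?_ ?_ (by simp)
    · rw [Finset.card_singleton, one_mul] at h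
      rw [Finset.card_insert_of_notMem ha]
      calc _ ≤ ((p * (T.card + 1)).choose p * (exactWords p T).card) *
            p.factorial ^ (T.card + 1) := Nat.mul_le_mul_right _ h
        _ = ((p * (T.card + 1)).choose p * p.factorial) *
            ((exactWords p T).card * p.factorial ^ T.card) := by ring
        _ ≤ ((p * (T.card + 1)).choose p * p.factorial) * (p * T.card).factorial :=
            Nat.mul_le_mul_left _ ih
        _ = _ := by
            have := Nat.choose_mul_factorial_mul_factorial
              (Nat.le_mul_of_pos_right p (Nat.succ_pos T.card))
            rw [← this]
            congr 2
            rw [Nat.mul_succ, Nat.add_sub_cancel]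
    · intro w hw
      rw [mem_exactWords] at hw
      rw [length_eq_of_count_eq hw.1 hw.2, Finset.card_insert_of_notMem ha]
    · intro w hw
      rw [mem_exactWords] at hw
      rw [Finset.mem_singleton, List.eq_replicate_iff]
      refine ⟨?_, fun b hb => by simpa using (List.mem_filter.mp hb).2⟩
      rw [← hw.2 a (Finset.mem_insert_self a T), List.count, List.countP_eq_length_filter]
      congr 2
      funext x
      rw [Bool.eq_iff_iff]
      simp
    · intro w hw
      rw [mem_exactWords] at hw ⊢
      refine ⟨fun x hx => ?_, fun b hb => ?_⟩
      · have := List.mem_filter.mp hx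
        have h1 := hw.1 x this.1
        rw [Finset.mem_insert] at h1
        exact h1.resolve_left (by simpa using this.2)
      · rw [count_filter_notMem _ _ (by rintro h; simp at h; exact ha (h ▸ hb)),
          hw.2 b (Finset.mem_insert_of_mem hb)]

/-- The words of length `l` over `B` in which no letter occurs between `1` and `p - 1` times. -/
def thickWords (p : ℕ) (B : Finset α) (l : ℕ) : Finset (List α) :=
  (wordsOver B l).filter fun w => ∀ x ∈ w, p ≤ w.count x

theorem mem_thickWords {p : ℕ} {B : Finset α} {l : ℕ} {w : List α} :
    w ∈ thickWords p B l ↔ (w.length = l ∧ ∀ x ∈ w, x ∈ B) ∧ ∀ x ∈ w, p ≤ w.count x := by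
  rw [thickWords, Finset.mem_filter, mem_wordsOver]

theorem thickWords_subset (p : ℕ) (B : Finset α) (l : ℕ) : thickWords p B l ⊆ wordsOver B l :=
  Finset.filter_subset _ _

/-- The letters of `B` occurring exactly `p` times in `w`. -/
def lettersWithCount (p : ℕ) (B : Finset α) (w : List α) : Finset α :=
  B.filter fun x => w.count x = p

theorem filter_notMem_mem_thickWords {p : ℕ} {B T : Finset α} {l : ℕ} {w : List α}
    (hw : w ∈ thickWords p B l) (hT : lettersWithCount p B w = T) :
    w.filter (fun x => !decide (x ∈ T)) ∈ thickWords (p + 1) (B \ T) (l - p * T.card) := by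
  rw [mem_thickWords] at hw ⊢
  have hc : ∀ a ∈ T, w.count a = p := fun a ha => by
    rw [← hT, lettersWithCount, Finset.mem_filter] at ha
    exact ha.2
  refine ⟨⟨?_, fun x hx => ?_⟩, fun x hx => ?_⟩
  · have h1 := length_eq_of_count_eq (mem_exactWords.mp (filter_mem_exactWords hc)).1
      (mem_exactWords.mp (filter_mem_exactWords hc)).2
    have h2 := List.length_eq_length_filter_add (l := w) (fun x => decide (x ∈ T))
    omega
  · have := List.mem_filter.mp hx
    exact Finset.mem_sdiff.mpr ⟨hw.1.2 x this.1, by simpa using this.2⟩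
  · have := List.mem_filter.mp hx
    have hxT : x ∉ T := by simpa using this.2
    rw [count_filter_notMem _ _ hxT]
    refine lt_of_le_of_ne (hw.2 x this.1) fun h => hxT ?_
    rw [← hT, lettersWithCount, Finset.mem_filter]
    exact ⟨hw.1.2 x this.1, h.symm⟩

/-- Counting words in which `T` is the set of letters occurring exactly `p` times by means of the
two subwords of letters in `T` and not in `T`. -/
theorem card_le_of_lettersWithCount_eq {p l : ℕ} {B T : Finset α} (S U V : Finset (List α))
    (hS : ∀ w ∈ S, w ∈ thickWords p B l ∧ lettersWithCount p B w = T)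
    (hU : ∀ w ∈ S, w.filter (fun x => decide (x ∈ T)) ∈ U)
    (hV : ∀ w ∈ S, w.filter (fun x => !decide (x ∈ T)) ∈ V) (hUe : U ⊆ exactWords p T) :
    S.card ≤ l.choose (p * T.card) * (U.card * V.card) := by
  refine card_le_choose_mul_of_filter_mem _ S U V
    (fun w hw => (mem_thickWords.mp (hS w hw).1).1.1) hU hV fun u hu => ?_
  have := mem_exactWords.mp (hUe hu)
  exact length_eq_of_count_eq this.1 this.2

end WordSplitting
theorem Yrec_eq_sum {p c l d : ℕ} (hp : p ≤ l) (h : ¬(c = 0 ∧ l = 0)) :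
    Yrec p c l d = ∑ i ∈ Finset.Icc c (l / p),
      (d.choose i : ℝ) * ((Nat.factorial p : ℝ))⁻¹ ^ i *
        ((Nat.factorial l : ℝ) / (Nat.factorial (l - p * i) : ℝ)) *
        Yrec (p + 1) 0 (l - p * i) (d - i) := by
  rw [Yrec, if_neg h, dif_neg (by omega)]

theorem Yrec_zero_zero (p d : ℕ) : Yrec p 0 0 d = 1 := by
  rw [Yrec, if_pos ⟨rfl, rfl⟩]

theorem Yrec_nonneg (p c l d : ℕ) : 0 ≤ Yrec p c l d := by
  induction h : l + 1 - p using Nat.strong_induction_on generalizing p c l d with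
  | _ N ih =>
    rw [Yrec]
    split_ifs with h1 h2
    · exact zero_le_one
    · exact le_rfl
    · refine Finset.sum_nonneg fun i _ => mul_nonneg (by positivity) (ih _ ?_ _ _ _ _ rfl)
      have := Nat.sub_le l (p * i)
      omega

/-- Regrouping a sum over the set of letters occurring exactly `p` times by its cardinality. -/
theorem sum_powerset_le_sum_Icc {α : Type*} (B : Finset α) {p c l : ℕ} (hp : 0 < p) (f : ℕ → ℝ)
    (hf : ∀ i, 0 ≤ f i) (g : Finset α → ℝ)
    (hg : ∀ T ∈ B.powerset, c ≤ T.card → p * T.card ≤ l → g T ≤ f T.card)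
    (hg1 : ∀ T ∈ B.powerset, T.card < c → g T ≤ 0)
    (hg2 : ∀ T ∈ B.powerset, l < p * T.card → g T ≤ 0) :
    ∑ T ∈ B.powerset, g T ≤ ∑ i ∈ Finset.Icc c (l / p), (B.card.choose i : ℝ) * f i := by
  classical
  have key : ∀ T ∈ B.powerset, g T ≤ if T.card ∈ Finset.Icc c (l / p) then f T.card else 0 := by
    intro T hT
    simp only [Finset.mem_Icc, Nat.le_div_iff_mul_le hp, mul_comm T.card p]
    split_ifs with h
    · exact hg T hT h.1 h.2
    · rw [not_and_or, not_le, not_le] at h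
      exact h.elim (hg1 T hT) (hg2 T hT)
  refine (Finset.sum_le_sum key).trans ?_
  rw [Finset.sum_powerset_apply_card fun i => if i ∈ Finset.Icc c (l / p) then f i else 0]
  simp only [nsmul_eq_mul, mul_ite, mul_zero]
  rw [← Finset.sum_filter]
  refine Finset.sum_le_sum_of_subset_of_nonneg (fun i hi => (Finset.mem_filter.mp hi).2)
    fun i _ _ => mul_nonneg (Nat.cast_nonneg _) (hf i)

section WordCounts

variable {α : Type*} [DecidableEq α]

theorem card_eq_sum_lettersWithCount (p : ℕ) (B : Finset α) (S : Finset (List α)) :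
    (S.card : ℝ) = ∑ T ∈ B.powerset, ((S.filter fun w => lettersWithCount p B w = T).card : ℝ) := by
  exact_mod_cast Finset.card_eq_sum_card_fiberwise
    (fun w _ => Finset.mem_coe.mpr (Finset.mem_powerset.mpr (Finset.filter_subset _ _)))

theorem card_thickWords_filter_le_sum {p c l : ℕ} (hp : 0 < p) (B : Finset α) (y : ℕ → ℝ)
    (hy : ∀ i, 0 ≤ y i)
    (h : ∀ T ⊆ B, ((thickWords (p + 1) (B \ T) (l - p * T.card)).card : ℝ) ≤ y T.card) :
    (((thickWords p B l).filter fun w => c ≤ (lettersWithCount p B w).card).card : ℝ) ≤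
      ∑ i ∈ Finset.Icc c (l / p), (B.card.choose i : ℝ) * ((Nat.factorial p : ℝ))⁻¹ ^ i *
        ((Nat.factorial l : ℝ) / (Nat.factorial (l - p * i) : ℝ)) * y i := by
  rw [card_eq_sum_lettersWithCount p B]
  simp only [mul_assoc]
  refine sum_powerset_le_sum_Icc B hp
    (fun i => ((Nat.factorial p : ℝ))⁻¹ ^ i *
        ((Nat.factorial l : ℝ) / (Nat.factorial (l - p * i) : ℝ) * y i))
    (fun i => mul_nonneg (by positivity) (mul_nonneg (by positivity) (hy i))) _ ?_ ?_ ?_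
  · intro T hT _ hl
    have hcard := card_le_of_lettersWithCount_eq (p := p) (l := l) (B := B) (T := T)
      (((thickWords p B l).filter fun w => c ≤ (lettersWithCount p B w).card).filter
        fun w => lettersWithCount p B w = T) (exactWords p T)
      (thickWords (p + 1) (B \ T) (l - p * T.card))
      (fun w hw => by simp only [Finset.mem_filter] at hw; exact ⟨hw.1.1, hw.2⟩)
      (fun w hw => filter_mem_exactWords fun a ha => by
        simp only [Finset.mem_filter] at hw
        rw [← hw.2, lettersWithCount, Finset.mem_filter] at ha
        exact ha.2)
      (fun w hw => by
        simp only [Finset.mem_filter] at hw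
        exact filter_notMem_mem_thickWords hw.1.1 hw.2)
      (Finset.Subset.refl _)
    have hE : ((exactWords p T).card : ℝ) ≤
        ((p * T.card).factorial : ℝ) * ((Nat.factorial p : ℝ))⁻¹ ^ T.card := by
      rw [inv_pow, ← div_eq_mul_inv, le_div_iff₀ (by positivity)]
      exact_mod_cast card_exactWords_mul_le p T
    calc _ ≤ (l.choose (p * T.card) : ℝ) * ((exactWords p T).card *
            (thickWords (p + 1) (B \ T) (l - p * T.card)).card) := by exact_mod_cast hcard
      _ ≤ (l.choose (p * T.card) : ℝ) *
            (((p * T.card).factorial : ℝ) * ((Nat.factorial p : ℝ))⁻¹ ^ T.card * y T.card) := by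
          gcongr
          exact h T (Finset.mem_powerset.mp hT)
      _ = _ := by
          rw [Nat.cast_choose ℝ hl]
          field_simp
  · intro T _ hc
    rw [Finset.card_eq_zero.mpr, Nat.cast_zero]
    simp only [Finset.filter_eq_empty_iff, Finset.mem_filter]
    rintro w hw rfl
    omega
  · intro T _ hl
    rw [Finset.card_eq_zero.mpr, Nat.cast_zero]
    simp only [Finset.filter_eq_empty_iff, Finset.mem_filter]
    rintro w hw rfl
    have h1 := mem_exactWords.mp (filter_mem_exactWords (p := p) (w := w)
      (T := lettersWithCount p B w) fun a ha => (Finset.mem_filter.mp ha).2)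
    have h2 := length_eq_of_count_eq h1.1 h1.2
    have h3 := List.length_filter_le (fun x => decide (x ∈ lettersWithCount p B w)) w
    have h4 := (mem_thickWords.mp hw.1).1.1
    omega

theorem card_thickWords_le_Yrec {p : ℕ} (hp : 0 < p) (B : Finset α) (l : ℕ) :
    ((thickWords p B l).card : ℝ) ≤ Yrec p 0 l B.card := by
  induction h : l + 1 - p using Nat.strong_induction_on generalizing p B l with
  | _ N ih =>
    rcases Nat.eq_zero_or_pos l with rfl | hl
    · rw [Yrec_zero_zero]
      have : (thickWords p B 0).card ≤ 1 := by
        refine (Finset.card_filter_le _ _).trans ?_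
        simp [wordsOver]
      exact_mod_cast this
    · by_cases hpl : p ≤ l
      · rw [Yrec_eq_sum hpl (by omega)]
        have := card_thickWords_filter_le_sum (c := 0) (l := l) hp B
          (fun i => Yrec (p + 1) 0 (l - p * i) (B.card - i)) (fun i => Yrec_nonneg _ _ _ _) ?_
        · simpa using this
        · intro T hT
          rw [← Finset.card_sdiff_of_subset hT]
          refine ih _ ?_ p.succ_pos _ _ rfl
          have := Nat.sub_le l (p * T.card)
          omega
      · rw [Finset.card_eq_zero.mpr, Nat.cast_zero]
        · exact Yrec_nonneg _ _ _ _
        · rw [Finset.eq_empty_iff_forall_notMem]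
          intro w hw
          rw [mem_thickWords] at hw
          obtain ⟨x, hx⟩ := List.exists_mem_of_length_pos (by omega : 0 < w.length)
          have h1 := hw.2 x hx
          have h2 := List.count_le_length (a := x) (l := w)
          omega

/-- The words of length `l` over `B` in which no letter occurs between `1` and `p - 1` times and
some letter occurs exactly `p` times. -/
def thickWordsWithExact (p : ℕ) (B : Finset α) (l : ℕ) : Finset (List α) :=
  (thickWords p B l).filter fun w => 1 ≤ (lettersWithCount p B w).card

theorem card_thickWordsWithExact_le_Yrec {p : ℕ} (hp : 0 < p) (B : Finset α) (l : ℕ) :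
    ((thickWordsWithExact p B l).card : ℝ) ≤ Yrec p 1 l B.card := by
  by_cases hpl : p ≤ l
  · rw [Yrec_eq_sum hpl (by omega)]
    refine card_thickWords_filter_le_sum hp B
      (fun i => Yrec (p + 1) 0 (l - p * i) (B.card - i)) (fun i => Yrec_nonneg _ _ _ _) ?_
    intro T hT
    rw [← Finset.card_sdiff_of_subset hT]
    exact card_thickWords_le_Yrec p.succ_pos _ _
  · rw [Finset.card_eq_zero.mpr, Nat.cast_zero]
    · exact Yrec_nonneg _ _ _ _
    · rw [Finset.eq_empty_iff_forall_notMem]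
      intro w hw
      rw [thickWordsWithExact, Finset.mem_filter, mem_thickWords] at hw
      obtain ⟨x, hx⟩ := Finset.card_pos.mp hw.2
      have h1 := (Finset.mem_filter.mp hx).2
      have h2 := List.count_le_length (a := x) (l := w)
      omega

end WordCounts
section NoncrossingWords

variable {α : Type*} [DecidableEq α]

/-- The word obtained from a binary tree by a depth-first traversal, writing the label of each node
before and after the traversal of its left subtree. Labels are listed in preorder. -/
def treeWord : BinaryTree Unit → List α → List α
  | .nil, _ => []
  | .node _ _ _, [] => []
  | .node _ l r, a :: L =>
    a :: (treeWord l (L.take l.numNodes) ++ a :: treeWord r (L.drop l.numNodes))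

/-- No two distinct letters occur in the order `a, b, a, b`. -/
def Noncrossing (w : List α) : Prop := ∀ a b, a ≠ b → ¬ List.Sublist [a, b, a, b] w

theorem exists_eq_append_of_count_eq_one {a : α} {w : List α} (h : w.count a = 1) :
    ∃ u v, w = u ++ a :: v ∧ a ∉ u ∧ a ∉ v := by
  obtain ⟨u, v, rfl, hu⟩ := List.eq_append_cons_of_mem (List.count_pos_iff.mp (by omega : 0 < w.count a))
  refine ⟨u, v, rfl, hu, ?_⟩
  rw [List.count_append, List.count_cons_self, List.count_eq_zero_of_not_mem hu] at h
  exact List.count_eq_zero.mp (by omega)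

theorem exists_treeWord_eq (u : List α) (hc : ∀ x ∈ u, u.count x = 2) (hn : Noncrossing u) :
    ∃ (t : BinaryTree Unit) (L : List α), t.numNodes = L.length ∧ L.Nodup ∧
      (∀ x, x ∈ L ↔ x ∈ u) ∧ treeWord t L = u := by
  induction h : u.length using Nat.strong_induction_on generalizing u with
  | _ N ih =>
    rcases u with _ | ⟨a, u'⟩
    · exact ⟨.nil, [], rfl, List.nodup_nil, fun _ => Iff.rfl, rfl⟩
    · have ha : u'.count a = 1 := by simpa using hc a List.mem_cons_self
      obtain ⟨u1, u2, rfl, h1, h2⟩ := exists_eq_append_of_count_eq_one ha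
      have hdisj : ∀ x ∈ u1, x ∉ u2 := by
        intro x hx1 hx2
        refine hn a x (fun h => h1 (h ▸ hx1)) ?_
        refine List.Sublist.cons_cons a ?_
        refine (List.singleton_sublist.mpr hx1).append ?_
        exact List.Sublist.cons_cons a (List.singleton_sublist.mpr hx2)
      have hc1 : ∀ x ∈ u1, u1.count x = 2 := by
        intro x hx
        have := hc x (by simp [hx])
        have hxa : a ≠ x := fun h => h1 (h ▸ hx)
        simpa [List.count_cons, hxa, List.count_eq_zero_of_not_mem (hdisj x hx)] using this
      have hc2 : ∀ x ∈ u2, u2.count x = 2 := by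
        intro x hx
        have := hc x (by simp [hx])
        have hxa : a ≠ x := fun h => h2 (h ▸ hx)
        have hx1 : x ∉ u1 := fun h => hdisj x h hx
        simpa [List.count_cons, hxa, List.count_eq_zero_of_not_mem hx1] using this
      have hn1 : Noncrossing u1 := fun b c hbc hs => hn b c hbc
        ((hs.trans (List.sublist_append_left _ _)).trans (List.sublist_cons_self _ _))
      have hn2 : Noncrossing u2 := fun b c hbc hs => hn b c hbc
        (((hs.trans (List.sublist_cons_self _ _)).trans (List.sublist_append_right _ _)).trans
          (List.sublist_cons_self _ _))
      simp only [List.length_cons, List.length_append] at h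
      obtain ⟨t1, L1, e1, d1, m1, w1⟩ := ih u1.length (by omega) u1 hc1 hn1 rfl
      obtain ⟨t2, L2, e2, d2, m2, w2⟩ := ih u2.length (by omega) u2 hc2 hn2 rfl
      refine ⟨.node () t1 t2, a :: (L1 ++ L2), ?_, ?_, ?_, ?_⟩
      · simp [BinaryTree.numNodes, e1, e2]
      · rw [List.nodup_cons, List.nodup_append']
        refine ⟨by simp [m1, m2, h1, h2], d1, d2, fun x hx1 hx2 => ?_⟩
        exact hdisj x ((m1 x).mp hx1) ((m2 x).mp hx2)
      · intro x
        simp only [List.mem_cons, List.mem_append, m1, m2]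
        tauto
      · simp [treeWord, e1, w1, w2]

open Classical in
/-- The noncrossing words in which each letter of `T` occurs exactly twice. -/
noncomputable def noncrossingWords (T : Finset α) : Finset (List α) :=
  (exactWords 2 T).filter Noncrossing

theorem mem_noncrossingWords {T : Finset α} {w : List α} :
    w ∈ noncrossingWords T ↔ w ∈ exactWords 2 T ∧ Noncrossing w := by
  unfold noncrossingWords
  exact @Finset.mem_filter _ _ (_) _ _

theorem noncrossingWords_subset (T : Finset α) : noncrossingWords T ⊆ exactWords 2 T :=
  fun _ h => (mem_noncrossingWords.mp h).1

theorem card_noncrossingWords_mul_le (T : Finset α) :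
    (noncrossingWords T).card * (T.card + 1).factorial ≤ (2 * T.card).factorial := by
  have hle : (noncrossingWords T).card ≤ catalan T.card * T.card.factorial := by
    calc (noncrossingWords T).card
        ≤ ((BinaryTree.treesOfNumNodesEq T.card ×ˢ T.toList.permutations.toFinset).image
            fun q => treeWord q.1 q.2).card := by
          refine Finset.card_le_card fun u hu => ?_
          rw [mem_noncrossingWords, mem_exactWords] at hu
          obtain ⟨⟨hT, hc⟩, hn⟩ := hu
          obtain ⟨t, L, ht, hL, hm, rfl⟩ := exists_treeWord_eq u (fun x hx => hc x (hT x hx)) hn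
          have hperm : L.Perm T.toList := by
            rw [List.perm_ext_iff_of_nodup hL T.nodup_toList]
            intro x
            rw [hm, Finset.mem_toList]
            refine ⟨hT x, fun hx => List.count_pos_iff.mp ?_⟩
            rw [hc x hx]
            exact two_pos
          refine Finset.mem_image.mpr ⟨(t, L), Finset.mem_product.mpr ⟨?_, ?_⟩, rfl⟩
          · rw [BinaryTree.mem_treesOfNumNodesEq, ht, hperm.length_eq, Finset.length_toList]
          · rw [List.mem_toFinset, List.mem_permutations]
            exact hperm
      _ ≤ _ := by
          refine Finset.card_image_le.trans ?_
          rw [Finset.card_product, BinaryTree.treesOfNumNodesEq_card_eq_catalan]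
          refine Nat.mul_le_mul_left _ ((List.toFinset_card_le _).trans ?_)
          rw [List.length_permutations, Finset.length_toList]
  refine (Nat.mul_le_mul_right _ hle).trans (le_of_eq ?_)
  have h1 := succ_mul_catalan_eq_centralBinom T.card
  have h2 := Nat.choose_mul_factorial_mul_factorial (Nat.le_mul_of_pos_left T.card two_pos)
  rw [← Nat.centralBinom_eq_two_mul_choose, ← h1] at h2
  rw [← h2, Nat.factorial_succ, show 2 * T.card - T.card = T.card by omega]
  ring

/-- The words over `B` of length `l` with no letter occurring exactly once, whose letters occurring
exactly twice are those of `T` and form a noncrossing word, and whose other letters form a word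
of `V`. -/
noncomputable def noncrossingClass (B : Finset α) (l : ℕ) (V : Finset (List α)) (T : Finset α) :
    Finset (List α) :=
  (thickWords 2 B l).filter fun w => lettersWithCount 2 B w = T ∧
    w.filter (fun x => decide (x ∈ T)) ∈ noncrossingWords T ∧
    w.filter (fun x => !decide (x ∈ T)) ∈ V

theorem card_noncrossingClass_le (B : Finset α) (l : ℕ) (V : Finset (List α)) (T : Finset α)
    (h : 2 * T.card ≤ l) :
    ((noncrossingClass B l V T).card : ℝ) ≤ ((1 : ℝ) / 2) ^ T.card *
      ((Nat.factorial l : ℝ) / (Nat.factorial (l - 2 * T.card) : ℝ)) *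
      ((2 : ℝ) ^ T.card / (Nat.factorial (T.card + 1) : ℝ)) * V.card := by
  have hcard := card_le_of_lettersWithCount_eq (p := 2) (l := l) (B := B) (T := T)
    (noncrossingClass B l V T) (noncrossingWords T) V
    (fun w hw => by
      rw [noncrossingClass, Finset.mem_filter] at hw; exact ⟨hw.1, hw.2.1⟩)
    (fun w hw => by rw [noncrossingClass, Finset.mem_filter] at hw; exact hw.2.2.1)
    (fun w hw => by rw [noncrossingClass, Finset.mem_filter] at hw; exact hw.2.2.2)
    (noncrossingWords_subset T)
  have hN : ((noncrossingWords T).card : ℝ) ≤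
      ((2 * T.card).factorial : ℝ) / (T.card + 1).factorial := by
    rw [le_div_iff₀ (by positivity)]
    exact_mod_cast card_noncrossingWords_mul_le T
  calc _ ≤ (l.choose (2 * T.card) : ℝ) * ((noncrossingWords T).card * V.card) := by
        exact_mod_cast hcard
    _ ≤ (l.choose (2 * T.card) : ℝ) *
          (((2 * T.card).factorial : ℝ) / (T.card + 1).factorial * V.card) := by gcongr
    _ = _ := by
        rw [Nat.cast_choose ℝ h, div_pow, one_pow]
        field_simp

theorem noncrossingClass_eq_empty {B : Finset α} {l : ℕ} {V : Finset (List α)} {T : Finset α}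
    (h : l < 2 * T.card) : noncrossingClass B l V T = ∅ := by
  rw [Finset.eq_empty_iff_forall_notMem]
  intro w hw
  rw [noncrossingClass, Finset.mem_filter, mem_thickWords] at hw
  have h1 := mem_exactWords.mp (noncrossingWords_subset T hw.2.2.1)
  have h2 := length_eq_of_count_eq h1.1 h1.2
  have h3 := List.length_filter_le (fun x => decide (x ∈ T)) w
  omega

/-- Summing a function on words that is bounded in terms of the multiplicities of the letters and
of the crossings between the letters occurring twice. -/
theorem sum_wordsOver_le_of_bounds {d m : ℕ} {N : ℝ} (hN : 0 ≤ N) (F : List (Fin d) → ℝ)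
    (hF : ∀ w, F w ≤ N) (h1 : ∀ w a, w.count a = 1 → F w ≤ 1)
    (h2 : ∀ w a b, a ≠ b → w.count a = 2 → w.count b = 2 → List.Sublist [a, b, a, b] w → F w ≤ 2)
    (h3 : ∀ w a, w.count a = 3 → F w ≤ 5) :
    ∑ w ∈ wordsOver Finset.univ (2 * m), F w ≤
      Yrec 1 1 (2 * m) d + 2 * Yrec 2 1 (2 * m) d +
      ∑ i ∈ Finset.Icc 0 m, (d.choose i : ℝ) * (((1 : ℝ) / 2) ^ i *
        ((Nat.factorial (2 * m) : ℝ) / (Nat.factorial (2 * m - 2 * i) : ℝ)) *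
        ((2 : ℝ) ^ i / (Nat.factorial (i + 1) : ℝ)) *
        (5 * Yrec 3 1 (2 * m - 2 * i) (d - i) + N * Yrec 4 0 (2 * m - 2 * i) (d - i))) := by
  classical
  set B : Finset (Fin d) := Finset.univ with hB
  have hBc : B.card = d := by simp [hB]
  set l := 2 * m with hl
  let Q : Finset (Fin d) → Finset (List (Fin d)) := fun T =>
    noncrossingClass B l (thickWordsWithExact 3 (B \ T) (l - 2 * T.card)) T
  let R : Finset (Fin d) → Finset (List (Fin d)) := fun T =>
    noncrossingClass B l (thickWords 4 (B \ T) (l - 2 * T.card)) T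
  have ind : ∀ (S : Finset (List (Fin d))) (w), (0 : ℝ) ≤ if w ∈ S then 1 else 0 := by
    intro S w; split_ifs <;> norm_num
  have key : ∀ w ∈ wordsOver B l, F w ≤ (if w ∈ thickWordsWithExact 1 B l then 1 else 0) +
      2 * (if w ∈ thickWordsWithExact 2 B l then 1 else 0) +
      ∑ T ∈ B.powerset, (5 * (if w ∈ Q T then 1 else 0) + N * (if w ∈ R T then 1 else 0)) := by
    intro w hw
    have hw' := mem_wordsOver.mp hw
    have hS : ∀ T, 0 ≤ 5 * (if w ∈ Q T then (1 : ℝ) else 0) + N * (if w ∈ R T then 1 else 0) :=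
      fun T => add_nonneg (mul_nonneg (by norm_num) (ind _ _)) (mul_nonneg hN (ind _ _))
    have hsum := Finset.sum_nonneg fun T (_ : T ∈ B.powerset) => hS T
    have i1 := ind (thickWordsWithExact 1 B l) w
    have i2 := ind (thickWordsWithExact 2 B l) w
    by_cases c1 : ∃ a, w.count a = 1
    · obtain ⟨a, ha⟩ := c1
      have hmem : w ∈ thickWordsWithExact 1 B l := by
        rw [thickWordsWithExact, Finset.mem_filter, mem_thickWords]
        exact ⟨⟨hw', fun x hx => List.count_pos_iff.mpr hx⟩,
          Finset.card_pos.mpr ⟨a, Finset.mem_filter.mpr ⟨Finset.mem_univ _, ha⟩⟩⟩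
      rw [if_pos hmem]
      linarith [h1 w a ha]
    have hthick : w ∈ thickWords 2 B l := by
      rw [mem_thickWords]
      refine ⟨hw', fun x hx => ?_⟩
      have := List.count_pos_iff.mpr hx
      have := not_exists.mp c1 x
      omega
    set T := lettersWithCount 2 B w with hT
    have hTm : ∀ a, a ∈ T ↔ w.count a = 2 := fun a => by simp [hT, lettersWithCount, hB]
    by_cases c2 : Noncrossing (w.filter fun x => decide (x ∈ T))
    · have hTP : T ∈ B.powerset := Finset.mem_powerset.mpr (Finset.subset_univ _)
      have hsing := Finset.single_le_sum (fun T _ => hS T) hTP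
      have hnc : w.filter (fun x => decide (x ∈ T)) ∈ noncrossingWords T :=
        mem_noncrossingWords.mpr ⟨filter_mem_exactWords fun a ha => (hTm a).mp ha, c2⟩
      have hrest := filter_notMem_mem_thickWords hthick hT.symm
      have hFw : F w ≤ 5 * (if w ∈ Q T then (1 : ℝ) else 0) + N * (if w ∈ R T then 1 else 0) := by
        by_cases c3 : ∃ a, w.count a = 3
        · obtain ⟨a, ha⟩ := c3
          have haT : a ∉ T := fun h => by rw [hTm] at h; omega
          have hQ : w ∈ Q T := by
            refine Finset.mem_filter.mpr ⟨hthick, hT.symm, hnc, ?_⟩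
            refine Finset.mem_filter.mpr ⟨hrest, Finset.card_pos.mpr ⟨a, ?_⟩⟩
            refine Finset.mem_filter.mpr ⟨Finset.mem_sdiff.mpr ⟨Finset.mem_univ _, haT⟩, ?_⟩
            rw [count_filter_notMem _ _ haT, ha]
          rw [if_pos hQ]
          linarith [h3 w a ha, mul_nonneg hN (ind (R T) w)]
        · have hR : w ∈ R T := by
            refine Finset.mem_filter.mpr ⟨hthick, hT.symm, hnc, ?_⟩
            rw [mem_thickWords] at hrest ⊢
            refine ⟨hrest.1, fun x hx => lt_of_le_of_ne (hrest.2 x hx) fun h => c3 ⟨x, ?_⟩⟩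
            rw [← count_filter_notMem T w (by simpa using (List.mem_filter.mp hx).2), ← h]
          rw [if_pos hR]
          linarith [hF w, ind (Q T) w]
      linarith
    · simp only [Noncrossing, not_forall, not_not] at c2
      obtain ⟨a, b, hab, hs⟩ := c2
      have hmemT : ∀ x ∈ [a, b, a, b], x ∈ T := fun x hx => by
        simpa using (List.mem_filter.mp (hs.subset hx)).2
      have ha := (hTm a).mp (hmemT a (by simp))
      have hb := (hTm b).mp (hmemT b (by simp))
      have hmem : w ∈ thickWordsWithExact 2 B l :=
        Finset.mem_filter.mpr ⟨hthick, Finset.card_pos.mpr ⟨a, hmemT a (by simp)⟩⟩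
      rw [if_pos hmem]
      linarith [h2 w a b hab ha hb (hs.trans List.filter_sublist)]
  have hcount : ∀ S ⊆ wordsOver B l,
      ∑ w ∈ wordsOver B l, (if w ∈ S then (1 : ℝ) else 0) = S.card := by
    intro S hS
    rw [← Finset.sum_filter, Finset.sum_const, nsmul_eq_mul, mul_one,
      Finset.filter_mem_eq_inter, Finset.inter_eq_right.mpr hS]
  refine (Finset.sum_le_sum key).trans ?_
  rw [Finset.sum_add_distrib, Finset.sum_add_distrib, ← Finset.mul_sum, Finset.sum_comm]
  simp only [Finset.sum_add_distrib (s := wordsOver B l), ← Finset.mul_sum]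
  have sub1 : ∀ p, thickWordsWithExact p B l ⊆ wordsOver B l := fun p =>
    (Finset.filter_subset _ _).trans (thickWords_subset p B l)
  have sub2 : ∀ V T, noncrossingClass B l V T ⊆ wordsOver B l := fun V T =>
    (Finset.filter_subset _ _).trans (thickWords_subset 2 B l)
  rw [hcount _ (sub1 1), hcount _ (sub1 2)]
  have e1 := card_thickWordsWithExact_le_Yrec one_pos B l
  have e2 := card_thickWordsWithExact_le_Yrec two_pos B l
  rw [hBc] at e1 e2
  refine add_le_add (by linarith) ?_
  have hlm : m = l / 2 := by omega
  rw [hlm]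
  conv_rhs => rw [← hBc]
  refine sum_powerset_le_sum_Icc B two_pos
    (fun i => ((1 : ℝ) / 2) ^ i *
        ((Nat.factorial l : ℝ) / (Nat.factorial (l - 2 * i) : ℝ)) *
        ((2 : ℝ) ^ i / (Nat.factorial (i + 1) : ℝ)) *
        (5 * Yrec 3 1 (l - 2 * i) (B.card - i) + N * Yrec 4 0 (l - 2 * i) (B.card - i)))
    (fun i => ?_) _ ?_ ?_ ?_
  · have := Yrec_nonneg 3 1 (l - 2 * i) (B.card - i)
    have := Yrec_nonneg 4 0 (l - 2 * i) (B.card - i)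
    positivity
  · intro T hT _ hle
    rw [hcount _ (sub2 _ _), hcount _ (sub2 _ _)]
    have q1 := card_noncrossingClass_le B l (thickWordsWithExact 3 (B \ T) (l - 2 * T.card)) T hle
    have q2 := card_noncrossingClass_le B l (thickWords 4 (B \ T) (l - 2 * T.card)) T hle
    have y1 := card_thickWordsWithExact_le_Yrec three_pos (B \ T) (l - 2 * T.card)
    have y2 := card_thickWords_le_Yrec four_pos (B \ T) (l - 2 * T.card)
    rw [Finset.card_sdiff_of_subset (Finset.subset_univ T)] at y1 y2
    rw [mul_add]
    refine add_le_add ?_ ?_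
    · rw [mul_left_comm]
      refine mul_le_mul_of_nonneg_left (q1.trans ?_) (by norm_num)
      gcongr
    · rw [mul_left_comm]
      refine mul_le_mul_of_nonneg_left (q2.trans ?_) hN
      gcongr
  · intro T _ h
    omega
  · intro T _ h
    simp only [Q, R, noncrossingClass_eq_empty h]
    simp

end NoncrossingWords
/-- The indicator of equality, as a real number. -/
def kron {X : Type*} [DecidableEq X] (a b : X) : ℝ := if a = b then 1 else 0

section Kron

variable {X : Type*} [DecidableEq X]

theorem kron_nonneg (a b : X) : 0 ≤ kron a b := by
  unfold kron; split_ifs <;> norm_num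

theorem kron_le_one (a b : X) : kron a b ≤ 1 := by
  unfold kron; split_ifs <;> norm_num

theorem kron_self (a : X) : kron a a = 1 := if_pos rfl

theorem kron_of_ne {a b : X} (h : a ≠ b) : kron a b = 0 := if_neg h

theorem kron_mem (a b : X) : 0 ≤ kron a b ∧ kron a b ≤ 1 := ⟨kron_nonneg a b, kron_le_one a b⟩

theorem one_sub_kron_nonneg (a b : X) : 0 ≤ 1 - kron a b := sub_nonneg.mpr (kron_le_one a b)

theorem one_sub_kron_le_one (a b : X) : 1 - kron a b ≤ 1 := by
  linarith [kron_nonneg a b]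

variable {G : Type*} [Group G] [MulAction G X]

/-- A group element or its inverse, according to a sign. -/
def signed (ε : Bool) (t : G) : G := if ε then t else t⁻¹

theorem signed_signed (ε δ : Bool) (t : G) : signed δ (signed ε t) = signed (δ == ε) t := by
  cases ε <;> cases δ <;> simp [signed]

theorem kron_signed_smul (ε : Bool) (t : G) (a b : X) :
    kron (signed ε t • a) b = kron (t • (if ε then a else b)) (if ε then b else a) := by
  cases ε
  · simp only [signed, kron, inv_smul_eq_iff, Bool.false_eq_true, if_false]
    simp only [eq_comm (a := a)]
  · simp [signed]

theorem kron_smul_mul_kron_smul_eq_zero {a a' b b' : X} (h : ¬ (a = a' ↔ b = b')) (t : G) :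
    kron (t • a) b * kron (t • a') b' = 0 := by
  unfold kron
  split_ifs with h1 h2 <;> simp
  apply h
  rw [← h1, ← h2, smul_left_cancel_iff]

theorem kron_mul_smul_of_fixed {g : G} {b : X} (hg : g • b = b) (t : G) (a : X) :
    kron ((g * t) • a) b = kron (t • a) b := by
  conv_lhs => rw [← hg]
  simp only [kron, mul_smul, smul_left_cancel_iff]

variable [Fintype X]

theorem sum_kron_left (a : X) : ∑ z, kron a z = 1 := by simp [kron]

theorem sum_kron_right (a : X) : ∑ z, kron z a = 1 := by simp [kron]

theorem sum_one_sub_kron_left (a : X) : ∑ z, (1 - kron a z) = (Fintype.card X : ℝ) - 1 := by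
  rw [Finset.sum_sub_distrib, sum_kron_left]; simp

theorem sum_kron_smul_left (g : G) (a : X) : ∑ z, kron a (g • z) = 1 := by
  rw [← sum_kron_left a]
  exact Equiv.sum_comp (MulAction.toPerm g) (kron a)

theorem sum_kron_smul_right (g : G) (a : X) : ∑ z, kron (g • z) a = 1 := by
  rw [← sum_kron_right a]
  exact Equiv.sum_comp (MulAction.toPerm g) (fun z => kron z a)

theorem sum_one_sub_kron_smul_left (g : G) (a : X) :
    ∑ z, (1 - kron a (g • z)) = (Fintype.card X : ℝ) - 1 := by
  rw [Finset.sum_sub_distrib, sum_kron_smul_left]; simp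

variable (X) in
/-- The number of fixed points of a group element. -/
def fixCount (g : G) : ℝ := ∑ x : X, kron (g • x) x

theorem fixCount_le_card (g : G) : fixCount X g ≤ Fintype.card X := by
  rw [fixCount]
  exact (Finset.sum_le_sum fun x _ => kron_le_one (g • x) x).trans (by simp)

theorem fixCount_mul_comm (g h : G) : fixCount X (g * h) = fixCount X (h * g) := by
  rw [fixCount, fixCount, ← Equiv.sum_comp (MulAction.toPerm h) fun y => kron ((h * g) • y) y]
  refine Finset.sum_congr rfl fun x _ => ?_
  simp only [kron, MulAction.toPerm_apply, mul_smul, smul_left_cancel_iff]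

theorem fixCount_mul₄ (g₁ g₂ g₃ g₄ A B C D : G) :
    fixCount X (g₁ * A * g₂ * B * g₃ * C * g₄ * D) =
      ∑ z₁ : X, ∑ z₂ : X, ∑ z₃ : X, ∑ z₄ : X,
        (kron (g₁ • A • z₂) z₁ * kron (g₃ • C • z₄) z₃) *
          (kron (g₂ • B • z₃) z₂ * kron (g₄ • D • z₁) z₄) := by
  rw [fixCount]
  refine Finset.sum_congr rfl fun z₁ _ => ?_
  have : ∀ z₂ z₃ z₄ : X, (kron (g₁ • A • z₂) z₁ * kron (g₃ • C • z₄) z₃) *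
          (kron (g₂ • B • z₃) z₂ * kron (g₄ • D • z₁) z₄) =
      if z₄ = g₄ • D • z₁ then (if z₃ = g₃ • C • z₄ then
        (if z₂ = g₂ • B • z₃ then kron (g₁ • A • z₂) z₁ else 0) else 0) else 0 := by
    intro z₂ z₃ z₄
    simp only [kron, eq_comm (a := z₂), eq_comm (a := z₃), eq_comm (a := z₄)]
    split_ifs <;> simp
  simp only [this, Finset.sum_ite_eq', Finset.mem_univ, if_true, mul_smul]

theorem fixCount_mul₃ (g₁ g₂ g₃ A B C : G) :
    fixCount X (g₁ * A * g₂ * B * g₃ * C) =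
      ∑ z₁ : X, ∑ z₂ : X, ∑ z₃ : X,
        kron (g₁ • A • z₂) z₁ * (kron (g₂ • B • z₃) z₂ * kron (g₃ • C • z₁) z₃) := by
  rw [fixCount]
  refine Finset.sum_congr rfl fun z₁ _ => ?_
  have : ∀ z₂ z₃ : X, kron (g₁ • A • z₂) z₁ * (kron (g₂ • B • z₃) z₂ * kron (g₃ • C • z₁) z₃) =
      if z₃ = g₃ • C • z₁ then (if z₂ = g₂ • B • z₃ then kron (g₁ • A • z₂) z₁ else 0) else 0 := by
    intro z₂ z₃
    simp only [kron, eq_comm (a := z₂), eq_comm (a := z₃)]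
    split_ifs <;> simp
  simp only [this, Finset.sum_ite_eq', Finset.mem_univ, if_true, mul_smul]

end Kron

/-- A finite group acting on a finite set like `GL_k(F₂)` acts on the nonzero vectors of `F₂^k`:
the number of group elements with prescribed values at one, two or three points in general position
is at most what transitivity gives. Here `τ a b c` stands for `a + b + c = 0`. -/
structure IsLineAction (G X : Type*) [Group G] [Fintype G] [DecidableEq X] [Fintype X]
    [MulAction G X] (τ : X → X → X → Prop) : Prop where
  card_one : ∀ a b : X, (∑ t : G, kron (t • a) b) * Fintype.card X ≤ Fintype.card G
  card_two : ∀ a a' b b' : X, a ≠ a' → (∑ t : G, kron (t • a) b * kron (t • a') b') *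
    (Fintype.card X * (Fintype.card X - 1)) ≤ Fintype.card G
  card_three : ∀ a₁ a₂ a₃ b₁ b₂ b₃ : X, a₁ ≠ a₂ → a₁ ≠ a₃ → a₂ ≠ a₃ → ¬ τ a₁ a₂ a₃ →
    (∑ t : G, kron (t • a₁) b₁ * (kron (t • a₂) b₂ * kron (t • a₃) b₃)) *
      (Fintype.card X * ((Fintype.card X - 1) * (Fintype.card X - 3))) ≤ Fintype.card G
  smul_iff : ∀ (g : G) (a b c : X), τ (g • a) (g • b) (g • c) ↔ τ a b c
  ne : ∀ a b c, τ a b c → a ≠ b ∧ a ≠ c ∧ b ≠ c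
  unique_right : ∀ a b c c', τ a b c → τ a b c' → c = c'
  unique_mid : ∀ a b b' c, τ a b c → τ a b' c → b = b'
section Crossing

variable {G X : Type*} [Group G] [Fintype G] [DecidableEq X] [Fintype X] [MulAction G X]
  {τ : X → X → X → Prop}

/-- The weight of a pair of constraints `a ↦ b`, `a' ↦ b'` on a random group element. -/
noncomputable def pairWeight (a a' b b' : X) : ℝ :=
  kron a a' * kron b b' + (1 - kron a a') * (1 - kron b b') / (Fintype.card X - 1)

theorem IsLineAction.sum_pair_le (h : IsLineAction G X τ) (hX : 3 ≤ Fintype.card X)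
    (a a' b b' : X) :
    ∑ t : G, kron (t • a) b * kron (t • a') b' ≤
      Fintype.card G / Fintype.card X * pairWeight a a' b b' := by
  have hn : (3 : ℝ) ≤ Fintype.card X := by exact_mod_cast hX
  by_cases ha : a = a'
  · subst ha
    by_cases hb : b = b'
    · subst hb
      have h1 : ∀ t : G, kron (t • a) b * kron (t • a) b = kron (t • a) b := fun t => by
        unfold kron; split_ifs <;> norm_num
      simp only [h1]
      have := h.card_one a b
      rw [← le_div_iff₀ (by linarith)] at this
      simpa [pairWeight, kron] using this
    · have h1 : ∀ t : G, kron (t • a) b * kron (t • a) b' = 0 := fun t => by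
        unfold kron
        split_ifs with h1 h2 <;> simp
        exact hb (h1.symm.trans h2)
      rw [Finset.sum_eq_zero fun t _ => h1 t]
      simp [pairWeight, kron, hb]
  · by_cases hb : b = b'
    · subst hb
      have h1 : ∀ t : G, kron (t • a) b * kron (t • a') b = 0 := fun t => by
        unfold kron
        split_ifs with h1 h2 <;> simp
        exact ha (smul_left_cancel t (h1.trans h2.symm))
      rw [Finset.sum_eq_zero fun t _ => h1 t]
      simp [pairWeight, kron, ha]
    · have := h.card_two a a' b b' ha
      rw [← le_div_iff₀ (mul_pos (by linarith) (by linarith))] at this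
      refine this.trans (le_of_eq ?_)
      simp only [pairWeight, kron, ha, hb, if_false]
      have : (Fintype.card X : ℝ) - 1 ≠ 0 := by linarith
      field_simp
      ring

theorem pairWeight_nonneg (hX : 3 ≤ Fintype.card X) (a a' b b' : X) :
    0 ≤ pairWeight a a' b b' := by
  have hn : (3 : ℝ) ≤ Fintype.card X := by exact_mod_cast hX
  have h0 : (0 : ℝ) ≤ Fintype.card X - 1 := by linarith
  exact add_nonneg (mul_nonneg (kron_nonneg _ _) (kron_nonneg _ _))
    (div_nonneg (mul_nonneg (one_sub_kron_nonneg _ _) (one_sub_kron_nonneg _ _)) h0)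

theorem IsLineAction.sum_fixCount_crossing_le_weights (h : IsLineAction G X τ)
    (hX : 3 ≤ Fintype.card X) (ε δ : Bool) (A B C D : G) :
    ∑ t : G, ∑ r : G, fixCount X (t * A * r * B * signed ε t * C * signed δ r * D) ≤
      (Fintype.card G / Fintype.card X : ℝ) ^ 2 *
        ∑ z₁ : X, ∑ z₂ : X, ∑ z₃ : X, ∑ z₄ : X,
          pairWeight (A • z₂) (if ε then C • z₄ else z₃) z₁ (if ε then z₃ else C • z₄) *
          pairWeight (B • z₃) (if δ then D • z₁ else z₄) z₂ (if δ then z₄ else D • z₁) := by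
  simp only [fixCount_mul₄, kron_signed_smul]
  have swap : ∀ f : G → G → X → X → X → X → ℝ,
      ∑ t, ∑ r, ∑ z₁, ∑ z₂, ∑ z₃, ∑ z₄, f t r z₁ z₂ z₃ z₄ =
        ∑ z₁, ∑ z₂, ∑ z₃, ∑ z₄, ∑ t, ∑ r, f t r z₁ z₂ z₃ z₄ := by
    intro f
    have := Finset.sum_comm (s := (Finset.univ : Finset (G × G)))
      (t := (Finset.univ : Finset (X × X × X × X)))
      (f := fun p z => f p.1 p.2 z.1 z.2.1 z.2.2.1 z.2.2.2)
    simpa only [Fintype.sum_prod_type] using this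
  rw [swap]
  simp only [Finset.mul_sum]
  refine Finset.sum_le_sum fun z₁ _ => Finset.sum_le_sum fun z₂ _ => Finset.sum_le_sum fun z₃ _ =>
    Finset.sum_le_sum fun z₄ _ => ?_
  rw [← Finset.sum_mul_sum, sq, mul_mul_mul_comm]
  refine mul_le_mul (h.sum_pair_le hX _ _ _ _) (h.sum_pair_le hX _ _ _ _)
    (Finset.sum_nonneg fun r _ => mul_nonneg (kron_nonneg _ _) (kron_nonneg _ _))
    (mul_nonneg (by positivity) (pairWeight_nonneg hX _ _ _ _))

end Crossing
section WeightedSums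

variable {X : Type*} [Fintype X]

theorem sum_mul_interleaved (P Q : X → X → ℝ) :
    ∑ z₁, ∑ z₂, ∑ z₃, ∑ z₄, P z₁ z₃ * Q z₂ z₄ = (∑ x, ∑ y, P x y) * ∑ x, ∑ y, Q x y := by
  rw [Finset.sum_mul_sum]
  refine Finset.sum_congr rfl fun z₁ _ => Finset.sum_congr rfl fun z₂ _ => ?_
  rw [Finset.sum_mul_sum]

theorem product_weight_le {a b q r c : ℝ} (ha : 0 ≤ a) (ha' : a ≤ 1) (hb : 0 ≤ b) (hb' : b ≤ 1)
    (hq : 0 ≤ q) (hq' : q ≤ 1) (hr : 0 ≤ r) (hr' : r ≤ 1) (hc : 0 ≤ c) :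
    (a * b + (1 - a) * (1 - b) * c) * (q * r + (1 - q) * (1 - r) * c) ≤
      q * (a * r) + c * ((1 - q) * (a * b)) + c * (q * ((1 - a) * r)) +
        c ^ 2 * ((1 - a) * (1 - b)) := by
  have ha1 : 0 ≤ 1 - a := by linarith
  have hb1 : 0 ≤ 1 - b := by linarith
  have hq1 : 0 ≤ 1 - q := by linarith
  have hr1 : 0 ≤ 1 - r := by linarith
  have e1 : 0 ≤ q * (a * r) * (1 - b) := by positivity
  have e2 : 0 ≤ c * ((1 - q) * (a * b)) * r := by positivity
  have e3 : 0 ≤ c * (q * ((1 - a) * r)) * b := by positivity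
  have e4 : 0 ≤ c ^ 2 * ((1 - a) * (1 - b)) * (q + (1 - q) * r) := by positivity
  nlinarith [e1, e2, e3, e4]

theorem sum_chained_weights_le (hX : 3 ≤ Fintype.card X) (a : X → X → X → ℝ)
    (b : X → X → X → X → ℝ) (q : X → X → ℝ) (r : X → X → ℝ)
    (ha : ∀ x y z, 0 ≤ a x y z ∧ a x y z ≤ 1) (hb : ∀ x y z w, 0 ≤ b x y z w ∧ b x y z w ≤ 1)
    (hq : ∀ x y, 0 ≤ q x y ∧ q x y ≤ 1) (hr : ∀ x y, 0 ≤ r x y ∧ r x y ≤ 1)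
    (sa : ∀ x y, ∑ z, a x y z = 1) (sb : ∀ x y z, ∑ w, b x y z w = 1)
    (sq : ∀ x, ∑ y, q x y = 1) (sr : ∀ x, ∑ y, r x y = 1) :
    ∑ z₁, ∑ z₂, ∑ z₃, ∑ z₄,
      (a z₁ z₂ z₃ * b z₁ z₂ z₃ z₄ +
        (1 - a z₁ z₂ z₃) * (1 - b z₁ z₂ z₃ z₄) / ((Fintype.card X : ℝ) - 1)) *
      (q z₁ z₂ * r z₃ z₄ + (1 - q z₁ z₂) * (1 - r z₃ z₄) / ((Fintype.card X : ℝ) - 1)) ≤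
        2 * (Fintype.card X : ℝ) ^ 2 := by
  have hn : (3 : ℝ) ≤ Fintype.card X := by exact_mod_cast hX
  set n := (Fintype.card X : ℝ) with hn_def
  have hc : 0 ≤ (n - 1)⁻¹ := inv_nonneg.mpr (by linarith)
  have cardX : ∑ _x : X, (1 : ℝ) = n := by simp [hn_def]
  have sa' : ∀ x y, ∑ z, (1 - a x y z) = n - 1 := fun x y => by
    rw [Finset.sum_sub_distrib, sa, cardX]
  have sb' : ∀ x y z, ∑ w, (1 - b x y z w) = n - 1 := fun x y z => by
    rw [Finset.sum_sub_distrib, sb, cardX]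
  have sq' : ∀ x, ∑ y, (1 - q x y) = n - 1 := fun x => by
    rw [Finset.sum_sub_distrib, sq, cardX]
  calc _ ≤ ∑ z₁, ∑ z₂, ∑ z₃, ∑ z₄, (q z₁ z₂ * (a z₁ z₂ z₃ * r z₃ z₄) +
        (n - 1)⁻¹ * ((1 - q z₁ z₂) * (a z₁ z₂ z₃ * b z₁ z₂ z₃ z₄)) +
        (n - 1)⁻¹ * (q z₁ z₂ * ((1 - a z₁ z₂ z₃) * r z₃ z₄)) +
        (n - 1)⁻¹ ^ 2 * ((1 - a z₁ z₂ z₃) * (1 - b z₁ z₂ z₃ z₄))) := by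
        refine Finset.sum_le_sum fun z₁ _ => Finset.sum_le_sum fun z₂ _ =>
          Finset.sum_le_sum fun z₃ _ => Finset.sum_le_sum fun z₄ _ => ?_
        simp only [div_eq_mul_inv]
        exact product_weight_le (ha _ _ _).1 (ha _ _ _).2 (hb _ _ _ _).1 (hb _ _ _ _).2
          (hq _ _).1 (hq _ _).2 (hr _ _).1 (hr _ _).2 hc
    _ = n + (n - 1)⁻¹ * (n * (n - 1)) + (n - 1)⁻¹ * (n * (n - 1)) +
        (n - 1)⁻¹ ^ 2 * (n * (n * (n - 1) * (n - 1))) := by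
        simp only [Finset.sum_add_distrib, ← Finset.mul_sum, ← Finset.sum_mul, sa, sb, sq, sr,
          sa', sb', sq', mul_one, cardX, Finset.sum_const, Finset.card_univ, nsmul_eq_mul]
        simp only [← hn_def]
        ring
    _ ≤ 2 * n ^ 2 := by
        have h1 : n - 1 ≠ 0 := by linarith
        field_simp
        nlinarith

theorem sum_product_weights_le (hX : 3 ≤ Fintype.card X) (e e' h h' : X → X → ℝ)
    (he : ∀ x y, 0 ≤ e x y ∧ e x y ≤ 1) (he' : ∀ x y, 0 ≤ e' x y ∧ e' x y ≤ 1)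
    (hh : ∀ x y, 0 ≤ h x y ∧ h x y ≤ 1) (hh' : ∀ x y, 0 ≤ h' x y ∧ h' x y ≤ 1)
    (se : ∀ x, ∑ y, e x y = 1) (se' : ∀ x, ∑ y, e' x y = 1)
    (sh : ∀ x, ∑ y, h x y = 1) (sh' : ∀ x, ∑ y, h' x y = 1) :
    ∑ z₁, ∑ z₂, ∑ z₃, ∑ z₄,
      (e' z₂ z₄ * e z₁ z₃ + (1 - e' z₂ z₄) * (1 - e z₁ z₃) / ((Fintype.card X : ℝ) - 1)) *
      (h z₁ z₃ * h' z₂ z₄ + (1 - h z₁ z₃) * (1 - h' z₂ z₄) / ((Fintype.card X : ℝ) - 1)) ≤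
        2 * (Fintype.card X : ℝ) ^ 2 := by
  have hn : (3 : ℝ) ≤ Fintype.card X := by exact_mod_cast hX
  set n := (Fintype.card X : ℝ) with hn_def
  have cardX : ∑ _x : X, (1 : ℝ) = n := by simp [hn_def]
  have sums : ∀ p q : X → X → ℝ, (∀ x y, 0 ≤ p x y ∧ p x y ≤ 1) →
      (∀ x y, 0 ≤ q x y ∧ q x y ≤ 1) → (∀ x, ∑ y, p x y = 1) → (∀ x, ∑ y, q x y = 1) →
      ∃ f : ℝ, 0 ≤ f ∧ f ≤ n ∧ (∑ x, ∑ y, p x y * q x y = f) ∧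
        (∑ x, ∑ y, p x y * (1 - q x y) = n - f) ∧ (∑ x, ∑ y, (1 - p x y) * q x y = n - f) ∧
        (∑ x, ∑ y, (1 - p x y) * (1 - q x y) = n ^ 2 - 2 * n + f) := by
    intro p q hp hq sp sq
    refine ⟨∑ x, ∑ y, p x y * q x y, ?_, ?_, rfl, ?_, ?_, ?_⟩
    · exact Finset.sum_nonneg fun x _ => Finset.sum_nonneg fun y _ =>
        mul_nonneg (hp x y).1 (hq x y).1
    · calc _ ≤ ∑ x, ∑ y, p x y := Finset.sum_le_sum fun x _ => Finset.sum_le_sum fun y _ =>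
            mul_le_of_le_one_right (hp x y).1 (hq x y).2
        _ = n := by simp only [sp, cardX]
    · simp only [mul_sub, mul_one, Finset.sum_sub_distrib, sp, cardX]
    · simp only [sub_mul, one_mul, Finset.sum_sub_distrib, sq, cardX]
    · simp only [sub_mul, mul_sub, one_mul, mul_one, Finset.sum_sub_distrib, sp, sq, cardX,
        Finset.sum_const, Finset.card_univ, nsmul_eq_mul]
      simp only [← hn_def]
      ring
  obtain ⟨f, f0, fn, f1, f2, f3, f4⟩ := sums e h he hh se sh
  obtain ⟨g, g0, gn, g1, g2, g3, g4⟩ := sums e' h' he' hh' se' sh'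
  have expand : ∀ z₁ z₂ z₃ z₄ : X,
      (e' z₂ z₄ * e z₁ z₃ + (1 - e' z₂ z₄) * (1 - e z₁ z₃) / (n - 1)) *
        (h z₁ z₃ * h' z₂ z₄ + (1 - h z₁ z₃) * (1 - h' z₂ z₄) / (n - 1)) =
      (e z₁ z₃ * h z₁ z₃) * (e' z₂ z₄ * h' z₂ z₄) +
      (n - 1)⁻¹ * ((e z₁ z₃ * (1 - h z₁ z₃)) * (e' z₂ z₄ * (1 - h' z₂ z₄))) +
      (n - 1)⁻¹ * (((1 - e z₁ z₃) * h z₁ z₃) * ((1 - e' z₂ z₄) * h' z₂ z₄)) +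
      (n - 1)⁻¹ ^ 2 * (((1 - e z₁ z₃) * (1 - h z₁ z₃)) * ((1 - e' z₂ z₄) * (1 - h' z₂ z₄))) := by
    intro z₁ z₂ z₃ z₄
    rw [div_eq_mul_inv, div_eq_mul_inv]
    ring
  have interleaved := fun P Q : X → X → ℝ => sum_mul_interleaved P Q
  simp only [expand, Finset.sum_add_distrib, ← Finset.mul_sum (a := (n - 1)⁻¹),
    ← Finset.mul_sum (a := (n - 1)⁻¹ ^ 2)]
  rw [interleaved (fun x y => e x y * h x y) (fun x y => e' x y * h' x y),
    interleaved (fun x y => e x y * (1 - h x y)) (fun x y => e' x y * (1 - h' x y)),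
    interleaved (fun x y => (1 - e x y) * h x y) (fun x y => (1 - e' x y) * h' x y),
    interleaved (fun x y => (1 - e x y) * (1 - h x y)) (fun x y => (1 - e' x y) * (1 - h' x y)),
    f1, f2, f3, f4, g1, g2, g3, g4]
  have h1 : 0 < n - 1 := by linarith
  have key : 2 * n ^ 2 - (f * g + (n - 1)⁻¹ * ((n - f) * (n - g)) +
      (n - 1)⁻¹ * ((n - f) * (n - g)) +
      (n - 1)⁻¹ ^ 2 * ((n ^ 2 - 2 * n + f) * (n ^ 2 - 2 * n + g))) =
      n ^ 2 / (n - 1) ^ 2 * ((n - 1) * ((n - f) + (n - g)) - (n - f) * (n - g)) := by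
    have := h1.ne'
    field_simp
    ring
  have : 0 ≤ (n - 1) * ((n - f) + (n - g)) - (n - f) * (n - g) := by
    nlinarith [mul_nonneg (sub_nonneg.mpr fn) g0, mul_nonneg (sub_nonneg.mpr gn) f0]
  have : 0 ≤ n ^ 2 / (n - 1) ^ 2 * ((n - 1) * ((n - f) + (n - g)) - (n - f) * (n - g)) :=
    mul_nonneg (by positivity) this
  linarith

end WeightedSums
section CrossingBound

variable {G X : Type*} [Group G] [Fintype G] [DecidableEq X] [Fintype X] [MulAction G X]
  {τ : X → X → X → Prop}

theorem le_two_mul_sq_of_le_div_sq_mul {W c : ℝ} {n N : ℝ} (hn : 0 < n)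
    (h : W ≤ (N / n) ^ 2 * c) (hc : c ≤ 2 * n ^ 2) : W ≤ 2 * N ^ 2 := by
  refine h.trans ((mul_le_mul_of_nonneg_left hc (by positivity)).trans (le_of_eq ?_))
  field_simp

theorem sum_signed (ε : Bool) (f : G → ℝ) : ∑ t, f (signed ε t) = ∑ t, f t := by
  cases ε
  · exact Equiv.sum_comp (Equiv.inv G) f
  · rfl

theorem IsLineAction.sum_fixCount_crossing_le_of_pos (h : IsLineAction G X τ)
    (hX : 3 ≤ Fintype.card X) (ε δ : Bool) (hεδ : ε = true ∨ δ = false) (A B C D : G) :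
    ∑ t : G, ∑ r : G, fixCount X (t * A * r * B * signed ε t * C * signed δ r * D) ≤
      2 * (Fintype.card G : ℝ) ^ 2 := by
  have hn : (0 : ℝ) < Fintype.card X := by
    have : 0 < Fintype.card X := by omega
    exact_mod_cast this
  refine le_two_mul_sq_of_le_div_sq_mul hn
    (h.sum_fixCount_crossing_le_weights hX ε δ A B C D) ?_
  rcases ε with _ | _ <;> rcases δ with _ | _ <;> simp only [if_true, Bool.false_eq_true, if_false]
  · refine le_trans (le_of_eq ?_) (sum_chained_weights_le hX (fun _ z₂ z₃ => kron (A • z₂) z₃)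
      (fun z₁ _ _ z₄ => kron z₁ (C • z₄)) (fun z₁ z₂ => kron z₂ (D • z₁))
      (fun z₃ z₄ => kron (B • z₃) z₄) (fun _ _ _ => kron_mem _ _) (fun _ _ _ _ => kron_mem _ _)
      (fun _ _ => kron_mem _ _) (fun _ _ => kron_mem _ _) (fun _ _ => sum_kron_left _)
      (fun _ _ _ => sum_kron_smul_left _ _) (fun _ => sum_kron_right _) (fun _ => sum_kron_left _))
    refine Finset.sum_congr rfl fun z₁ _ => Finset.sum_congr rfl fun z₂ _ =>
      Finset.sum_congr rfl fun z₃ _ => Finset.sum_congr rfl fun z₄ _ => ?_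
    simp only [pairWeight]
    ring
  · simp at hεδ
  · refine le_trans (le_of_eq ?_) (sum_chained_weights_le hX (fun z₁ _ z₃ => kron z₁ z₃)
      (fun _ z₂ _ z₄ => kron (A • z₂) (C • z₄)) (fun z₁ z₂ => kron z₂ (D • z₁))
      (fun z₃ z₄ => kron (B • z₃) z₄) (fun _ _ _ => kron_mem _ _) (fun _ _ _ _ => kron_mem _ _)
      (fun _ _ => kron_mem _ _) (fun _ _ => kron_mem _ _) (fun _ _ => sum_kron_left _)
      (fun _ _ _ => sum_kron_smul_left _ _) (fun _ => sum_kron_right _) (fun _ => sum_kron_left _))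
    refine Finset.sum_congr rfl fun z₁ _ => Finset.sum_congr rfl fun z₂ _ =>
      Finset.sum_congr rfl fun z₃ _ => Finset.sum_congr rfl fun z₄ _ => ?_
    simp only [pairWeight]
    ring
  · exact sum_product_weights_le hX (fun z₁ z₃ => kron z₁ z₃) (fun z₂ z₄ => kron (A • z₂) (C • z₄))
      (fun z₁ z₃ => kron (B • z₃) (D • z₁)) (fun z₂ z₄ => kron z₂ z₄) (fun _ _ => kron_mem _ _)
      (fun _ _ => kron_mem _ _) (fun _ _ => kron_mem _ _) (fun _ _ => kron_mem _ _)
      (fun _ => sum_kron_left _) (fun _ => sum_kron_smul_left _ _)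
      (fun _ => sum_kron_smul_right _ _) (fun _ => sum_kron_left _)

theorem IsLineAction.sum_fixCount_crossing_le (h : IsLineAction G X τ)
    (hX : 3 ≤ Fintype.card X) (ε₁ ε₂ δ₁ δ₂ : Bool) (A B C D : G) :
    ∑ t : G, ∑ r : G,
      fixCount X (signed ε₁ t * A * signed δ₁ r * B * signed ε₂ t * C * signed δ₂ r * D) ≤
        2 * (Fintype.card G : ℝ) ^ 2 := by
  have norm : ∀ (ε δ : Bool) (P : G → G → G → G → ℝ),
      ∑ t, ∑ r, P (signed ε t) (signed δ r) (signed ε₂ t) (signed δ₂ r) =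
        ∑ t, ∑ r, P t r (signed (ε₂ == ε) t) (signed (δ₂ == δ) r) := by
    intro ε δ P
    rw [← sum_signed ε]
    refine Finset.sum_congr rfl fun t _ => ?_
    rw [← sum_signed δ]
    refine Finset.sum_congr rfl fun r _ => ?_
    simp only [signed_signed]
    cases ε <;> cases δ <;> cases ε₂ <;> cases δ₂ <;> rfl
  rw [norm ε₁ δ₁ fun a b c e => fixCount X (a * A * b * B * c * C * e * D)]
  generalize (ε₂ == ε₁) = ε
  generalize (δ₂ == δ₁) = δ
  by_cases hεδ : ε = true ∨ δ = false
  · exact h.sum_fixCount_crossing_le_of_pos hX ε δ hεδ A B C D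
  · obtain rfl : ε = false := by simpa using (not_or.mp hεδ).1
    obtain rfl : δ = true := by simpa using (not_or.mp hεδ).2
    have := h.sum_fixCount_crossing_le_of_pos hX true false (Or.inl rfl) B C D A
    refine le_trans (le_of_eq ?_) this
    rw [Finset.sum_comm]
    refine Finset.sum_congr rfl fun r _ => ?_
    rw [← sum_signed false]
    refine Finset.sum_congr rfl fun t _ => ?_
    simp only [signed, if_true, Bool.false_eq_true, if_false, inv_inv]
    rw [mul_assoc, mul_assoc, mul_assoc, mul_assoc, mul_assoc, mul_assoc, ← mul_assoc t⁻¹,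
      fixCount_mul_comm]
    simp only [mul_assoc]

theorem IsLineAction.sum_fixCount_single_le (h : IsLineAction G X τ) (hX : 3 ≤ Fintype.card X)
    (ε : Bool) (A : G) : ∑ t : G, fixCount X (signed ε t * A) ≤ Fintype.card G := by
  have hn : (0 : ℝ) < Fintype.card X := by
    have : 0 < Fintype.card X := by omega
    exact_mod_cast this
  rw [sum_signed ε fun t => fixCount X (t * A)]
  simp only [fixCount, mul_smul]
  rw [Finset.sum_comm]
  calc _ ≤ ∑ _x : X, (Fintype.card G / Fintype.card X : ℝ) :=
        Finset.sum_le_sum fun x _ => (le_div_iff₀ hn).mpr (h.card_one _ _)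
    _ = Fintype.card G := by
        rw [Finset.sum_const, Finset.card_univ, nsmul_eq_mul]
        field_simp

end CrossingBound
section Triple

variable {G X : Type*} [Group G] [Fintype G] [DecidableEq X] [Fintype X] [MulAction G X]
  {τ : X → X → X → Prop}

open Classical in
/-- The indicator of a proposition, as a real number. -/
noncomputable def ind (p : Prop) : ℝ := if p then 1 else 0

theorem ind_nonneg (p : Prop) : 0 ≤ ind p := by
  unfold ind; split_ifs <;> norm_num

theorem ind_of_true {p : Prop} (h : p) : ind p = 1 := if_pos h

theorem ind_of_false {p : Prop} (h : ¬ p) : ind p = 0 := if_neg h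

theorem sum_ind_le_one {Y : Type*} [Fintype Y] (p : Y → Prop) (hp : ∀ x y, p x → p y → x = y) :
    ∑ x, ind (p x) ≤ 1 := by
  classical
  simp only [ind]
  rw [Finset.sum_boole]
  exact_mod_cast Finset.card_le_one.mpr fun x hx y hy =>
    hp x y (Finset.mem_filter.mp hx).2 (Finset.mem_filter.mp hy).2

/-- The weight of a triple of constraints `aᵢ ↦ bᵢ` on a random group element. -/
noncomputable def tripleWeight (τ : X → X → X → Prop) (a₁ a₂ a₃ b₁ b₂ b₃ : X) : ℝ :=
  kron a₁ a₂ * kron a₁ a₃ * (kron b₁ b₂ * kron b₁ b₃) +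
    ((Fintype.card X : ℝ) - 1)⁻¹ *
      (kron a₁ a₂ * kron b₁ b₂ * ((1 - kron a₁ a₃) * (1 - kron b₁ b₃)) +
        (kron a₁ a₃ * kron b₁ b₃ * ((1 - kron a₁ a₂) * (1 - kron b₁ b₂)) +
          kron a₂ a₃ * kron b₂ b₃ * ((1 - kron a₁ a₂) * (1 - kron b₁ b₂)) +
          ind (τ a₁ a₂ a₃ ∧ τ b₁ b₂ b₃))) +
    (((Fintype.card X : ℝ) - 1) * ((Fintype.card X : ℝ) - 3))⁻¹ *
      ((1 - kron a₁ a₂) * (1 - kron b₁ b₂) * (1 - kron b₂ b₃))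

theorem tripleWeight_nonneg (hX : 6 ≤ Fintype.card X) (a₁ a₂ a₃ b₁ b₂ b₃ : X) :
    0 ≤ tripleWeight τ a₁ a₂ a₃ b₁ b₂ b₃ := by
  have hn : (6 : ℝ) ≤ Fintype.card X := by exact_mod_cast hX
  have h1 : (0 : ℝ) ≤ Fintype.card X - 1 := by linarith
  have h3 : (0 : ℝ) ≤ Fintype.card X - 3 := by linarith
  have k := fun a b : X => kron_nonneg a b
  have k' := fun a b : X => one_sub_kron_nonneg a b
  have i := fun p => ind_nonneg p
  unfold tripleWeight
  have e1 := mul_nonneg (mul_nonneg (k a₁ a₂) (k a₁ a₃)) (mul_nonneg (k b₁ b₂) (k b₁ b₃))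
  have e2 := mul_nonneg (mul_nonneg (k a₁ a₂) (k b₁ b₂)) (mul_nonneg (k' a₁ a₃) (k' b₁ b₃))
  have e3 := mul_nonneg (mul_nonneg (k a₁ a₃) (k b₁ b₃)) (mul_nonneg (k' a₁ a₂) (k' b₁ b₂))
  have e4 := mul_nonneg (mul_nonneg (k a₂ a₃) (k b₂ b₃)) (mul_nonneg (k' a₁ a₂) (k' b₁ b₂))
  have e5 := mul_nonneg (mul_nonneg (k' a₁ a₂) (k' b₁ b₂)) (k' b₂ b₃)
  have e6 := i (τ a₁ a₂ a₃ ∧ τ b₁ b₂ b₃)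
  positivity

theorem IsLineAction.sum_triple_le (h : IsLineAction G X τ) (hX : 6 ≤ Fintype.card X)
    (a₁ a₂ a₃ b₁ b₂ b₃ : X) :
    ∑ t : G, kron (t • a₁) b₁ * (kron (t • a₂) b₂ * kron (t • a₃) b₃) ≤
      Fintype.card G / Fintype.card X * tripleWeight τ a₁ a₂ a₃ b₁ b₂ b₃ := by
  have hn : (6 : ℝ) ≤ Fintype.card X := by exact_mod_cast hX
  have h1 : (0 : ℝ) < Fintype.card X - 1 := by linarith
  have h3 : (0 : ℝ) < Fintype.card X - 3 := by linarith
  have hX3 : 3 ≤ Fintype.card X := by omega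
  have hnn : (0 : ℝ) ≤ Fintype.card G / Fintype.card X * tripleWeight τ a₁ a₂ a₃ b₁ b₂ b₃ :=
    mul_nonneg (by positivity) (tripleWeight_nonneg hX _ _ _ _ _ _)
  have hNn : (0 : ℝ) ≤ Fintype.card G / Fintype.card X := by positivity
  have idem : ∀ x y : X, kron x y * kron x y = kron x y := fun x y => by
    unfold kron; split_ifs <;> norm_num
  by_cases h12 : a₁ = a₂ ↔ b₁ = b₂
  swap
  · refine (Finset.sum_eq_zero fun t _ => ?_).trans_le hnn
    rw [← mul_assoc, kron_smul_mul_kron_smul_eq_zero h12, zero_mul]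
  by_cases h13 : a₁ = a₃ ↔ b₁ = b₃
  swap
  · refine (Finset.sum_eq_zero fun t _ => ?_).trans_le hnn
    rw [mul_left_comm, kron_smul_mul_kron_smul_eq_zero h13, mul_zero]
  by_cases h23 : a₂ = a₃ ↔ b₂ = b₃
  swap
  · refine (Finset.sum_eq_zero fun t _ => ?_).trans_le hnn
    rw [kron_smul_mul_kron_smul_eq_zero h23, mul_zero]
  by_cases e12 : a₁ = a₂
  · obtain rfl := h12.mp e12
    subst e12
    simp only [← mul_assoc, idem]
    refine (h.sum_pair_le hX3 _ _ _ _).trans (mul_le_mul_of_nonneg_left ?_ hNn)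
    simp only [tripleWeight, pairWeight, kron_self, one_mul, sub_self, mul_zero, zero_mul,
      add_zero, zero_add, div_eq_inv_mul]
    gcongr
    linarith [ind_nonneg (τ a₁ a₁ a₃ ∧ τ b₁ b₁ b₃)]
  have f12 : b₁ ≠ b₂ := fun hb => e12 (h12.mpr hb)
  by_cases e13 : a₁ = a₃
  · obtain rfl := h13.mp e13
    subst e13
    have : ∀ t : G, kron (t • a₁) b₁ * (kron (t • a₂) b₂ * kron (t • a₁) b₁) =
        kron (t • a₁) b₁ * kron (t • a₂) b₂ := fun t => by
      rw [mul_left_comm, idem, mul_comm]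
    simp only [this]
    refine (h.sum_pair_le hX3 _ _ _ _).trans (mul_le_mul_of_nonneg_left ?_ hNn)
    simp only [tripleWeight, pairWeight, kron_self, kron_of_ne e12, kron_of_ne f12,
      kron_of_ne (Ne.symm e12), kron_of_ne f12.symm, sub_zero, mul_one, zero_mul, zero_add,
      one_div]
    have := ind_nonneg (τ a₁ a₂ a₁ ∧ τ b₁ b₂ b₁)
    have : 0 ≤ ((Fintype.card X : ℝ) - 1)⁻¹ * ind (τ a₁ a₂ a₁ ∧ τ b₁ b₂ b₁) := by positivity
    have : 0 ≤ (((Fintype.card X : ℝ) - 1) * ((Fintype.card X : ℝ) - 3))⁻¹ := by positivity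
    linarith
  have f13 : b₁ ≠ b₃ := fun hb => e13 (h13.mpr hb)
  by_cases e23 : a₂ = a₃
  · obtain rfl := h23.mp e23
    subst e23
    simp only [idem]
    refine (h.sum_pair_le hX3 _ _ _ _).trans (mul_le_mul_of_nonneg_left ?_ hNn)
    simp only [tripleWeight, pairWeight, kron_self, kron_of_ne e12, kron_of_ne f12,
      sub_zero, mul_one, zero_add, one_div, sub_self, mul_zero, add_zero]
    have := ind_nonneg (τ a₁ a₂ a₂ ∧ τ b₁ b₂ b₂)
    have : 0 ≤ ((Fintype.card X : ℝ) - 1)⁻¹ * ind (τ a₁ a₂ a₂ ∧ τ b₁ b₂ b₂) := by positivity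
    linarith
  have f23 : b₂ ≠ b₃ := fun hb => e23 (h23.mpr hb)
  by_cases ta : τ a₁ a₂ a₃
  · by_cases tb : τ b₁ b₂ b₃
    · refine (Finset.sum_le_sum fun t _ => mul_le_mul_of_nonneg_left
        (mul_le_of_le_one_right (kron_nonneg _ _) (kron_le_one _ _)) (kron_nonneg _ _)).trans ?_
      refine (h.sum_pair_le hX3 _ _ _ _).trans (mul_le_mul_of_nonneg_left ?_ hNn)
      simp only [tripleWeight, pairWeight, kron_of_ne e12, kron_of_ne f12, kron_of_ne e13,
        kron_of_ne e23, kron_of_ne f23, ind_of_true (And.intro ta tb),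
        sub_zero, mul_one, zero_mul, zero_add, one_div, mul_zero, add_zero]
      have : 0 ≤ (((Fintype.card X : ℝ) - 1) * ((Fintype.card X : ℝ) - 3))⁻¹ := by positivity
      linarith
    · refine (Finset.sum_eq_zero fun t _ => ?_).trans_le hnn
      unfold kron
      split_ifs with g1 g2 g3 <;> simp
      subst g1 g2 g3
      exact tb ((h.smul_iff _ _ _ _).mpr ta)
  · have := h.card_three a₁ a₂ a₃ b₁ b₂ b₃ e12 e13 e23 ta
    rw [← le_div_iff₀ (mul_pos (by linarith) (mul_pos h1 h3))] at this
    refine this.trans (le_of_eq ?_)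
    simp only [tripleWeight, kron_of_ne e12, kron_of_ne f12, kron_of_ne e13,
        kron_of_ne e23, kron_of_ne f23, ind_of_false (fun hab => ta (And.left hab)),
        sub_zero, mul_one, zero_mul, zero_add, mul_zero, add_zero]
    rw [div_mul_eq_div_div, div_eq_mul_inv]

end Triple
section TripleBound

variable {G X : Type*} [Group G] [Fintype G] [DecidableEq X] [Fintype X] [MulAction G X]
  {τ : X → X → X → Prop}

theorem mul_mul_le_of_le_one {a b c d : ℝ} (hab : 0 ≤ a * b) (hc : 0 ≤ c) (hc' : c ≤ 1)
    (hd' : d ≤ 1) : a * b * (c * d) ≤ a * b :=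
  mul_le_of_le_one_right hab ((mul_le_of_le_one_right hc hd').trans hc')

theorem triple_total_le {n x p t q : ℝ} (hn : 6 ≤ n) (hx : x ≤ n) (hp : p ≤ n)
    (ht : t ≤ 2 * n + n ^ 2) (hq : q ≤ n * ((n - 1) * (n - 1))) :
    x + (n - 1)⁻¹ * (p + t) + ((n - 1) * (n - 3))⁻¹ * q ≤ 5 * n := by
  have h1 : 0 < n - 1 := by linarith
  have h3 : 0 < n - 3 := by linarith
  calc _ ≤ n + (n - 1)⁻¹ * (n + (2 * n + n ^ 2)) +
        ((n - 1) * (n - 3))⁻¹ * (n * ((n - 1) * (n - 1))) := by gcongr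
    _ ≤ 5 * n := by
        have h1' := h1.ne'
        have h3' := h3.ne'
        rw [← sub_nonneg]
        have : 5 * n - (n + (n - 1)⁻¹ * (n + (2 * n + n ^ 2)) +
            ((n - 1) * (n - 3))⁻¹ * (n * ((n - 1) * (n - 1)))) =
            n * (4 * (n - 1) * (n - 3) - (n + 3) * (n - 3) - (n - 1) ^ 2) /
              ((n - 1) * (n - 3)) := by
          field_simp
          ring
        rw [this]
        refine div_nonneg (mul_nonneg (by linarith) (by nlinarith)) (by positivity)

theorem sum_weights_eq {Y : Type*} [Fintype Y] (e p t q : Y → Y → Y → ℝ) (c c' : ℝ) :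
    ∑ x, ∑ y, ∑ z, (e x y z + c * (p x y z + t x y z) + c' * q x y z) =
      ∑ x, ∑ y, ∑ z, e x y z + c * (∑ x, ∑ y, ∑ z, p x y z + ∑ x, ∑ y, ∑ z, t x y z) +
        c' * ∑ x, ∑ y, ∑ z, q x y z := by
  simp only [mul_add, Finset.sum_add_distrib, Finset.mul_sum]

variable {A B C : G}

theorem IsLineAction.sum_tripleWeight_pos_le (h : IsLineAction G X τ) (hX : 6 ≤ Fintype.card X) :
    ∑ z₁ : X, ∑ z₂ : X, ∑ z₃ : X, tripleWeight τ (A • z₂) (B • z₃) (C • z₁) z₁ z₂ z₃ ≤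
      5 * Fintype.card X := by
  have hn : (6 : ℝ) ≤ Fintype.card X := by exact_mod_cast hX
  set n := (Fintype.card X : ℝ) with hn_def
  have k := fun a b : X => kron_nonneg a b
  have k' := fun a b : X => one_sub_kron_nonneg a b
  have l := fun a b : X => kron_le_one a b
  have l' := fun a b : X => one_sub_kron_le_one a b
  have cardX : ∑ _x : X, (1 : ℝ) = n := by simp [hn_def]
  simp only [tripleWeight, ← hn_def]
  rw [sum_weights_eq]
  refine triple_total_le hn ?_ ?_ ?_ ?_
  · calc _ ≤ ∑ z₁ : X, ∑ z₂ : X, ∑ z₃ : X, kron z₁ z₂ * kron z₁ z₃ := by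
          refine Finset.sum_le_sum fun z₁ _ => Finset.sum_le_sum fun z₂ _ =>
            Finset.sum_le_sum fun z₃ _ => ?_
          rw [mul_comm]
          exact mul_mul_le_of_le_one (mul_nonneg (k _ _) (k _ _)) (k _ _) (l _ _) (l _ _)
      _ = n := by simp only [← Finset.mul_sum, sum_kron_left, mul_one, cardX]
  · calc _ ≤ ∑ z₁ : X, ∑ z₂ : X, ∑ z₃ : X, kron z₁ z₂ * kron (A • z₂) (B • z₃) := by
          refine Finset.sum_le_sum fun z₁ _ => Finset.sum_le_sum fun z₂ _ =>
            Finset.sum_le_sum fun z₃ _ => ?_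
          rw [mul_comm (kron z₁ z₂)]
          exact mul_mul_le_of_le_one (mul_nonneg (k _ _) (k _ _)) (k' _ _) (l' _ _) (l' _ _)
      _ = n := by simp only [← Finset.mul_sum, sum_kron_left, sum_kron_smul_left, mul_one, cardX]
  · have e2 : ∑ z₁ : X, ∑ z₂ : X, ∑ z₃ : X, kron (A • z₂) (C • z₁) * kron z₁ z₃ *
        ((1 - kron (A • z₂) (B • z₃)) * (1 - kron z₁ z₂)) ≤ n := by
      calc _ ≤ ∑ z₁ : X, ∑ z₂ : X, ∑ z₃ : X, kron (A • z₂) (C • z₁) * kron z₁ z₃ := by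
            refine Finset.sum_le_sum fun z₁ _ => Finset.sum_le_sum fun z₂ _ =>
              Finset.sum_le_sum fun z₃ _ => ?_
            exact mul_mul_le_of_le_one (mul_nonneg (k _ _) (k _ _)) (k' _ _) (l' _ _) (l' _ _)
        _ = n := by
            simp only [← Finset.mul_sum, sum_kron_left, sum_kron_smul_right, mul_one, cardX]
    have e3 : ∑ z₁ : X, ∑ z₂ : X, ∑ z₃ : X, kron (B • z₃) (C • z₁) * kron z₂ z₃ *
        ((1 - kron (A • z₂) (B • z₃)) * (1 - kron z₁ z₂)) ≤ n := by
      calc _ ≤ ∑ z₁ : X, ∑ z₂ : X, ∑ z₃ : X, kron (B • z₂) (C • z₁) * kron z₂ z₃ := by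
            refine Finset.sum_le_sum fun z₁ _ => Finset.sum_le_sum fun z₂ _ =>
              Finset.sum_le_sum fun z₃ _ => ?_
            refine (mul_mul_le_of_le_one (mul_nonneg (k _ _) (k _ _)) (k' _ _) (l' _ _)
              (l' _ _)).trans (le_of_eq ?_)
            by_cases hz : z₂ = z₃
            · rw [hz]
            · rw [kron_of_ne hz, mul_zero, mul_zero]
        _ = n := by
            simp only [← Finset.mul_sum, sum_kron_left, sum_kron_smul_right, mul_one, cardX]
    have e4 : ∑ z₁ : X, ∑ z₂ : X, ∑ z₃ : X,
        ind (τ (A • z₂) (B • z₃) (C • z₁) ∧ τ z₁ z₂ z₃) ≤ n ^ 2 := by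
      calc _ ≤ ∑ _z₁ : X, ∑ _z₂ : X, (1 : ℝ) :=
            Finset.sum_le_sum fun z₁ _ => Finset.sum_le_sum fun z₂ _ =>
              sum_ind_le_one _ fun x y hx hy => h.unique_right _ _ _ _ hx.2 hy.2
        _ = n ^ 2 := by simp [hn_def, sq]
    simp only [Finset.sum_add_distrib]
    linarith
  · calc _ ≤ ∑ z₁ : X, ∑ z₂ : X, ∑ z₃ : X, (1 - kron z₁ z₂) * (1 - kron z₂ z₃) := by
          refine Finset.sum_le_sum fun z₁ _ => Finset.sum_le_sum fun z₂ _ =>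
            Finset.sum_le_sum fun z₃ _ => ?_
          rw [mul_assoc]
          exact mul_le_of_le_one_left (mul_nonneg (k' _ _) (k' _ _)) (l' _ _)
      _ = n * ((n - 1) * (n - 1)) := by
          simp only [← Finset.mul_sum, ← Finset.sum_mul, sum_one_sub_kron_left, Finset.sum_const,
            Finset.card_univ, nsmul_eq_mul]
          simp only [← hn_def]
          ring

theorem IsLineAction.sum_tripleWeight_neg_le (h : IsLineAction G X τ) (hX : 6 ≤ Fintype.card X) :
    ∑ z₁ : X, ∑ z₂ : X, ∑ z₃ : X, tripleWeight τ (A • z₂) (B • z₃) z₃ z₁ z₂ (C • z₁) ≤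
      5 * Fintype.card X := by
  have hn : (6 : ℝ) ≤ Fintype.card X := by exact_mod_cast hX
  set n := (Fintype.card X : ℝ) with hn_def
  have k := fun a b : X => kron_nonneg a b
  have k' := fun a b : X => one_sub_kron_nonneg a b
  have l := fun a b : X => kron_le_one a b
  have l' := fun a b : X => one_sub_kron_le_one a b
  have cardX : ∑ _x : X, (1 : ℝ) = n := by simp [hn_def]
  simp only [tripleWeight, ← hn_def]
  rw [sum_weights_eq]
  refine triple_total_le hn ?_ ?_ ?_ ?_
  · calc _ ≤ ∑ z₁ : X, ∑ z₂ : X, ∑ z₃ : X, kron z₁ z₂ * kron (A • z₂) z₃ := by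
          refine Finset.sum_le_sum fun z₁ _ => Finset.sum_le_sum fun z₂ _ =>
            Finset.sum_le_sum fun z₃ _ => ?_
          rw [mul_mul_mul_comm, mul_comm, mul_mul_mul_comm, mul_comm, mul_comm (kron z₁ (C • z₁)),
            mul_mul_mul_comm]
          exact mul_mul_le_of_le_one (mul_nonneg (k _ _) (k _ _)) (k _ _) (l _ _) (l _ _)
      _ = n := by simp only [← Finset.mul_sum, sum_kron_left, mul_one, cardX]
  · calc _ ≤ ∑ z₁ : X, ∑ z₂ : X, ∑ z₃ : X, kron z₁ z₂ * kron (A • z₂) (B • z₃) := by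
          refine Finset.sum_le_sum fun z₁ _ => Finset.sum_le_sum fun z₂ _ =>
            Finset.sum_le_sum fun z₃ _ => ?_
          rw [mul_comm (kron z₁ z₂)]
          exact mul_mul_le_of_le_one (mul_nonneg (k _ _) (k _ _)) (k' _ _) (l' _ _) (l' _ _)
      _ = n := by simp only [← Finset.mul_sum, sum_kron_left, sum_kron_smul_left, mul_one, cardX]
  · calc _ = ∑ z₁ : X, ∑ z₃ : X, ∑ z₂ : X,
          (kron (A • z₂) z₃ * kron z₁ (C • z₁) *
            ((1 - kron (A • z₂) (B • z₃)) * (1 - kron z₁ z₂)) +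
          kron (B • z₃) z₃ * kron z₂ (C • z₁) *
            ((1 - kron (A • z₂) (B • z₃)) * (1 - kron z₁ z₂)) +
          ind (τ (A • z₂) (B • z₃) z₃ ∧ τ z₁ z₂ (C • z₁))) :=
          Finset.sum_congr rfl fun z₁ _ => Finset.sum_comm
      _ ≤ ∑ _z₁ : X, ∑ _z₃ : X, (1 : ℝ) := by
          refine Finset.sum_le_sum fun z₁ _ => Finset.sum_le_sum fun z₃ _ => ?_
          by_cases hC : z₁ = C • z₁
          · have hτ : ∀ z₂, ind (τ (A • z₂) (B • z₃) z₃ ∧ τ z₁ z₂ (C • z₁)) = 0 := fun z₂ =>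
              ind_of_false fun ht => (h.ne _ _ _ ht.2).2.1 hC
            refine le_trans (Finset.sum_le_sum fun z₂ _ => ?_) (sum_kron_smul_right A z₃).le
            rw [hτ, ← hC, kron_self, mul_one, add_zero]
            by_cases hz : z₂ = z₁
            · rw [hz, kron_self, sub_self, mul_zero, mul_zero, mul_zero, add_zero]
              exact k _ _
            · rw [kron_of_ne hz, mul_zero, zero_mul, add_zero]
              exact mul_le_of_le_one_right (k _ _)
                ((mul_le_of_le_one_right (k' _ _) (l' _ _)).trans (l' _ _))
          · by_cases hB : B • z₃ = z₃
            · have hτ : ∀ z₂, ind (τ (A • z₂) (B • z₃) z₃ ∧ τ z₁ z₂ (C • z₁)) = 0 := fun z₂ =>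
                ind_of_false fun ht => (h.ne _ _ _ ht.1).2.2 hB
              refine le_trans (Finset.sum_le_sum fun z₂ _ => ?_) (sum_kron_right (C • z₁)).le
              rw [hτ, kron_of_ne hC, mul_zero, zero_mul, zero_add, add_zero, hB, kron_self, one_mul]
              exact mul_le_of_le_one_right (k _ _)
                ((mul_le_of_le_one_right (k' _ _) (l' _ _)).trans (l' _ _))
            · simp only [kron_of_ne hC, kron_of_ne hB, mul_zero, zero_mul, zero_add]
              exact sum_ind_le_one _ fun x y hx hy => h.unique_mid _ _ _ _ hx.2 hy.2
      _ = n ^ 2 := by simp [hn_def, sq]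
      _ ≤ 2 * n + n ^ 2 := by linarith
  · calc _ ≤ ∑ z₁ : X, ∑ z₂ : X, ∑ z₃ : X, (1 - kron z₁ z₂) * (1 - kron (A • z₂) (B • z₃)) := by
          refine Finset.sum_le_sum fun z₁ _ => Finset.sum_le_sum fun z₂ _ =>
            Finset.sum_le_sum fun z₃ _ => ?_
          rw [mul_comm (1 - kron z₁ z₂)]
          exact mul_le_of_le_one_right (mul_nonneg (k' _ _) (k' _ _)) (l' _ _)
      _ = n * ((n - 1) * (n - 1)) := by
          simp only [← Finset.mul_sum, ← Finset.sum_mul, sum_one_sub_kron_left,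
            sum_one_sub_kron_smul_left, Finset.sum_const, Finset.card_univ, nsmul_eq_mul]
          simp only [← hn_def]
          ring

theorem IsLineAction.sum_fixCount_triple_le_of_pos (h : IsLineAction G X τ)
    (hX : 6 ≤ Fintype.card X) (ε : Bool) (A B C : G) :
    ∑ t : G, fixCount X (t * A * t * B * signed ε t * C) ≤ 5 * Fintype.card G := by
  have hn : (0 : ℝ) < Fintype.card X := by
    have : 0 < Fintype.card X := by omega
    exact_mod_cast this
  simp only [fixCount_mul₃, kron_signed_smul]
  have swap : ∀ f : G → X → X → X → ℝ, ∑ t, ∑ z₁, ∑ z₂, ∑ z₃, f t z₁ z₂ z₃ =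
      ∑ z₁, ∑ z₂, ∑ z₃, ∑ t, f t z₁ z₂ z₃ := by
    intro f
    have := Finset.sum_comm (s := (Finset.univ : Finset G))
      (t := (Finset.univ : Finset (X × X × X))) (f := fun p z => f p z.1 z.2.1 z.2.2)
    simpa only [Fintype.sum_prod_type] using this
  rw [swap]
  calc _ ≤ ∑ z₁ : X, ∑ z₂ : X, ∑ z₃ : X, (Fintype.card G / Fintype.card X : ℝ) *
        tripleWeight τ (A • z₂) (B • z₃) (if ε then C • z₁ else z₃) z₁ z₂
          (if ε then z₃ else C • z₁) :=
        Finset.sum_le_sum fun z₁ _ => Finset.sum_le_sum fun z₂ _ =>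
          Finset.sum_le_sum fun z₃ _ => h.sum_triple_le hX _ _ _ _ _ _
    _ ≤ (Fintype.card G / Fintype.card X : ℝ) * (5 * Fintype.card X) := by
        simp only [← Finset.mul_sum]
        refine mul_le_mul_of_nonneg_left ?_ (by positivity)
        cases ε
        · simpa using h.sum_tripleWeight_neg_le hX
        · simpa using h.sum_tripleWeight_pos_le hX
    _ = 5 * Fintype.card G := by field_simp

theorem IsLineAction.sum_fixCount_triple_le (h : IsLineAction G X τ)
    (ε₁ ε₂ ε₃ : Bool) (A B C : G) :
    ∑ t : G, fixCount X (signed ε₁ t * A * signed ε₂ t * B * signed ε₃ t * C) ≤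
      5 * Fintype.card G := by
  by_cases hX : Fintype.card X ≤ 5
  · calc _ ≤ ∑ _t : G, (5 : ℝ) := Finset.sum_le_sum fun t _ =>
          (fixCount_le_card _).trans (by exact_mod_cast hX)
      _ = 5 * Fintype.card G := by simp [mul_comm]
  replace hX : 6 ≤ Fintype.card X := by omega
  have norm : ∑ t : G, fixCount X (signed ε₁ t * A * signed ε₂ t * B * signed ε₃ t * C) =
      ∑ t : G, fixCount X (t * A * signed (ε₂ == ε₁) t * B * signed (ε₃ == ε₁) t * C) := by
    rw [← sum_signed ε₁]
    refine Finset.sum_congr rfl fun t _ => ?_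
    simp only [signed_signed]
    cases ε₁ <;> cases ε₂ <;> cases ε₃ <;> rfl
  rw [norm]
  generalize (ε₂ == ε₁) = ε
  generalize (ε₃ == ε₁) = δ
  cases ε
  · cases δ
    · refine le_trans (le_of_eq ?_) (h.sum_fixCount_triple_le_of_pos hX false B C A)
      rw [← sum_signed false]
      refine Finset.sum_congr rfl fun t _ => ?_
      simp only [signed, Bool.false_eq_true, if_false, inv_inv]
      rw [mul_assoc, mul_assoc, mul_assoc, mul_assoc, ← mul_assoc t⁻¹, fixCount_mul_comm]
      simp only [mul_assoc]
    · refine le_trans (le_of_eq ?_) (h.sum_fixCount_triple_le_of_pos hX false C A B)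
      refine Finset.sum_congr rfl fun t _ => ?_
      simp only [signed, Bool.false_eq_true, if_false, if_true]
      rw [mul_assoc, fixCount_mul_comm]
      simp only [mul_assoc]
  · exact h.sum_fixCount_triple_le_of_pos hX δ A B C

end TripleBound
section WordProducts

variable {G α : Type*} [Group G]

/-- The product of the group elements `s a` along a word, with alternating signs. -/
def wordProd (s : α → G) : Bool → List α → G
  | _, [] => 1
  | ε, a :: w => signed ε (s a) * wordProd s (!ε) w

/-- The sign in force after reading a word. -/
def signAfter : Bool → List α → Bool
  | ε, [] => ε
  | ε, _ :: w => signAfter (!ε) w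

theorem wordProd_append (s : α → G) (ε : Bool) (u v : List α) :
    wordProd s ε (u ++ v) = wordProd s ε u * wordProd s (signAfter ε u) v := by
  induction u generalizing ε with
  | nil => simp [wordProd, signAfter]
  | cons a u ih => simp [wordProd, signAfter, ih, mul_assoc]

theorem wordProd_update_of_notMem [DecidableEq α] (s : α → G) {a : α} (t : G) (ε : Bool)
    {w : List α} (h : a ∉ w) : wordProd (Function.update s a t) ε w = wordProd s ε w := by
  induction w generalizing ε with
  | nil => rfl
  | cons b w ih =>
    rw [List.mem_cons, not_or] at h
    rw [wordProd, wordProd, ih _ h.2, Function.update_of_ne (Ne.symm h.1)]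

theorem exists_eq_append_of_count_eq_three [DecidableEq α] {a : α} {w : List α}
    (h : w.count a = 3) : ∃ u₀ u₁ u₂ u₃, w = u₀ ++ a :: (u₁ ++ a :: (u₂ ++ a :: u₃)) ∧
      a ∉ u₀ ∧ a ∉ u₁ ∧ a ∉ u₂ ∧ a ∉ u₃ := by
  have hw : a ∈ w := List.count_pos_iff.mp (by omega)
  obtain ⟨u₀, v, rfl, h₀⟩ := List.eq_append_cons_of_mem hw
  rw [List.count_append, List.count_eq_zero_of_not_mem h₀, List.count_cons_self] at h
  have hv : a ∈ v := List.count_pos_iff.mp (by omega)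
  obtain ⟨u₁, v, rfl, h₁⟩ := List.eq_append_cons_of_mem hv
  rw [List.count_append, List.count_eq_zero_of_not_mem h₁, List.count_cons_self] at h
  obtain ⟨u₂, u₃, rfl, h₂, h₃⟩ := exists_eq_append_of_count_eq_one (show v.count a = 1 by omega)
  exact ⟨u₀, u₁, u₂, u₃, rfl, h₀, h₁, h₂, h₃⟩

theorem exists_eq_append_of_crossing [DecidableEq α] {a b : α} {w : List α} (hab : a ≠ b)
    (ha : w.count a = 2) (hb : w.count b = 2) (h : List.Sublist [a, b, a, b] w) :
    ∃ u₀ u₁ u₂ u₃ u₄, w = u₀ ++ a :: (u₁ ++ b :: (u₂ ++ a :: (u₃ ++ b :: u₄))) ∧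
      ∀ u ∈ [u₀, u₁, u₂, u₃, u₄], a ∉ u ∧ b ∉ u := by
  obtain ⟨r₀, v, rfl, h₀, h⟩ := List.cons_sublist_iff.mp h
  obtain ⟨r₁, v, rfl, h₁, h⟩ := List.cons_sublist_iff.mp h
  obtain ⟨r₂, v, rfl, h₂, h⟩ := List.cons_sublist_iff.mp h
  obtain ⟨p₃, q₃, rfl⟩ := List.append_of_mem (List.singleton_sublist.mp h)
  obtain ⟨p₀, q₀, rfl⟩ := List.append_of_mem h₀
  obtain ⟨p₁, q₁, rfl⟩ := List.append_of_mem h₁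
  obtain ⟨p₂, q₂, rfl⟩ := List.append_of_mem h₂
  refine ⟨p₀, q₀ ++ p₁, q₁ ++ p₂, q₂ ++ p₃, q₃, by simp, ?_⟩
  simp only [List.count_append, List.count_cons_self, List.count_cons_of_ne hab,
    List.count_cons_of_ne hab.symm] at ha hb
  simp only [List.mem_cons, List.not_mem_nil, or_false, forall_eq_or_imp, forall_eq,
    ← List.count_eq_zero, List.count_append]
  omega

end WordProducts

section Averaging

variable {G α : Type*} [Fintype G] [Fintype α] [DecidableEq α]

theorem sum_sum_update (a : α) (f : (α → G) → ℝ) :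
    ∑ s : α → G, ∑ t : G, f (Function.update s a t) = Fintype.card G * ∑ s, f s := by
  let e : (α → G) × G ≃ (α → G) × G := Function.Involutive.toPerm
    (fun p => (Function.update p.1 a p.2, p.1 a)) fun p => by simp
  have key := Equiv.sum_comp e fun p => f p.1
  rw [Fintype.sum_prod_type, Fintype.sum_prod_type] at key
  calc _ = ∑ s : α → G, ∑ _t : G, f s := key
    _ = _ := by rw [Finset.mul_sum]; simp

theorem average_le_of_update (a : α) (f : (α → G) → ℝ) {C : ℝ} [Nonempty G]
    (h : ∀ s, ∑ t, f (Function.update s a t) ≤ C * Fintype.card G) :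
    (∑ s, f s) / Fintype.card (α → G) ≤ C := by
  have hG : (0 : ℝ) < Fintype.card G := by exact_mod_cast Fintype.card_pos
  have hS : (0 : ℝ) < Fintype.card (α → G) := by exact_mod_cast Fintype.card_pos
  rw [div_le_iff₀ hS, ← mul_le_mul_iff_right₀ hG, ← sum_sum_update a f]
  calc _ ≤ ∑ _s : α → G, C * Fintype.card G := Finset.sum_le_sum fun s _ => h s
    _ = _ := by rw [Finset.sum_const, Finset.card_univ, nsmul_eq_mul]; ring

theorem average_le_of_update_update (a b : α) (f : (α → G) → ℝ) {C : ℝ} [Nonempty G]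
    (h : ∀ s, ∑ t, ∑ r, f (Function.update (Function.update s a t) b r) ≤
      C * (Fintype.card G : ℝ) ^ 2) :
    (∑ s, f s) / Fintype.card (α → G) ≤ C := by
  have hG : (0 : ℝ) < Fintype.card G := by exact_mod_cast Fintype.card_pos
  have := average_le_of_update a (C := C * Fintype.card G)
    (fun s => ∑ r, f (Function.update s b r)) fun s => (h s).trans_eq (by ring)
  rw [sum_sum_update, mul_div_assoc, mul_comm C] at this
  exact le_of_mul_le_mul_left this hG

end Averaging

section WordBounds

variable {G X α : Type*} [Group G] [Fintype G] [DecidableEq X] [Fintype X] [MulAction G X]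
  {τ : X → X → X → Prop} [Fintype α] [DecidableEq α]

variable (G X) in
/-- The expected number of fixed points of a word in independent uniform group elements. -/
noncomputable def expectedFix (ε : Bool) (w : List α) : ℝ :=
  (∑ s : α → G, fixCount X (wordProd s ε w)) / Fintype.card (α → G)

theorem expectedFix_le_card (ε : Bool) (w : List α) :
    expectedFix G X ε w ≤ Fintype.card X := by
  have hS : (0 : ℝ) < Fintype.card (α → G) := by exact_mod_cast Fintype.card_pos
  rw [expectedFix, div_le_iff₀ hS]
  calc _ ≤ ∑ _s : α → G, (Fintype.card X : ℝ) := Finset.sum_le_sum fun s _ => fixCount_le_card _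
    _ = _ := by rw [Finset.sum_const, Finset.card_univ, nsmul_eq_mul]; ring

theorem IsLineAction.expectedFix_single_le (h : IsLineAction G X τ) (hX : 3 ≤ Fintype.card X)
    (ε : Bool) {w : List α} {a : α} (hw : w.count a = 1) : expectedFix G X ε w ≤ 1 := by
  obtain ⟨u, v, rfl, hu, hv⟩ := exists_eq_append_of_count_eq_one hw
  refine average_le_of_update a _ fun s => ?_
  simp only [wordProd_append, wordProd, wordProd_update_of_notMem s _ _ hu,
    wordProd_update_of_notMem s _ _ hv, Function.update_self]
  rw [one_mul]
  refine le_trans (le_of_eq ?_) (h.sum_fixCount_single_le hX (signAfter ε u)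
    (wordProd s (!signAfter ε u) v * wordProd s ε u))
  refine Finset.sum_congr rfl fun t _ => ?_
  rw [fixCount_mul_comm, mul_assoc]

theorem IsLineAction.expectedFix_triple_le (h : IsLineAction G X τ)
    (ε : Bool) {w : List α} {a : α} (hw : w.count a = 3) : expectedFix G X ε w ≤ 5 := by
  obtain ⟨u₀, u₁, u₂, u₃, rfl, h₀, h₁, h₂, h₃⟩ := exists_eq_append_of_count_eq_three hw
  refine average_le_of_update a _ fun s => ?_
  simp only [wordProd_append, wordProd, wordProd_update_of_notMem s _ _ h₀,
    wordProd_update_of_notMem s _ _ h₁, wordProd_update_of_notMem s _ _ h₂,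
    wordProd_update_of_notMem s _ _ h₃, Function.update_self]
  simp only [fixCount_mul_comm (wordProd s ε u₀)]
  simpa only [mul_assoc] using h.sum_fixCount_triple_le (signAfter ε u₀) _ _ (wordProd s _ u₁)
    (wordProd s _ u₂) (wordProd s _ u₃ * wordProd s ε u₀)

theorem IsLineAction.expectedFix_crossing_le (h : IsLineAction G X τ) (hX : 3 ≤ Fintype.card X)
    (ε : Bool) {w : List α} {a b : α} (hab : a ≠ b) (ha : w.count a = 2) (hb : w.count b = 2)
    (hw : List.Sublist [a, b, a, b] w) : expectedFix G X ε w ≤ 2 := by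
  obtain ⟨u₀, u₁, u₂, u₃, u₄, rfl, hu⟩ := exists_eq_append_of_crossing hab ha hb hw
  have upd : ∀ u ∈ [u₀, u₁, u₂, u₃, u₄], ∀ (s : α → G) t r δ,
      wordProd (Function.update (Function.update s a t) b r) δ u = wordProd s δ u := by
    intro u hu' s t r δ
    rw [wordProd_update_of_notMem _ _ _ (hu u hu').2, wordProd_update_of_notMem _ _ _ (hu u hu').1]
  simp only [List.mem_cons, List.not_mem_nil, or_false, forall_eq_or_imp, forall_eq] at upd
  obtain ⟨e₀, e₁, e₂, e₃, e₄⟩ := upd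
  refine average_le_of_update_update a b _ fun s => ?_
  simp only [wordProd_append, wordProd, e₀, e₁, e₂, e₃, e₄, Function.update_self,
    Function.update_of_ne hab]
  simp only [fixCount_mul_comm (wordProd s ε u₀)]
  simpa only [mul_assoc] using h.sum_fixCount_crossing_le hX (signAfter ε u₀) _ _ _
    (wordProd s _ u₁) (wordProd s _ u₂) (wordProd s _ u₃) (wordProd s _ u₄ * wordProd s ε u₀)

theorem IsLineAction.sum_expectedFix_le (h : IsLineAction G X τ) (hX : 3 ≤ Fintype.card X)
    (ε : Bool) (d m : ℕ) :
    ∑ w ∈ wordsOver (Finset.univ : Finset (Fin d)) (2 * m), expectedFix G X ε w ≤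
      Fintype.card X *
          (Yrec 1 1 (2 * m) d * (1 / Fintype.card X)
          + Yrec 2 1 (2 * m) d * (2 / Fintype.card X)
          + (∑ i ∈ Finset.Icc 1 m, (d.choose i : ℝ) * ((1 : ℝ) / 2) ^ i *
            ((Nat.factorial (2 * m) : ℝ) / (Nat.factorial (2 * m - 2 * i) : ℝ)) *
            ((2 : ℝ) ^ i / (Nat.factorial (i + 1) : ℝ)) *
            (Yrec 3 1 (2 * m - 2 * i) (d - i) * (5 / Fintype.card X)
              + Yrec 4 0 (2 * m - 2 * i) (d - i)))
          + Yrec 3 1 (2 * m) d * (5 / Fintype.card X) + Yrec 4 0 (2 * m) d) := by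
  have hn : (0 : ℝ) < Fintype.card X := by
    have : 0 < Fintype.card X := by omega
    exact_mod_cast this
  refine (sum_wordsOver_le_of_bounds hn.le _ (fun w => expectedFix_le_card ε w)
    (fun w a => h.expectedFix_single_le hX ε)
    (fun w a b hab ha hb => h.expectedFix_crossing_le hX ε hab ha hb)
    (fun w a => h.expectedFix_triple_le ε)).trans (le_of_eq ?_)
  have h0 : ∀ f : ℕ → ℝ, ∑ i ∈ Finset.Icc 0 m, f i = f 0 + ∑ i ∈ Finset.Icc 1 m, f i := by
    intro f
    rw [← Finset.insert_Icc_succ_left_eq_Icc (Nat.zero_le m), Finset.sum_insert (by simp)]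
    rfl
  have hS : ∑ i ∈ Finset.Icc 1 m, (d.choose i : ℝ) * ((1 / 2) ^ i *
        ((2 * m).factorial / (2 * m - 2 * i).factorial) * (2 ^ i / (i + 1).factorial) *
        (5 * Yrec 3 1 (2 * m - 2 * i) (d - i) +
          Fintype.card X * Yrec 4 0 (2 * m - 2 * i) (d - i))) =
      Fintype.card X * ∑ i ∈ Finset.Icc 1 m, (d.choose i : ℝ) * ((1 : ℝ) / 2) ^ i *
        ((Nat.factorial (2 * m) : ℝ) / (Nat.factorial (2 * m - 2 * i) : ℝ)) *
        ((2 : ℝ) ^ i / (Nat.factorial (i + 1) : ℝ)) *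
        (Yrec 3 1 (2 * m - 2 * i) (d - i) * (5 / Fintype.card X)
          + Yrec 4 0 (2 * m - 2 * i) (d - i)) := by
    rw [Finset.mul_sum]
    refine Finset.sum_congr rfl fun i _ => ?_
    field_simp
  rw [h0, hS]
  generalize (∑ i ∈ Finset.Icc 1 m, _ : ℝ) = S
  have hf : (Nat.factorial (2 * m) : ℝ) ≠ 0 := by positivity
  simp only [Nat.choose_zero_right, Nat.cast_one, pow_zero, mul_zero, Nat.sub_zero, div_self hf,
    zero_add, Nat.factorial_one, one_mul, mul_one, div_one]
  field_simp
  ring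

end WordBounds
section GeneralLinear

variable {k : ℕ}

/-- `GL_k(F₂)` acts on the nonzero vectors by matrix–vector multiplication. -/
instance nonzeroVectorAction :
    MulAction (GL (Fin k) (ZMod 2)) {v : Fin k → ZMod 2 // v ≠ 0} where
  smul g x := ⟨(g : Matrix (Fin k) (Fin k) (ZMod 2)).mulVec x.val, fun h => x.2 <| by
    rw [← Matrix.one_mulVec x.val, ← Units.inv_mul g, ← Matrix.mulVec_mulVec, h,
      Matrix.mulVec_zero]⟩
  one_smul x := Subtype.ext (Matrix.one_mulVec x.val)
  mul_smul g h x := Subtype.ext (Matrix.mulVec_mulVec x.val _ _).symm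

theorem coe_smul_nonzero (g : GL (Fin k) (ZMod 2)) (x : {v : Fin k → ZMod 2 // v ≠ 0}) :
    (g • x).val = (g : Matrix (Fin k) (Fin k) (ZMod 2)).mulVec x.val := rfl

theorem exists_mulVec_eq_of_notMem (W : Submodule (ZMod 2) (Fin k → ZMod 2))
    {u v : Fin k → ZMod 2} (hu : u ∉ W) (hv : v ∉ W) :
    ∃ g : GL (Fin k) (ZMod 2), (∀ w ∈ W, (g : Matrix (Fin k) (Fin k) (ZMod 2)).mulVec w = w) ∧
      (g : Matrix (Fin k) (Fin k) (ZMod 2)).mulVec u = v := by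
  have two : ∀ x : Fin k → ZMod 2, x + x = 0 := fun x => by
    ext i
    exact CharTwo.add_self_eq_zero (x i)
  have hu' : u ∉ W ⊔ Submodule.span (ZMod 2) {u + v} := by
    rw [Submodule.mem_sup]
    rintro ⟨w, hw, y, hy, hwy⟩
    obtain ⟨c, rfl⟩ := Submodule.mem_span_singleton.mp hy
    have coef : ∀ c : ZMod 2, c = 0 ∨ c = 1 := by decide
    rcases coef c with rfl | rfl
    · rw [zero_smul, add_zero] at hwy
      exact hu (hwy ▸ hw)
    · rw [one_smul] at hwy
      have : w = v := by
        have h1 : w + (u + v) + (u + v) = u + (u + v) := by rw [hwy]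
        rwa [add_assoc, two, add_zero, ← add_assoc, two, zero_add] at h1
      exact hv (this ▸ hw)
  obtain ⟨f, hf, hfW⟩ := Submodule.exists_le_ker_of_notMem hu'
  have hfu : f u = 1 := by
    have : ∀ c : ZMod 2, c ≠ 0 → c = 1 := by decide
    exact this _ hf
  have hfuv : f (u + v) = 0 := hfW (Submodule.mem_sup_right (Submodule.mem_span_singleton_self _))
  let T : (Fin k → ZMod 2) →ₗ[ZMod 2] (Fin k → ZMod 2) :=
    LinearMap.id + f.smulRight (u + v)
  have hT : ∀ x, T x = x + f x • (u + v) := fun x => rfl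
  have hTT : T ∘ₗ T = LinearMap.id := by
    refine LinearMap.ext fun x => ?_
    simp only [LinearMap.comp_apply, hT, map_add, map_smul, hfuv, smul_zero, add_zero]
    rw [add_assoc, two, add_zero]
    rfl
  have hMM : LinearMap.toMatrix' T * LinearMap.toMatrix' T = 1 := by
    rw [← LinearMap.toMatrix'_comp, hTT, LinearMap.toMatrix'_id]
  refine ⟨⟨LinearMap.toMatrix' T, LinearMap.toMatrix' T, hMM, hMM⟩, fun w hw => ?_, ?_⟩
  · have : f w = 0 := hfW (Submodule.mem_sup_left hw)
    simp only [LinearMap.toMatrix'_mulVec, hT, this, zero_smul, add_zero]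
  · simp only [LinearMap.toMatrix'_mulVec, hT, hfu, one_smul]
    rw [← add_assoc, two, zero_add]

theorem card_nonzeroVector : Fintype.card {v : Fin k → ZMod 2 // v ≠ 0} = 2 ^ k - 1 := by
  rw [Fintype.card_subtype_compl]
  simp

end GeneralLinear

section OrbitCounting

variable {G X : Type*} [Group G] [Fintype G] [DecidableEq X] [Fintype X] [MulAction G X]

theorem sum_kron_mul_card_le (φ : G → ℝ) (hφ : ∀ t, 0 ≤ φ t) (a b : X) (R : Finset X)
    (hR : ∀ r ∈ R, ∃ g : G, g • b = r ∧ ∀ t, φ (g * t) = φ t) :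
    (∑ t, φ t * kron (t • a) b) * R.card ≤ ∑ t, φ t := by
  calc (∑ t, φ t * kron (t • a) b) * R.card = ∑ _r ∈ R, ∑ t, φ t * kron (t • a) b := by
        rw [Finset.sum_const, nsmul_eq_mul, mul_comm]
    _ = ∑ r ∈ R, ∑ t, φ t * kron (t • a) r := by
        refine Finset.sum_congr rfl fun r hr => ?_
        obtain ⟨g, rfl, hg⟩ := hR r hr
        rw [← Equiv.sum_comp (Equiv.mulLeft g) fun t => φ t * kron (t • a) (g • b)]
        refine Finset.sum_congr rfl fun t _ => ?_
        simp only [Equiv.coe_mulLeft, hg, kron, mul_smul, smul_left_cancel_iff]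
    _ = ∑ t, φ t * ∑ r ∈ R, kron (t • a) r := by
        rw [Finset.sum_comm]
        simp only [Finset.mul_sum]
    _ ≤ ∑ t, φ t := by
        refine Finset.sum_le_sum fun t _ => mul_le_of_le_one_right (hφ t) ?_
        rw [← sum_kron_left (t • a)]
        exact Finset.sum_le_sum_of_subset_of_nonneg (Finset.subset_univ R)
          fun r _ _ => kron_nonneg _ _

end OrbitCounting

section GeneralLinearIsLineAction

variable {k : ℕ}

theorem isLineAction_generalLinear :
    IsLineAction (GL (Fin k) (ZMod 2)) {v : Fin k → ZMod 2 // v ≠ 0}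
      (fun a b c => a.val + b.val + c.val = 0) := by
  have two : ∀ x : Fin k → ZMod 2, x + x = 0 := fun x => by
    ext i
    exact CharTwo.add_self_eq_zero (x i)
  have coef : ∀ c : ZMod 2, c = 0 ∨ c = 1 := by decide
  have card_one : ∀ a b : {v : Fin k → ZMod 2 // v ≠ 0},
      (∑ t : GL (Fin k) (ZMod 2), kron (t • a) b) *
        Fintype.card {v : Fin k → ZMod 2 // v ≠ 0} ≤ Fintype.card (GL (Fin k) (ZMod 2)) := by
    intro a b
    have := sum_kron_mul_card_le (fun _ : GL (Fin k) (ZMod 2) => (1 : ℝ)) (fun _ => zero_le_one)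
      a b Finset.univ fun r _ => by
        obtain ⟨g, -, hg⟩ := exists_mulVec_eq_of_notMem ⊥ (u := b.val) (v := r.val)
          (by simpa using b.2) (by simpa using r.2)
        exact ⟨g, Subtype.ext hg, fun _ => rfl⟩
    simpa using this
  have pair : ∀ a a' b b' : {v : Fin k → ZMod 2 // v ≠ 0}, b ≠ b' →
      (∑ t : GL (Fin k) (ZMod 2), kron (t • a) b * kron (t • a') b') *
        (Fintype.card {v : Fin k → ZMod 2 // v ≠ 0} - 1) ≤
          ∑ t : GL (Fin k) (ZMod 2), kron (t • a) b := by
    intro a a' b b' hb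
    have notMem : ∀ r ≠ b, r.val ∉ Submodule.span (ZMod 2) {b.val} := by
      intro r hr hmem
      obtain ⟨c, hc⟩ := Submodule.mem_span_singleton.mp hmem
      rcases coef c with rfl | rfl
      · exact r.2 (by rw [← hc, zero_smul])
      · exact hr (Subtype.ext (by rw [← hc, one_smul]))
    have := sum_kron_mul_card_le (fun t : GL (Fin k) (ZMod 2) => kron (t • a) b)
      (fun t => kron_nonneg _ _) a' b' (Finset.univ.erase b) fun r hr => by
        obtain ⟨g, hg, hg'⟩ := exists_mulVec_eq_of_notMem (Submodule.span (ZMod 2) {b.val})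
          (notMem b' hb.symm) (notMem r (Finset.ne_of_mem_erase hr))
        exact ⟨g, Subtype.ext hg', fun t => kron_mul_smul_of_fixed (Subtype.ext
          (hg _ (Submodule.mem_span_singleton_self _))) t a⟩
    rwa [Finset.card_erase_of_mem (Finset.mem_univ b), Finset.card_univ,
      Nat.cast_sub (Fintype.card_pos_iff.mpr ⟨b⟩), Nat.cast_one] at this
  have card_two : ∀ a a' b b' : {v : Fin k → ZMod 2 // v ≠ 0}, a ≠ a' →
      (∑ t : GL (Fin k) (ZMod 2), kron (t • a) b * kron (t • a') b') *
        (Fintype.card {v : Fin k → ZMod 2 // v ≠ 0} *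
          (Fintype.card {v : Fin k → ZMod 2 // v ≠ 0} - 1)) ≤
            Fintype.card (GL (Fin k) (ZMod 2)) := by
    intro a a' b b' ha
    by_cases hb : b = b'
    · rw [Finset.sum_eq_zero fun t _ => kron_smul_mul_kron_smul_eq_zero (by simp [ha, hb]) t,
        zero_mul]
      positivity
    · calc _ = (∑ t : GL (Fin k) (ZMod 2), kron (t • a) b * kron (t • a') b') *
            (Fintype.card {v : Fin k → ZMod 2 // v ≠ 0} - 1) *
              Fintype.card {v : Fin k → ZMod 2 // v ≠ 0} := by ring
        _ ≤ _ := (mul_le_mul_of_nonneg_right (pair a a' b b' hb) (by positivity)).trans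
            (card_one a b)
  have triple : ∀ a₁ a₂ a₃ b₁ b₂ b₃ : {v : Fin k → ZMod 2 // v ≠ 0}, b₁ ≠ b₃ → b₂ ≠ b₃ →
      b₁.val + b₂.val + b₃.val ≠ 0 →
      (∑ t : GL (Fin k) (ZMod 2), kron (t • a₁) b₁ * (kron (t • a₂) b₂ * kron (t • a₃) b₃)) *
        (Fintype.card {v : Fin k → ZMod 2 // v ≠ 0} - 3) ≤
          ∑ t : GL (Fin k) (ZMod 2), kron (t • a₁) b₁ * kron (t • a₂) b₂ := by
    intro a₁ a₂ a₃ b₁ b₂ b₃ h13 h23 hτ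
    have notMem : ∀ r : {v : Fin k → ZMod 2 // v ≠ 0}, r ≠ b₁ → r ≠ b₂ →
        b₁.val + b₂.val + r.val ≠ 0 → r.val ∉ Submodule.span (ZMod 2) {b₁.val, b₂.val} := by
      intro r h1 h2 h3 hmem
      obtain ⟨c, e, hr⟩ := Submodule.mem_span_pair.mp hmem
      rcases coef c with rfl | rfl <;> rcases coef e with rfl | rfl <;>
        simp only [zero_smul, one_smul, zero_add, add_zero] at hr
      · exact r.2 hr.symm
      · exact h2 (Subtype.ext hr.symm)
      · exact h1 (Subtype.ext hr.symm)
      · exact h3 (by rw [← hr, two])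
    set R := Finset.univ.filter fun r : {v : Fin k → ZMod 2 // v ≠ 0} =>
      r ≠ b₁ ∧ r ≠ b₂ ∧ b₁.val + b₂.val + r.val ≠ 0 with hR
    have hcard : (Fintype.card {v : Fin k → ZMod 2 // v ≠ 0} : ℝ) - 3 ≤ R.card := by
      have hlast : (Finset.univ.filter fun r : {v : Fin k → ZMod 2 // v ≠ 0} =>
          b₁.val + b₂.val + r.val = 0).card ≤ 1 := by
        refine Finset.card_le_one.mpr fun x hx y hy => Subtype.ext ?_
        exact add_left_cancel ((Finset.mem_filter.mp hx).2.trans (Finset.mem_filter.mp hy).2.symm)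
      have hcover : (Finset.univ : Finset {v : Fin k → ZMod 2 // v ≠ 0}) ⊆
          R ∪ ({b₁, b₂} ∪ Finset.univ.filter fun r => b₁.val + b₂.val + r.val = 0) := by
        intro r _
        simp only [hR, Finset.mem_union, Finset.mem_filter, Finset.mem_univ, true_and,
          Finset.mem_insert, Finset.mem_singleton]
        tauto
      have h1 := Finset.card_le_card hcover
      have h2 := Finset.card_union_le R
        ({b₁, b₂} ∪ Finset.univ.filter fun r => b₁.val + b₂.val + r.val = 0)
      have h3 := Finset.card_union_le {b₁, b₂}
        (Finset.univ.filter fun r : {v : Fin k → ZMod 2 // v ≠ 0} => b₁.val + b₂.val + r.val = 0)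
      have h4 := Finset.card_le_two (a := b₁) (b := b₂)
      rw [Finset.card_univ] at h1
      have h5 : Fintype.card {v : Fin k → ZMod 2 // v ≠ 0} ≤ R.card + 3 := by omega
      have h6 : (Fintype.card {v : Fin k → ZMod 2 // v ≠ 0} : ℝ) ≤ R.card + 3 := by
        exact_mod_cast h5
      linarith
    have := sum_kron_mul_card_le
      (fun t : GL (Fin k) (ZMod 2) => kron (t • a₁) b₁ * kron (t • a₂) b₂)
      (fun t => mul_nonneg (kron_nonneg _ _) (kron_nonneg _ _)) a₃ b₃ R fun r hr => by
        obtain ⟨h1, h2, h3⟩ := (Finset.mem_filter.mp hr).2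
        obtain ⟨g, hg, hg'⟩ := exists_mulVec_eq_of_notMem
          (Submodule.span (ZMod 2) {b₁.val, b₂.val}) (notMem b₃ h13.symm h23.symm hτ)
          (notMem r h1 h2 h3)
        refine ⟨g, Subtype.ext hg', fun t => ?_⟩
        rw [kron_mul_smul_of_fixed (Subtype.ext (hg _ (Submodule.subset_span (by simp)))),
          kron_mul_smul_of_fixed (Subtype.ext (hg _ (Submodule.subset_span (by simp))))]
    simp only [mul_assoc] at this
    refine (mul_le_mul_of_nonneg_left hcard (Finset.sum_nonneg fun t _ => ?_)).trans this
    exact mul_nonneg (kron_nonneg _ _) (mul_nonneg (kron_nonneg _ _) (kron_nonneg _ _))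
  have smul_iff : ∀ (g : GL (Fin k) (ZMod 2)) (a b c : {v : Fin k → ZMod 2 // v ≠ 0}),
      (g • a).val + (g • b).val + (g • c).val = 0 ↔ a.val + b.val + c.val = 0 := by
    intro g a b c
    simp only [coe_smul_nonzero, ← Matrix.mulVec_add]
    refine ⟨fun h => ?_, fun h => by rw [h, Matrix.mulVec_zero]⟩
    rw [← Matrix.one_mulVec (a.val + b.val + c.val), ← Units.inv_mul g, ← Matrix.mulVec_mulVec, h,
      Matrix.mulVec_zero]
  refine ⟨card_one, card_two, ?_, smul_iff, ?_, ?_, ?_⟩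
  · intro a₁ a₂ a₃ b₁ b₂ b₃ h12 h13 h23 hτ
    have hzero : (∑ t : GL (Fin k) (ZMod 2),
        kron (t • a₁) b₁ * (kron (t • a₂) b₂ * kron (t • a₃) b₃) = 0) →
        (∑ t : GL (Fin k) (ZMod 2),
          kron (t • a₁) b₁ * (kron (t • a₂) b₂ * kron (t • a₃) b₃)) *
        (Fintype.card {v : Fin k → ZMod 2 // v ≠ 0} *
          ((Fintype.card {v : Fin k → ZMod 2 // v ≠ 0} - 1) *
            (Fintype.card {v : Fin k → ZMod 2 // v ≠ 0} - 3))) ≤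
          (Fintype.card (GL (Fin k) (ZMod 2)) : ℝ) := by
      intro h0
      rw [h0, zero_mul]
      positivity
    by_cases e13 : b₁ = b₃
    · refine hzero (Finset.sum_eq_zero fun t _ => ?_)
      rw [mul_left_comm, kron_smul_mul_kron_smul_eq_zero (by simp [h13, e13]), mul_zero]
    by_cases e23 : b₂ = b₃
    · refine hzero (Finset.sum_eq_zero fun t _ => ?_)
      rw [kron_smul_mul_kron_smul_eq_zero (by simp [h23, e23]), mul_zero]
    by_cases eτ : b₁.val + b₂.val + b₃.val = 0
    · refine hzero (Finset.sum_eq_zero fun t _ => ?_)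
      unfold kron
      split_ifs with g1 g2 g3 <;> simp only [mul_zero, mul_one]
      subst g1 g2 g3
      exact absurd ((smul_iff _ _ _ _).mp eτ) hτ
    have hc : (0 : ℝ) ≤ Fintype.card {v : Fin k → ZMod 2 // v ≠ 0} *
        (Fintype.card {v : Fin k → ZMod 2 // v ≠ 0} - 1) := by
      have : (1 : ℝ) ≤ Fintype.card {v : Fin k → ZMod 2 // v ≠ 0} := by
        exact_mod_cast Fintype.card_pos_iff.mpr ⟨a₁⟩
      exact mul_nonneg (by linarith) (by linarith)
    calc _ = (∑ t : GL (Fin k) (ZMod 2),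
          kron (t • a₁) b₁ * (kron (t • a₂) b₂ * kron (t • a₃) b₃)) *
            (Fintype.card {v : Fin k → ZMod 2 // v ≠ 0} - 3) *
            (Fintype.card {v : Fin k → ZMod 2 // v ≠ 0} *
              (Fintype.card {v : Fin k → ZMod 2 // v ≠ 0} - 1)) := by ring
      _ ≤ _ := (mul_le_mul_of_nonneg_right (triple a₁ a₂ a₃ b₁ b₂ b₃ e13 e23 eτ) hc).trans
          (card_two a₁ a₂ b₁ b₂ h12)
  · intro a b c h
    refine ⟨?_, ?_, ?_⟩
    · rintro rfl
      rw [two, zero_add] at h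
      exact c.2 h
    · rintro rfl
      rw [add_right_comm, two, zero_add] at h
      exact b.2 h
    · rintro rfl
      rw [add_assoc, two, add_zero] at h
      exact a.2 h
  · intro a b c c' h h'
    exact Subtype.ext (add_left_cancel (h.trans h'.symm))
  · intro a b b' c h h'
    exact Subtype.ext (add_left_cancel (add_right_cancel (h.trans h'.symm)))

end GeneralLinearIsLineAction

section Spectrum

variable {ι : Type*} [Fintype ι] [DecidableEq ι]

theorem Matrix.IsHermitian.trace_pow_eq_sum_eigenvalues {M : Matrix ι ι ℝ} (hM : M.IsHermitian)
    (p : ℕ) : (M ^ p).trace = ∑ i, hM.eigenvalues i ^ p := by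
  conv_lhs => rw [hM.spectral_theorem, ← map_pow, Unitary.conjStarAlgAut_apply,
    Matrix.trace_mul_comm, ← mul_assoc]
  simp [Matrix.diagonal_pow, Matrix.trace_diagonal]

open Polynomial in
theorem Matrix.IsHermitian.charpoly_neg_eq_prod {M : Matrix ι ι ℝ} (hM : M.IsHermitian) :
    (-M).charpoly = ∏ i, (X - C (-hM.eigenvalues i)) := by
  conv_lhs => rw [hM.spectral_theorem, ← map_neg, Unitary.conjStarAlgAut_apply,
    Matrix.charpoly_mul_comm, ← mul_assoc, Matrix.diagonal_neg]
  simp [Matrix.charpoly_diagonal]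

/-- A symmetric matrix similar to its negative has a spectrum symmetric about zero, with
multiplicities. -/
theorem Matrix.IsHermitian.map_neg_eigenvalues_eq {M D : Matrix ι ι ℝ} (hM : M.IsHermitian)
    (hD : D * D = 1) (hDM : D * M * D = -M) :
    Finset.univ.val.map (fun i => -hM.eigenvalues i) = Finset.univ.val.map hM.eigenvalues := by
  have h : (-M).charpoly = M.charpoly := by
    rw [← hDM, mul_assoc, Matrix.charpoly_mul_comm, mul_assoc, hD, mul_one]
  have h1 := congrArg Polynomial.roots h
  rw [hM.charpoly_neg_eq_prod, hM.roots_charpoly_eq_eigenvalues, Polynomial.roots_prod _ _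
    (by simp only [Finset.prod_ne_zero_iff]; exact fun i _ => Polynomial.X_sub_C_ne_zero _)] at h1
  simp only [Polynomial.roots_X_sub_C, Multiset.bind_singleton] at h1
  exact h1

/-- For a family symmetric about zero containing `±1` and a further element `c`, both `c` and `-c`
contribute to the even power sums besides `±1`. -/
theorem two_add_two_mul_pow_le_sum {κ : Type*} [Fintype κ] [DecidableEq κ] (f : κ → ℝ)
    (hf : Finset.univ.val.map (fun i => -f i) = Finset.univ.val.map f) {i j l : κ}
    (hij : i ≠ j) (hil : i ≠ l) (hjl : j ≠ l) (h : f i = 1 ∧ f j = -1 ∨ f i = -1 ∧ f j = 1)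
    {m : ℕ} (hm : 0 < m) : 2 + 2 * |f l| ^ (2 * m) ≤ ∑ x, f x ^ (2 * m) := by
  have even_nonneg : ∀ x, 0 ≤ f x ^ (2 * m) := fun x => (even_two_mul m).pow_nonneg _
  have habs : |f l| ^ (2 * m) = f l ^ (2 * m) := (even_two_mul m).pow_abs _
  have hi : f i ^ (2 * m) = 1 := by
    rcases h with h | h <;> simp [h.1]
  have hj : f j ^ (2 * m) = 1 := by
    rcases h with h | h <;> simp [h.2]
  by_cases h0 : f l = 0
  · calc 2 + 2 * |f l| ^ (2 * m) = ∑ x ∈ {i, j}, f x ^ (2 * m) := by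
          rw [Finset.sum_pair hij, hi, hj, habs, h0, zero_pow (by omega)]
          norm_num
      _ ≤ _ := Finset.sum_le_sum_of_subset_of_nonneg (Finset.subset_univ _)
          fun x _ _ => even_nonneg x
  obtain ⟨q, hqi, hqj, hql⟩ : ∃ q, q ≠ i ∧ q ≠ j ∧ f q = -f l := by
    set R := (Finset.univ.erase i).erase j with hR
    have hmap : ∀ g : κ → ℝ, Finset.univ.val.map g = g i ::ₘ g j ::ₘ R.val.map g := by
      intro g
      rw [← Multiset.map_cons, ← Multiset.map_cons, hR, Finset.erase_val (Finset.univ.erase i),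
        Multiset.cons_erase (show j ∈ Finset.univ.erase i by simp [hij.symm]),
        Finset.erase_val,
        Multiset.cons_erase (Finset.mem_univ i)]
    have hsum : f j = -f i := by
      rcases h with h | h <;> simp [h.1, h.2]
    rw [hmap, hmap, hsum, neg_neg, Multiset.cons_swap, Multiset.cons_inj_right,
      Multiset.cons_inj_right] at hf
    have hmem : -f l ∈ R.val.map f :=
      hf ▸ Multiset.mem_map_of_mem (fun x => -f x)
        (show l ∈ R by simp [hR, hil.symm, hjl.symm])
    obtain ⟨q, hq, hql⟩ := Multiset.mem_map.mp hmem
    have hq' : q ≠ j ∧ q ≠ i := by simpa [hR] using (show q ∈ R from hq)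
    exact ⟨q, hq'.2, hq'.1, hql⟩
  have hlq : l ≠ q := by
    rintro rfl
    exact h0 (by linarith)
  calc 2 + 2 * |f l| ^ (2 * m) = ∑ x ∈ {i, j, l, q}, f x ^ (2 * m) := by
        rw [Finset.sum_insert (by simp [hij, hil, hqi.symm]),
          Finset.sum_insert (by simp [hjl, hqj.symm]), Finset.sum_pair hlq, hi, hj, habs, hql,
          (even_two_mul m).neg_pow]
        ring
    _ ≤ _ := Finset.sum_le_sum_of_subset_of_nonneg (Finset.subset_univ _)
        fun x _ _ => even_nonneg x

theorem trace_bipartite_pow (A : Matrix ι ι ℝ) (c : ℝ) (m : ℕ) :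
    ((c • Matrix.fromBlocks 0 A A.transpose 0) ^ (2 * m)).trace =
      c ^ (2 * m) * (((A * A.transpose) ^ m).trace + ((A.transpose * A) ^ m).trace) := by
  rw [smul_pow, Matrix.trace_smul, pow_mul (Matrix.fromBlocks _ _ _ _), sq,
    Matrix.fromBlocks_multiply]
  simp only [zero_mul, mul_zero, zero_add, add_zero, Matrix.fromBlocks_diagonal_pow,
    Matrix.trace, Fintype.sum_sum_type, Matrix.diag_apply, Matrix.fromBlocks_apply₁₁,
    Matrix.fromBlocks_apply₂₂, smul_eq_mul]

theorem bipartite_signs_mul_self :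
    Matrix.fromBlocks (1 : Matrix ι ι ℝ) 0 0 (-1 : Matrix ι ι ℝ) *
      Matrix.fromBlocks 1 0 0 (-1) = 1 := by
  simp [Matrix.fromBlocks_multiply]

theorem bipartite_signs_conj (A : Matrix ι ι ℝ) (c : ℝ) :
    Matrix.fromBlocks (1 : Matrix ι ι ℝ) 0 0 (-1) * (c • Matrix.fromBlocks 0 A A.transpose 0) *
      Matrix.fromBlocks 1 0 0 (-1) = -(c • Matrix.fromBlocks 0 A A.transpose 0) := by
  simp [Matrix.fromBlocks_multiply, Matrix.fromBlocks_smul, Matrix.fromBlocks_neg]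

end Spectrum

section TraceOfWalks

variable {G X : Type*} [Group G] [DecidableEq X] [Fintype X] [MulAction G X] {d : ℕ}

theorem sum_kron_wordProd_eq_pow (s : Fin d → G) (P : Bool → Matrix X X ℝ)
    (hP : ∀ ε x y, P ε x y = ∑ a, kron (signed ε (s a) • x) y) (ε : Bool) (m : ℕ) (x y : X) :
    ∑ w ∈ wordsOver (Finset.univ : Finset (Fin d)) (2 * m), kron (wordProd s ε w • x) y =
      ((P (!ε) * P ε) ^ m) x y := by
  have step : ∀ δ l (Q : Matrix X X ℝ), (∀ x y,
      ∑ w ∈ wordsOver (Finset.univ : Finset (Fin d)) l, kron (wordProd s (!δ) w • x) y = Q x y) →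
      ∀ x y, ∑ w ∈ wordsOver (Finset.univ : Finset (Fin d)) (l + 1), kron (wordProd s δ w • x) y =
        (Q * P δ) x y := by
    intro δ l Q hQ x y
    rw [sum_wordsOver_succ, Matrix.mul_apply]
    simp only [← hQ, hP, wordProd, Finset.sum_mul_sum]
    rw [Finset.sum_comm, Finset.sum_comm (s := Finset.univ (α := X))]
    refine Finset.sum_congr rfl fun w _ => ?_
    rw [Finset.sum_comm]
    refine Finset.sum_congr rfl fun a _ => ?_
    rw [Fintype.sum_eq_single (wordProd s (!δ) w • x) fun z hz => by
      rw [kron_of_ne hz.symm, zero_mul], kron_self, one_mul, mul_smul]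
  induction m generalizing x y with
  | zero => simp only [wordsOver, Finset.sum_singleton, wordProd, pow_zero,
      Matrix.one_apply, one_smul, kron]
  | succ m ih =>
    rw [Nat.mul_succ, pow_succ, ← mul_assoc]
    refine step ε _ _ (step (!ε) _ _ ?_) x y
    simpa using ih

theorem sum_fixCount_wordProd_eq_trace (s : Fin d → G) (P : Bool → Matrix X X ℝ)
    (hP : ∀ ε x y, P ε x y = ∑ a, kron (signed ε (s a) • x) y) (ε : Bool) (m : ℕ) :
    ∑ w ∈ wordsOver (Finset.univ : Finset (Fin d)) (2 * m), fixCount X (wordProd s ε w) =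
      ((P (!ε) * P ε) ^ m).trace := by
  simp only [fixCount, Matrix.trace, Matrix.diag_apply, ← sum_kron_wordProd_eq_pow s P hP]
  exact Finset.sum_comm

end TraceOfWalks

/-- The power mean inequality for a uniform average, in the form of a bound on the mean. -/
theorem mean_le_rpow_of_mean_pow_le {Ω : Type*} [Fintype Ω] [Nonempty Ω] (f : Ω → ℝ)
    (hf : ∀ s, 0 ≤ f s) {p : ℕ} (hp : p ≠ 0) {B : ℝ}
    (hB : (∑ s, f s ^ p) / Fintype.card Ω ≤ B) :
    (∑ s, f s) / Fintype.card Ω ≤ B ^ ((1 : ℝ) / p) := by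
  have hS : (0 : ℝ) < Fintype.card Ω := by exact_mod_cast Fintype.card_pos
  have h0 : 0 ≤ (∑ s, f s) / Fintype.card Ω :=
    div_nonneg (Finset.sum_nonneg fun s _ => hf s) hS.le
  have h1 := Real.pow_arith_mean_le_arith_mean_pow Finset.univ
    (fun _ : Ω => (Fintype.card Ω : ℝ)⁻¹) f (fun _ _ => by positivity)
    (by simp [hS.ne']) (fun s _ => hf s) p
  rw [← Finset.mul_sum, ← Finset.mul_sum, inv_mul_eq_div, inv_mul_eq_div] at h1
  rw [one_div, ← Real.pow_rpow_inv_natCast h0 hp]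
  exact Real.rpow_le_rpow (pow_nonneg h0 p) (h1.trans hB) (by positivity)

/-- Let `k ≥ 2`, `d ≥ 1`, `n = 2^k − 1`, and let `s₁, …, s_d` be
independent uniform random elements of `GL_k(F₂)`. Form the bipartite Schreier graph
on two copies of the nonzero vectors of `F₂^k` (with normalized adjacency matrix
`(1/d)·[[0,A],[Aᵀ,0]]`, `A x y = #{i : sᵢ x = y}`) and let `μ s 2` be the third largest
(in absolute value) eigenvalue of this matrix (the two largest being `1` and `−1`).
With `y₃(i) = Y₃(1, 2m−2i, d−i)` and `y₄(i) = Y₄(0, 2m−2i, d−i)`, for every positive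
integer `m`,
`E(|μ|) ≤ ((1/d)^{2m}·n·[Y₁(1,2m,d)·(1/n) + Y₂(1,2m,d)·(2/n) + Σ_{i=1}^{m} C(d,i)·(1/2)^i·((2m)!/(2m−2i)!)·(2^i/(i+1)!)·(y₃(i)·(5/n) + y₄(i)) + y₃(0)·(5/n) + y₄(0)] − 1)^{1/(2m)}`. -/
theorem stmt3
    {k d n m : ℕ} (hk : 2 ≤ k) (hd : 1 ≤ d) (hn : n = 2 ^ k - 1) (hm : 0 < m)
    (A : (Fin d → GL (Fin k) (ZMod 2)) →
      Matrix {v : Fin k → ZMod 2 // v ≠ 0} {v : Fin k → ZMod 2 // v ≠ 0} ℝ)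
    (hA : ∀ s x y, A s x y =
      ((Finset.univ.filter fun i : Fin d =>
          (s i : Matrix (Fin k) (Fin k) (ZMod 2)).mulVec x.val = y.val).card : ℝ))
    (M : (Fin d → GL (Fin k) (ZMod 2)) →
      Matrix ({v : Fin k → ZMod 2 // v ≠ 0} ⊕ {v : Fin k → ZMod 2 // v ≠ 0})
        ({v : Fin k → ZMod 2 // v ≠ 0} ⊕ {v : Fin k → ZMod 2 // v ≠ 0}) ℝ)
    (hM : ∀ s, M s = (d : ℝ)⁻¹ • Matrix.fromBlocks 0 (A s) (A s).transpose 0)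
    (μ : (Fin d → GL (Fin k) (ZMod 2)) → Fin (2 * n) → ℝ)
    (hμ : ∀ s, ∃ hsym : (M s).IsHermitian,
      ∃ e : Fin (2 * n) ≃ ({v : Fin k → ZMod 2 // v ≠ 0} ⊕ {v : Fin k → ZMod 2 // v ≠ 0}),
      (∀ i, μ s i = hsym.eigenvalues (e i)) ∧
      (∀ i j : Fin (2 * n), i ≤ j → |μ s j| ≤ |μ s i|) ∧
      ((μ s ⟨0, by
          have h4 : 4 ≤ 2 ^ k := by
            calc (4:ℕ) = 2 ^ 2 := rfl
            _ ≤ 2 ^ k := Nat.pow_le_pow_right (by norm_num) hk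
          omega⟩ = 1 ∧ μ s ⟨1, by
          have h4 : 4 ≤ 2 ^ k := by
            calc (4:ℕ) = 2 ^ 2 := rfl
            _ ≤ 2 ^ k := Nat.pow_le_pow_right (by norm_num) hk
          omega⟩ = -1) ∨
        (μ s ⟨0, by
          have h4 : 4 ≤ 2 ^ k := by
            calc (4:ℕ) = 2 ^ 2 := rfl
            _ ≤ 2 ^ k := Nat.pow_le_pow_right (by norm_num) hk
          omega⟩ = -1 ∧ μ s ⟨1, by
          have h4 : 4 ≤ 2 ^ k := by
            calc (4:ℕ) = 2 ^ 2 := rfl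
            _ ≤ 2 ^ k := Nat.pow_le_pow_right (by norm_num) hk
          omega⟩ = 1))) :
    (∑ s : Fin d → GL (Fin k) (ZMod 2), |μ s ⟨2, by
          have h4 : 4 ≤ 2 ^ k := by
            calc (4:ℕ) = 2 ^ 2 := rfl
            _ ≤ 2 ^ k := Nat.pow_le_pow_right (by norm_num) hk
          omega⟩|)
        / (Fintype.card (GL (Fin k) (ZMod 2)) : ℝ) ^ d
      ≤ ((1 / (d : ℝ)) ^ (2 * m) * n *
          (Yrec 1 1 (2 * m) d * (1 / n)
          + Yrec 2 1 (2 * m) d * (2 / n)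
          + (∑ i ∈ Finset.Icc 1 m, (d.choose i : ℝ) * ((1 : ℝ) / 2) ^ i *
            ((Nat.factorial (2 * m) : ℝ) / (Nat.factorial (2 * m - 2 * i) : ℝ)) *
            ((2 : ℝ) ^ i / (Nat.factorial (i + 1) : ℝ)) *
            (Yrec 3 1 (2 * m - 2 * i) (d - i) * (5 / n)
              + Yrec 4 0 (2 * m - 2 * i) (d - i)))
          + Yrec 3 1 (2 * m) d * (5 / n) + Yrec 4 0 (2 * m) d) - 1) ^ ((1 : ℝ) / (2 * m)) := by
  have hcard : Fintype.card {v : Fin k → ZMod 2 // v ≠ 0} = n := by rw [card_nonzeroVector, hn]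
  have hcardΩ : (Fintype.card (Fin d → GL (Fin k) (ZMod 2)) : ℝ) =
      (Fintype.card (GL (Fin k) (ZMod 2)) : ℝ) ^ d := by
    simp
  have hX : 3 ≤ Fintype.card {v : Fin k → ZMod 2 // v ≠ 0} := by
    have h4 : 2 ^ 2 ≤ 2 ^ k := Nat.pow_le_pow_right (by norm_num) hk
    omega
  have hS : (0 : ℝ) < Fintype.card (Fin d → GL (Fin k) (ZMod 2)) := by
    exact_mod_cast Fintype.card_pos
  have hd0 : (0 : ℝ) ≤ (1 / (d : ℝ)) ^ (2 * m) := by positivity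
  suffices key : ∀ B : ℝ, (∀ ε, ∑ w ∈ wordsOver (Finset.univ : Finset (Fin d)) (2 * m),
      expectedFix (GL (Fin k) (ZMod 2)) {v : Fin k → ZMod 2 // v ≠ 0} ε w ≤ B) →
      (∑ s, |μ s ⟨2, by omega⟩|) / (Fintype.card (GL (Fin k) (ZMod 2)) : ℝ) ^ d ≤
        ((1 / (d : ℝ)) ^ (2 * m) * B - 1) ^ ((1 : ℝ) / (2 * m)) by
    have h := key _ fun ε => isLineAction_generalLinear.sum_expectedFix_le hX ε d m
    rwa [hcard, ← mul_assoc] at h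
  intro B hB
  have hwords : ∀ ε, ∑ s : Fin d → GL (Fin k) (ZMod 2),
      ∑ w ∈ wordsOver (Finset.univ : Finset (Fin d)) (2 * m),
        fixCount {v : Fin k → ZMod 2 // v ≠ 0} (wordProd s ε w) ≤
        B * Fintype.card (Fin d → GL (Fin k) (ZMod 2)) := by
    intro ε
    have h := hB ε
    simp only [expectedFix] at h
    rwa [← Finset.sum_div, Finset.sum_comm, div_le_iff₀ hS] at h
  have hspec : ∀ s, 2 + 2 * |μ s ⟨2, by omega⟩| ^ (2 * m) ≤ (1 / (d : ℝ)) ^ (2 * m) *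
      ((∑ w ∈ wordsOver (Finset.univ : Finset (Fin d)) (2 * m),
        fixCount {v : Fin k → ZMod 2 // v ≠ 0} (wordProd s false w)) +
      ∑ w ∈ wordsOver (Finset.univ : Finset (Fin d)) (2 * m),
        fixCount {v : Fin k → ZMod 2 // v ≠ 0} (wordProd s true w)) := by
    intro s
    obtain ⟨hsym, e, he, -, h01⟩ := hμ s
    have hP : ∀ ε x y, (if ε then A s else (A s).transpose) x y =
        ∑ a, kron (signed ε (s a) • x) y := by
      have hAs : ∀ x y, A s x y = ∑ a, kron (s a • x) y := by
        intro x y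
        simp only [hA, kron, Subtype.ext_iff, coe_smul_nonzero, Finset.sum_boole]
      intro ε x y
      simp only [kron_signed_smul]
      cases ε <;> simp [hAs]
    have hsymm : Finset.univ.val.map (fun i => -μ s i) = Finset.univ.val.map (μ s) := by
      have h1 := hsym.map_neg_eigenvalues_eq bipartite_signs_mul_self
        (by rw [hM]; exact bipartite_signs_conj _ _)
      have huniv : (Finset.univ : Finset (Fin (2 * n))).val.map e = Finset.univ.val := by
        rw [← Finset.map_univ_equiv e]
        rfl
      rw [← huniv, Multiset.map_map, Multiset.map_map] at h1
      simp only [he]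
      exact h1
    have hle := two_add_two_mul_pow_le_sum (μ s) hsymm (i := ⟨0, by omega⟩) (j := ⟨1, by omega⟩)
      (l := ⟨2, by omega⟩) (by simp) (by simp) (by simp) h01 hm
    refine hle.trans (le_of_eq ?_)
    rw [sum_fixCount_wordProd_eq_trace s _ hP, sum_fixCount_wordProd_eq_trace s _ hP, one_div]
    simp only [he]
    rw [Equiv.sum_comp e fun i => hsym.eigenvalues i ^ (2 * m),
      ← hsym.trace_pow_eq_sum_eigenvalues, hM, trace_bipartite_pow]
    simp
  have hmean : (∑ s, |μ s ⟨2, by omega⟩| ^ (2 * m)) /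
      Fintype.card (Fin d → GL (Fin k) (ZMod 2)) ≤ (1 / (d : ℝ)) ^ (2 * m) * B - 1 := by
    rw [div_le_iff₀ hS]
    have hsum := Finset.sum_le_sum fun s (_ : s ∈ Finset.univ) => hspec s
    rw [Finset.sum_add_distrib, ← Finset.mul_sum, ← Finset.mul_sum, Finset.sum_add_distrib,
      Finset.sum_const, Finset.card_univ, nsmul_eq_mul] at hsum
    have hbound := mul_le_mul_of_nonneg_left (add_le_add (hwords false) (hwords true)) hd0
    linarith
  have h := mean_le_rpow_of_mean_pow_le _ (fun s => abs_nonneg (μ s ⟨2, by omega⟩))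
    (by omega : 2 * m ≠ 0) hmean
  rwa [hcardΩ, Nat.cast_mul, Nat.cast_ofNat] at h
end

section
/- Let n₁, d₁, γ be positive integers with γ dividing n₁; set n₂ = n₁/γ and d₂ = γ·d₁. Let A be an n₁×n₁ real matrix with nonnegative integer entries all of whose row sums and column sums equal d₁ (the biadjacency matrix of a bipartite d₁-regular multigraph G with parts of size n₁), and suppose α ≥ 0 is such that every eigenvalue of the normalized adjacency matrix (1/d₁)·[[0,A],[Aᵀ,0]] of G, except its two largest in absolute value (which are 1 and −1), has absolute value at most α. Let M be the n₁×n₂ matrix obtained from A by merging every γ consecutive columns (M_{x,j} = Σ_{y : ⌈y/γ⌉ = j} A_{x,y}), and let P = [[0,M],[Mᵀ,0]] be the adjacency matrix of the resulting d₁,d₂-biregular bipartite multigraph H. Then every eigenvalue of P, except its two largest in absolute value (which are √(d₁d₂) and −√(d₁d₂)), has absolute value at most √(d₁d₂)·α. -/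
open scoped BigOperators

namespace Matrix

section Spectral

variable {n : Type*} [Fintype n] [DecidableEq n]

/-- A real symmetric matrix is diagonalized by an orthogonal matrix. -/
theorem IsHermitian.exists_orthogonal_diagonalization {N : Matrix n n ℝ} (hN : N.IsHermitian) :
    ∃ U : Matrix n n ℝ, U * Uᵀ = 1 ∧ Uᵀ * U = 1 ∧ U * N = diagonal hN.eigenvalues * U := by
  set V : Matrix n n ℝ := ↑hN.eigenvectorUnitary with hV
  have h1 : star V * V = 1 := Unitary.coe_star_mul_self _
  have h2 : V * star V = 1 := Unitary.coe_mul_star_self _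
  have ht : (star V)ᵀ = V := by
    ext i j
    simp [Matrix.star_apply]
  refine ⟨star V, by rw [ht, h1], by rw [ht, h2], ?_⟩
  have h := hN.spectral_theorem
  rw [Unitary.conjStarAlgAut_apply, ← hV] at h
  have h' := congrArg (star V * ·) h
  simp only [← mul_assoc, h1, one_mul] at h'
  exact h'

variable {U N : Matrix n n ℝ} {ev : n → ℝ}

theorem dotProduct_mulVec_mulVec_of_transpose_mul_eq_one (hU : Uᵀ * U = 1) (v w : n → ℝ) :
    (U *ᵥ v) ⬝ᵥ (U *ᵥ w) = v ⬝ᵥ w := by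
  rw [dotProduct_mulVec, ← mulVec_transpose, mulVec_mulVec, hU, one_mulVec]

theorem mulVec_mulVec_apply_of_diagonalizes (hUN : U * N = diagonal ev * U) (z : n → ℝ) (i : n) :
    (U *ᵥ (N *ᵥ z)) i = ev i * (U *ᵥ z) i := by
  rw [mulVec_mulVec, hUN, ← mulVec_mulVec, mulVec_diagonal]

theorem dotProduct_self_eq_sum_sq {m : Type*} [Fintype m] (z : m → ℝ) :
    z ⬝ᵥ z = ∑ i, z i ^ 2 := by
  simp [dotProduct, sq]

theorem dotProduct_mulVec_self_eq_sum (hU : Uᵀ * U = 1) (hUN : U * N = diagonal ev * U)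
    (z : n → ℝ) : (N *ᵥ z) ⬝ᵥ (N *ᵥ z) = ∑ i, ev i ^ 2 * (U *ᵥ z) i ^ 2 := by
  rw [← dotProduct_mulVec_mulVec_of_transpose_mul_eq_one hU, dotProduct_self_eq_sum_sq]
  simp only [mulVec_mulVec_apply_of_diagonalizes hUN, mul_pow]

theorem dotProduct_self_eq_sum_mulVec_sq (hU : Uᵀ * U = 1) (z : n → ℝ) :
    z ⬝ᵥ z = ∑ i, (U *ᵥ z) i ^ 2 := by
  rw [← dotProduct_mulVec_mulVec_of_transpose_mul_eq_one hU, dotProduct_self_eq_sum_sq]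

/-- If every eigenvalue that occurs in the expansion of `z` is at most `c` in absolute value,
then `N` stretches `z` by a factor of at most `c`. -/
theorem dotProduct_mulVec_self_le (hU : Uᵀ * U = 1) (hUN : U * N = diagonal ev * U) {c : ℝ}
    {z : n → ℝ} (h : ∀ i, (U *ᵥ z) i = 0 ∨ |ev i| ≤ c) :
    (N *ᵥ z) ⬝ᵥ (N *ᵥ z) ≤ c ^ 2 * (z ⬝ᵥ z) := by
  rw [dotProduct_mulVec_self_eq_sum hU hUN, dotProduct_self_eq_sum_mulVec_sq hU z, Finset.mul_sum]
  refine Finset.sum_le_sum fun i _ => ?_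
  rcases h i with h | h
  · simp [h]
  · have : ev i ^ 2 ≤ c ^ 2 := sq_le_sq' (abs_le.mp h).1 (abs_le.mp h).2
    gcongr

/-- If every eigenvalue that occurs in the expansion of `z` is at least `c` in absolute value,
then `N` stretches `z` by a factor of at least `c`. -/
theorem le_dotProduct_mulVec_self (hU : Uᵀ * U = 1) (hUN : U * N = diagonal ev * U) {c : ℝ}
    (hc : 0 ≤ c) {z : n → ℝ} (h : ∀ i, (U *ᵥ z) i = 0 ∨ c ≤ |ev i|) :
    c ^ 2 * (z ⬝ᵥ z) ≤ (N *ᵥ z) ⬝ᵥ (N *ᵥ z) := by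
  rw [dotProduct_mulVec_self_eq_sum hU hUN, dotProduct_self_eq_sum_mulVec_sq hU z, Finset.mul_sum]
  refine Finset.sum_le_sum fun i _ => ?_
  rcases h i with h | h
  · simp [h]
  · have : c ^ 2 ≤ ev i ^ 2 := by
      rw [← sq_abs (ev i)]
      gcongr
    gcongr

theorem IsHermitian.exists_eigenvalues_eq (hN : N.IsHermitian) {μ : ℝ} {w : n → ℝ} (hw : w ≠ 0)
    (h : N *ᵥ w = μ • w) : ∃ i, hN.eigenvalues i = μ := by
  obtain ⟨U, -, hU, hUN⟩ := hN.exists_orthogonal_diagonalization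
  by_contra! hne
  refine hw ?_
  have h0 : U *ᵥ w = 0 := by
    ext i
    have hi := mulVec_mulVec_apply_of_diagonalizes hUN w i
    rw [h, mulVec_smul, Pi.smul_apply, smul_eq_mul] at hi
    exact (mul_eq_mul_right_iff.mp hi).resolve_left (hne i).symm
  rw [← one_mulVec w, ← hU, ← mulVec_mulVec, h0, mulVec_zero]

theorem IsHermitian.abs_eigenvalues_le (hN : N.IsHermitian) {c : ℝ} (hc : 0 ≤ c)
    (h : ∀ z, (N *ᵥ z) ⬝ᵥ (N *ᵥ z) ≤ c ^ 2 * (z ⬝ᵥ z)) (i : n) : |hN.eigenvalues i| ≤ c := by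
  obtain ⟨U, hU', hU, hUN⟩ := hN.exists_orthogonal_diagonalization
  set z := Uᵀ *ᵥ Pi.single i 1 with hz
  have hUz : U *ᵥ z = Pi.single i 1 := by rw [hz, mulVec_mulVec, hU', one_mulVec]
  have hz1 : z ⬝ᵥ z = 1 := by
    rw [← dotProduct_mulVec_mulVec_of_transpose_mul_eq_one hU, hUz, single_one_dotProduct,
      Pi.single_eq_same]
  have hlow : |hN.eigenvalues i| ^ 2 * (z ⬝ᵥ z) ≤ (N *ᵥ z) ⬝ᵥ (N *ᵥ z) := by
    refine le_dotProduct_mulVec_self hU hUN (abs_nonneg _) fun j => ?_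
    by_cases hj : j = i
    · exact Or.inr (by rw [hj])
    · exact Or.inl (by rw [hUz, Pi.single_eq_of_ne hj])
  have := hlow.trans (h z)
  rw [hz1, mul_one, mul_one] at this
  exact le_of_sq_le_sq this hc

/-- If `N` stretches vectors orthogonal to `w₁` and `w₂` by a factor of at most `c`, then at most
two eigenvalues exceed `c` in absolute value. -/
theorem IsHermitian.abs_eigenvalues_le_of_two_lt_card (hN : N.IsHermitian) {c : ℝ} (hc : 0 ≤ c)
    {w₁ w₂ : n → ℝ}
    (h : ∀ z, w₁ ⬝ᵥ z = 0 → w₂ ⬝ᵥ z = 0 → (N *ᵥ z) ⬝ᵥ (N *ᵥ z) ≤ c ^ 2 * (z ⬝ᵥ z)) (i : n)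
    (hi : 2 < Fintype.card {j // |hN.eigenvalues i| ≤ |hN.eigenvalues j|}) :
    |hN.eigenvalues i| ≤ c := by
  obtain ⟨U, hU', hU, hUN⟩ := hN.exists_orthogonal_diagonalization
  let E : ({j // |hN.eigenvalues i| ≤ |hN.eigenvalues j|} → ℝ) →ₗ[ℝ] (n → ℝ) :=
    Function.ExtendByZero.linearMap ℝ Subtype.val
  let L : ({j // |hN.eigenvalues i| ≤ |hN.eigenvalues j|} → ℝ) →ₗ[ℝ] (Fin 2 → ℝ) :=
    (Matrix.of ![w₁, w₂]).mulVecLin ∘ₗ Uᵀ.mulVecLin ∘ₗ E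
  obtain ⟨t, htL, ht⟩ := (Submodule.ne_bot_iff _).mp
    (L.ker_ne_bot_of_finrank_lt (by simpa using hi))
  rw [LinearMap.mem_ker] at htL
  set z := Uᵀ *ᵥ E t with hz
  have hUz : U *ᵥ z = E t := by rw [hz, mulVec_mulVec, hU', one_mulVec]
  have hz1 : w₁ ⬝ᵥ z = 0 := congrFun htL 0
  have hz2 : w₂ ⬝ᵥ z = 0 := congrFun htL 1
  have hlow : |hN.eigenvalues i| ^ 2 * (z ⬝ᵥ z) ≤ (N *ᵥ z) ⬝ᵥ (N *ᵥ z) := by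
    refine le_dotProduct_mulVec_self hU hUN (abs_nonneg _) fun j => ?_
    by_cases hj : |hN.eigenvalues i| ≤ |hN.eigenvalues j|
    · exact Or.inr hj
    · left
      rw [hUz]
      exact Function.extend_apply' _ _ _ fun ⟨k, hk⟩ => hj (hk ▸ k.2)
  have hpos : 0 < z ⬝ᵥ z := by
    obtain ⟨k, hk⟩ := Function.ne_iff.mp ht
    rw [dotProduct_self_eq_sum_mulVec_sq hU, hUz]
    refine Finset.sum_pos' (fun _ _ => sq_nonneg _) ⟨k, Finset.mem_univ _, ?_⟩
    have : E t k = t k := Subtype.val_injective.extend_apply _ _ _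
    rw [this]
    exact sq_pos_of_ne_zero hk
  have := le_of_mul_le_mul_right (hlow.trans (h z hz1 hz2)) hpos
  exact le_of_sq_le_sq this hc

/-- If only two eigenvalues exceed `c` in absolute value and `w₁`, `w₂` are orthogonal eigenvectors
for such eigenvalues, then `N` stretches vectors orthogonal to both by a factor of at most `c`. -/
theorem IsHermitian.dotProduct_mulVec_self_le_of_orthogonal (hN : N.IsHermitian) {c : ℝ}
    {i₀ i₁ : n} (hc : ∀ i, i ≠ i₀ → i ≠ i₁ → |hN.eigenvalues i| ≤ c) {w₁ w₂ : n → ℝ} {μ₁ μ₂ : ℝ}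
    (h01 : i₀ ≠ i₁) (hw₁ : w₁ ≠ 0) (hw₂ : w₂ ≠ 0) (hw : w₁ ⬝ᵥ w₂ = 0)
    (h₁ : N *ᵥ w₁ = μ₁ • w₁) (h₂ : N *ᵥ w₂ = μ₂ • w₂) (hμ₁ : c < |μ₁|) (hμ₂ : c < |μ₂|)
    {z : n → ℝ} (hz₁ : w₁ ⬝ᵥ z = 0) (hz₂ : w₂ ⬝ᵥ z = 0) :
    (N *ᵥ z) ⬝ᵥ (N *ᵥ z) ≤ c ^ 2 * (z ⬝ᵥ z) := by
  obtain ⟨U, -, hU, hUN⟩ := hN.exists_orthogonal_diagonalization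
  have supp : ∀ {w : n → ℝ} {μ : ℝ}, N *ᵥ w = μ • w → c < |μ| →
      ∀ i, i ≠ i₀ → i ≠ i₁ → (U *ᵥ w) i = 0 := by
    intro w μ h hμ i hi0 hi1
    have hi := mulVec_mulVec_apply_of_diagonalizes hUN w i
    rw [h, mulVec_smul, Pi.smul_apply, smul_eq_mul] at hi
    refine (mul_eq_mul_right_iff.mp hi).resolve_left fun he => ?_
    have := hc i hi0 hi1
    rw [← he] at this
    exact absurd this (not_le.mpr hμ)
  have expand : ∀ {w : n → ℝ}, (∀ i, i ≠ i₀ → i ≠ i₁ → (U *ᵥ w) i = 0) → ∀ v,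
      w ⬝ᵥ v = (U *ᵥ w) i₀ * (U *ᵥ v) i₀ + (U *ᵥ w) i₁ * (U *ᵥ v) i₁ := by
    intro w h v
    rw [← dotProduct_mulVec_mulVec_of_transpose_mul_eq_one hU]
    exact Fintype.sum_eq_add i₀ i₁ h01 fun i hi => by rw [h i hi.1 hi.2, zero_mul]
  have e₁ := expand (supp h₁ hμ₁)
  have e₂ := expand (supp h₂ hμ₂)
  have p₁ : w₁ ⬝ᵥ w₁ ≠ 0 := by simpa using hw₁
  have p₂ : w₂ ⬝ᵥ w₂ ≠ 0 := by simpa using hw₂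
  rw [e₁] at hw hz₁ p₁
  rw [e₂] at hz₂ p₂
  generalize (U *ᵥ w₁) i₀ = a at *
  generalize (U *ᵥ w₁) i₁ = b at *
  generalize (U *ᵥ w₂) i₀ = a' at *
  generalize (U *ᵥ w₂) i₁ = b' at *
  have hdet : a * b' - b * a' ≠ 0 := by
    intro h
    refine mul_ne_zero p₁ p₂ ?_
    linear_combination (a * b' - b * a') * h + (a * a' + b * b') * hw
  refine dotProduct_mulVec_self_le hU hUN fun i => ?_
  by_cases hi0 : i = i₀
  · left
    subst hi0
    refine (mul_eq_zero.mp ?_).resolve_left hdet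
    linear_combination b' * hz₁ - b * hz₂
  by_cases hi1 : i = i₁
  · left
    subst hi1
    refine (mul_eq_zero.mp ?_).resolve_left hdet
    linear_combination a * hz₂ - a' * hz₁
  exact Or.inr (hc i hi0 hi1)

end Spectral

section Merge

variable {l m k : Type*} [Fintype m] [DecidableEq k]
  {A : Matrix l m ℝ} {M : Matrix l k ℝ} {g : m → k}

theorem mulVec_of_merge [Fintype k] (hM : ∀ x j, M x j = ∑ y with g y = j, A x y) (w : k → ℝ) :
    M *ᵥ w = A *ᵥ (w ∘ g) := by
  ext x
  simp only [mulVec, dotProduct, hM, Finset.sum_mul, Function.comp_apply]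
  rw [← Finset.sum_fiberwise Finset.univ g fun y => A x y * w (g y)]
  refine Finset.sum_congr rfl fun j _ => Finset.sum_congr rfl fun y hy => ?_
  rw [(Finset.mem_filter.mp hy).2]

theorem transpose_mulVec_apply_of_merge [Fintype l] (hM : ∀ x j, M x j = ∑ y with g y = j, A x y)
    (v : l → ℝ) (j : k) : (Mᵀ *ᵥ v) j = ∑ y with g y = j, (Aᵀ *ᵥ v) y := by
  simp only [mulVec, dotProduct, transpose_apply, hM, Finset.sum_mul]
  exact Finset.sum_comm

theorem sum_comp_of_card_fiber [Fintype k] {γ : ℕ}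
    (hg : ∀ j, (Finset.univ.filter fun y => g y = j).card = γ) (f : k → ℝ) :
    ∑ y, f (g y) = γ * ∑ j, f j := by
  rw [← Finset.sum_fiberwise Finset.univ g, Finset.mul_sum]
  refine Finset.sum_congr rfl fun j _ => ?_
  rw [Finset.sum_congr rfl fun y hy => by rw [(Finset.mem_filter.mp hy).2], Finset.sum_const, hg,
    nsmul_eq_mul]

/-- Merging columns in groups of size `γ` multiplies squared singular values by at most `γ`. -/
theorem dotProduct_fromBlocks_mulVec_self_le_of_merge [Fintype l] [Fintype k] {γ : ℕ}
    (hg : ∀ j, (Finset.univ.filter fun y => g y = j).card = γ)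
    (hM : ∀ x j, M x j = ∑ y with g y = j, A x y) {K : ℝ} {z : l ⊕ k → ℝ}
    (hA : (A *ᵥ (z ∘ Sum.inr ∘ g)) ⬝ᵥ (A *ᵥ (z ∘ Sum.inr ∘ g)) ≤
      K * ((z ∘ Sum.inr ∘ g) ⬝ᵥ (z ∘ Sum.inr ∘ g)))
    (hAt : (Aᵀ *ᵥ (z ∘ Sum.inl)) ⬝ᵥ (Aᵀ *ᵥ (z ∘ Sum.inl)) ≤
      K * ((z ∘ Sum.inl) ⬝ᵥ (z ∘ Sum.inl))) :
    (fromBlocks 0 M Mᵀ 0 *ᵥ z) ⬝ᵥ (fromBlocks 0 M Mᵀ 0 *ᵥ z) ≤ γ * K * (z ⬝ᵥ z) := by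
  have hz : z ⬝ᵥ z = (z ∘ Sum.inl) ⬝ᵥ (z ∘ Sum.inl) + (z ∘ Sum.inr) ⬝ᵥ (z ∘ Sum.inr) := by
    simp [dotProduct]
  have hcomp : (z ∘ Sum.inr ∘ g) ⬝ᵥ (z ∘ Sum.inr ∘ g) =
      γ * ((z ∘ Sum.inr) ⬝ᵥ (z ∘ Sum.inr)) :=
    sum_comp_of_card_fiber hg fun j => z (Sum.inr j) * z (Sum.inr j)
  have hMt : (Mᵀ *ᵥ (z ∘ Sum.inl)) ⬝ᵥ (Mᵀ *ᵥ (z ∘ Sum.inl)) ≤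
      γ * ((Aᵀ *ᵥ (z ∘ Sum.inl)) ⬝ᵥ (Aᵀ *ᵥ (z ∘ Sum.inl))) := by
    rw [dotProduct_self_eq_sum_sq, dotProduct_self_eq_sum_sq,
      ← Finset.sum_fiberwise Finset.univ g, Finset.mul_sum]
    refine Finset.sum_le_sum fun j _ => ?_
    rw [transpose_mulVec_apply_of_merge hM, ← hg j]
    exact sq_sum_le_card_mul_sum_sq
  rw [fromBlocks_mulVec, sumElim_dotProduct_sumElim, hz]
  simp only [zero_mulVec, zero_add, add_zero]
  rw [mulVec_of_merge hM, Function.comp_assoc]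
  rw [hcomp] at hA
  have := mul_le_mul_of_nonneg_left hAt (Nat.cast_nonneg (α := ℝ) γ)
  linarith

end Merge

end Matrix

/-- The blocks of `γ` consecutive elements of `Fin n₁` have `γ` elements each. -/
theorem Fin.card_filter_div_eq {n₁ n₂ γ : ℕ} (hγ : 0 < γ) (h : n₁ = γ * n₂) (j : Fin n₂) :
    (Finset.univ.filter fun y : Fin n₁ => (y : ℕ) / γ = (j : ℕ)).card = γ := by
  have hj : γ * j + γ ≤ n₁ := by
    rw [h, ← Nat.mul_succ]
    exact Nat.mul_le_mul_left _ j.2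
  have : (Finset.univ.filter fun y : Fin n₁ => (y : ℕ) / γ = (j : ℕ)) =
      Finset.univ.image fun i : Fin γ => (⟨γ * j + i, by omega⟩ : Fin n₁) := by
    ext y
    simp only [Finset.mem_filter, Finset.mem_univ, true_and, Finset.mem_image]
    constructor
    · intro hy
      refine ⟨⟨y % γ, Nat.mod_lt _ hγ⟩, Fin.ext ?_⟩
      simp only [← hy]
      exact Nat.div_add_mod _ _
    · rintro ⟨i, rfl⟩
      simp [Nat.mul_add_div hγ, Nat.div_eq_of_lt i.2]
  rw [this, Finset.card_image_of_injective, Finset.card_univ, Fintype.card_fin]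
  intro a b hab
  have := Fin.mk.inj hab
  exact Fin.ext (by omega)

open Matrix

/-- Let `n₁, d₁, γ` be positive integers with `γ ∣ n₁`; set `n₂ = n₁/γ`
and `d₂ = γ·d₁`. Let `A` be an `n₁×n₁` real matrix with nonnegative integer entries, all
of whose row and column sums equal `d₁` (the biadjacency matrix of a bipartite
`d₁`-regular multigraph `G`), and suppose every eigenvalue of the normalized adjacency
matrix `Q = (1/d₁)·[[0,A],[Aᵀ,0]]` of `G`, except the two largest in absolute value
(which have absolute value `1`), has absolute value at most `α`. Let `M` be obtained
from `A` by merging every `γ` consecutive columns and `P = [[0,M],[Mᵀ,0]]` the adjacency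
matrix of the resulting `(d₁,d₂)`-biregular bipartite multigraph. Then the two largest
(in absolute value) eigenvalues of `P` have absolute value `√(d₁·d₂)`, and every other
eigenvalue of `P` has absolute value at most `√(d₁·d₂)·α`. -/
theorem stmt4
    {n₁ n₂ d₁ d₂ γ : ℕ} (hn₁ : 0 < n₁) (hd₁ : 0 < d₁) (hγ : 0 < γ)
    (hdvd : γ ∣ n₁) (hn₂ : n₂ = n₁ / γ) (hd₂ : d₂ = γ * d₁)
    (A : Matrix (Fin n₁) (Fin n₁) ℝ)
    (hAint : ∀ i j, ∃ a : ℕ, A i j = a)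
    (hrow : ∀ i, ∑ j, A i j = d₁) (hcol : ∀ j, ∑ i, A i j = d₁)
    (α : ℝ) (hα : 0 ≤ α)
    (Q : Matrix (Fin n₁ ⊕ Fin n₁) (Fin n₁ ⊕ Fin n₁) ℝ)
    (hQ : Q = (d₁ : ℝ)⁻¹ • Matrix.fromBlocks 0 A A.transpose 0)
    (ν : Fin (n₁ + n₁) → ℝ)
    (hν : ∃ hsym : Q.IsHermitian, ∃ e : Fin (n₁ + n₁) ≃ (Fin n₁ ⊕ Fin n₁),
      (∀ i, ν i = hsym.eigenvalues (e i)) ∧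
      (∀ i j : Fin (n₁ + n₁), i ≤ j → |ν j| ≤ |ν i|) ∧
      |ν ⟨0, by omega⟩| = 1 ∧ |ν ⟨1, by omega⟩| = 1)
    (hνbound : ∀ i : Fin (n₁ + n₁), 2 ≤ (i : ℕ) → |ν i| ≤ α)
    (M : Matrix (Fin n₁) (Fin n₂) ℝ)
    (hMdef : ∀ x j, M x j =
      ∑ y ∈ Finset.univ.filter fun y : Fin n₁ => (y : ℕ) / γ = (j : ℕ), A x y)
    (P : Matrix (Fin n₁ ⊕ Fin n₂) (Fin n₁ ⊕ Fin n₂) ℝ)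
    (hP : P = Matrix.fromBlocks 0 M M.transpose 0)
    (lam : Fin (n₁ + n₂) → ℝ)
    (hlam : ∃ hsym : P.IsHermitian, ∃ e : Fin (n₁ + n₂) ≃ (Fin n₁ ⊕ Fin n₂),
      (∀ i, lam i = hsym.eigenvalues (e i)) ∧
      (∀ i j : Fin (n₁ + n₂), i ≤ j → |lam j| ≤ |lam i|)) :
    (|lam ⟨0, by omega⟩| = Real.sqrt (d₁ * d₂) ∧
      |lam ⟨1, by
        have hn₂pos : 0 < n₂ := by
          subst hn₂; exact Nat.div_pos (Nat.le_of_dvd hn₁ hdvd) hγ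
        omega⟩| = Real.sqrt (d₁ * d₂)) ∧
    ∀ i : Fin (n₁ + n₂), 2 ≤ (i : ℕ) → |lam i| ≤ Real.sqrt (d₁ * d₂) * α := by
  obtain ⟨hQsym, e, hνe, hνmono, hν0, hν1⟩ := hν
  obtain ⟨hPsym, e', hlame, hlammono⟩ := hlam
  have hn : n₁ = γ * n₂ := by rw [hn₂, Nat.mul_div_cancel' hdvd]
  have hn₂pos : 0 < n₂ := Nat.pos_of_ne_zero fun h => by simp [h] at hn; omega
  have hd : (0 : ℝ) < d₁ := by exact_mod_cast hd₁
  have hγ' : (0 : ℝ) < γ := by exact_mod_cast hγ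
  set s := Real.sqrt (d₁ * d₂) with hs
  have hs2 : s ^ 2 = γ * (d₁ : ℝ) ^ 2 := by
    rw [hs, Real.sq_sqrt (by positivity), hd₂]
    push_cast
    ring
  have hspos : 0 < s := Real.sqrt_pos.mpr (by rw [hd₂]; push_cast; positivity)
  let g : Fin n₁ → Fin n₂ := fun y => ⟨y / γ, Nat.div_lt_of_lt_mul (hn ▸ y.2)⟩
  have hg : ∀ j, (Finset.univ.filter fun y => g y = j).card = γ := fun j => by
    simpa only [g, Fin.ext_iff] using Fin.card_filter_div_eq hγ hn j
  have hM : ∀ x j, M x j = ∑ y with g y = j, A x y := fun x j => by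
    simpa only [g, Fin.ext_iff] using hMdef x j
  have hA1 : A *ᵥ (1 : Fin n₁ → ℝ) = fun _ => (d₁ : ℝ) := by
    ext x
    simp [mulVec, dotProduct, hrow]
  have hAt1 : Aᵀ *ᵥ (1 : Fin n₁ → ℝ) = fun _ => (d₁ : ℝ) := by
    ext x
    simp [mulVec, dotProduct, hcol]
  have hνle : ∀ i, |hQsym.eigenvalues i| ≤ 1 := fun i => by
    have := hνmono ⟨0, by omega⟩ (e.symm i) (Nat.zero_le _)
    rwa [hν0, hνe, e.apply_symm_apply] at this
  have hQall : ∀ z, (Q *ᵥ z) ⬝ᵥ (Q *ᵥ z) ≤ 1 ^ 2 * (z ⬝ᵥ z) := fun z => by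
    obtain ⟨U, -, hU, hUN⟩ := hQsym.exists_orthogonal_diagonalization
    exact dotProduct_mulVec_self_le hU hUN fun i => Or.inr (hνle i)
  have hQorth : ∀ x y : Fin n₁ → ℝ, ∑ i, x i = 0 → ∑ i, y i = 0 →
      (Q *ᵥ Sum.elim x y) ⬝ᵥ (Q *ᵥ Sum.elim x y) ≤ α ^ 2 * (Sum.elim x y ⬝ᵥ Sum.elim x y) := by
    intro x y hx hy
    rcases le_or_gt 1 α with hα1 | hα1
    · refine (hQall _).trans ?_
      have : 0 ≤ Sum.elim x y ⬝ᵥ Sum.elim x y := by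
        rw [dotProduct_self_eq_sum_sq]
        positivity
      gcongr
    · have hne : ∀ v : Fin n₁ → ℝ, (Sum.elim 1 v : Fin n₁ ⊕ Fin n₁ → ℝ) ≠ 0 :=
          fun v h => by
        simpa using congrFun h (Sum.inl ⟨0, hn₁⟩)
      refine hQsym.dotProduct_mulVec_self_le_of_orthogonal
        (i₀ := e ⟨0, by omega⟩) (i₁ := e ⟨1, by omega⟩) (w₁ := Sum.elim 1 1)
        (w₂ := Sum.elim 1 (-1)) (μ₁ := 1) (μ₂ := -1) ?_ (by simp) (hne _) (hne _) ?_ ?_ ?_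
        (by simpa) (by simpa) ?_ ?_
      · intro i hi0 hi1
        rw [← e.apply_symm_apply i, ← hνe]
        refine hνbound _ ?_
        have h0 : (e.symm i : ℕ) ≠ 0 := fun h => hi0 (by
          rw [← e.symm_apply_eq]; exact Fin.ext h)
        have h1 : (e.symm i : ℕ) ≠ 1 := fun h => hi1 (by
          rw [← e.symm_apply_eq]; exact Fin.ext h)
        omega
      · simp [dotProduct]
      · rw [hQ, smul_mulVec, fromBlocks_mulVec]
        ext (i | i) <;> simp [hA1, hAt1, hd.ne']
      · rw [hQ, smul_mulVec, fromBlocks_mulVec]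
        ext (i | i) <;> simp [hA1, hAt1, hd.ne', mulVec_neg]
      · simp [dotProduct, hx, hy]
      · simp [dotProduct, hx, hy]
  have hQA : ∀ {c : ℝ} {y : Fin n₁ → ℝ},
      (Q *ᵥ Sum.elim 0 y) ⬝ᵥ (Q *ᵥ Sum.elim 0 y) ≤
        c ^ 2 * ((Sum.elim 0 y : Fin n₁ ⊕ Fin n₁ → ℝ) ⬝ᵥ Sum.elim 0 y) →
      (A *ᵥ y) ⬝ᵥ (A *ᵥ y) ≤ (d₁ * c) ^ 2 * (y ⬝ᵥ y) := by
    intro c y h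
    rw [hQ, smul_mulVec, fromBlocks_mulVec] at h
    simp [sumElim_dotProduct_sumElim] at h
    rw [← mul_assoc, ← mul_inv, inv_mul_le_iff₀ (by positivity)] at h
    linarith
  have hQAt : ∀ {c : ℝ} {x : Fin n₁ → ℝ},
      (Q *ᵥ Sum.elim x 0) ⬝ᵥ (Q *ᵥ Sum.elim x 0) ≤
        c ^ 2 * ((Sum.elim x 0 : Fin n₁ ⊕ Fin n₁ → ℝ) ⬝ᵥ Sum.elim x 0) →
      (Aᵀ *ᵥ x) ⬝ᵥ (Aᵀ *ᵥ x) ≤ (d₁ * c) ^ 2 * (x ⬝ᵥ x) := by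
    intro c x h
    rw [hQ, smul_mulVec, fromBlocks_mulVec] at h
    simp [sumElim_dotProduct_sumElim] at h
    rw [← mul_assoc, ← mul_inv, inv_mul_le_iff₀ (by positivity)] at h
    linarith
  have hPall : ∀ z, (P *ᵥ z) ⬝ᵥ (P *ᵥ z) ≤ s ^ 2 * (z ⬝ᵥ z) := fun z => by
    have := dotProduct_fromBlocks_mulVec_self_le_of_merge hg hM (z := z)
      (hQA (hQall _)) (hQAt (hQall _))
    rwa [← hP, mul_one, ← hs2] at this
  have hPorth : ∀ z, Sum.elim 1 0 ⬝ᵥ z = 0 → Sum.elim 0 1 ⬝ᵥ z = 0 →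
      (P *ᵥ z) ⬝ᵥ (P *ᵥ z) ≤ (s * α) ^ 2 * (z ⬝ᵥ z) := by
    intro z hz1 hz2
    simp only [dotProduct, Fintype.sum_sum_type, Sum.elim_inl, Sum.elim_inr, Pi.one_apply,
      Pi.zero_apply, one_mul, zero_mul, Finset.sum_const_zero, add_zero, zero_add] at hz1 hz2
    have hz2' : ∑ y, (z ∘ Sum.inr ∘ g) y = 0 := by
      have := sum_comp_of_card_fiber hg fun j => z (Sum.inr j)
      rwa [hz2, mul_zero] at this
    have := dotProduct_fromBlocks_mulVec_self_le_of_merge hg hM (z := z)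
      (hQA (hQorth _ _ (by simp) hz2')) (hQAt (hQorth _ _ hz1 (by simp)))
    rwa [← hP, mul_pow, ← mul_assoc, ← hs2, ← mul_pow] at this
  have hle : ∀ i, |lam i| ≤ s := fun i => by
    rw [hlame]
    exact hPsym.abs_eigenvalues_le hspos.le hPall _
  have hM1 : M *ᵥ (1 : Fin n₂ → ℝ) = fun _ => (d₁ : ℝ) := by
    rw [mulVec_of_merge hM, ← hA1]
    rfl
  have hMt1 : Mᵀ *ᵥ (1 : Fin n₁ → ℝ) = fun _ => (γ * d₁ : ℝ) := by
    ext j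
    rw [transpose_mulVec_apply_of_merge hM, hAt1, Finset.sum_const, hg, nsmul_eq_mul]
  have hex : ∀ t : ℝ, t ^ 2 = γ * (d₁ : ℝ) ^ 2 → ∃ i, lam i = t := by
    intro t ht
    have hw : (Sum.elim ((d₁ : ℝ) • 1) (t • 1) : Fin n₁ ⊕ Fin n₂ → ℝ) ≠ 0 := fun h => by
      simpa [hd.ne'] using congrFun h (Sum.inl ⟨0, hn₁⟩)
    obtain ⟨i, hi⟩ := hPsym.exists_eigenvalues_eq (μ := t) hw (by
      rw [hP, fromBlocks_mulVec]
      ext (i | i)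
      · simp [mulVec_smul, hM1]
      · simp [mulVec_smul, hMt1]
        linear_combination -ht)
    exact ⟨e'.symm i, by rw [hlame, e'.apply_symm_apply, hi]⟩
  obtain ⟨i, hi⟩ := hex s hs2
  obtain ⟨j, hj⟩ := hex (-s) (by rw [neg_sq, hs2])
  have hij : i ≠ j := fun h => by
    rw [h, hj] at hi
    linarith
  have h1 : s ≤ |lam ⟨1, by omega⟩| := by
    rcases Nat.lt_or_gt_of_ne (Fin.val_ne_of_ne hij) with h | h
    · have := hlammono ⟨1, by omega⟩ j (Fin.mk_le_of_le_val (by omega))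
      rwa [hj, abs_neg, abs_of_pos hspos] at this
    · have := hlammono ⟨1, by omega⟩ i (Fin.mk_le_of_le_val (by omega))
      rwa [hi, abs_of_pos hspos] at this
  have h0 : s ≤ |lam ⟨0, by omega⟩| :=
    h1.trans (hlammono _ _ (Fin.mk_le_of_le_val (Nat.zero_le _)))
  refine ⟨⟨le_antisymm (hle _) h0, le_antisymm (hle _) h1⟩, fun i hi => ?_⟩
  rw [hlame]
  refine hPsym.abs_eigenvalues_le_of_two_lt_card (by positivity) hPorth _ ?_
  let f : Fin 3 → {j // |hPsym.eigenvalues (e' i)| ≤ |hPsym.eigenvalues j|} := fun k =>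
    ⟨e' ⟨k, by omega⟩, by
      rw [← hlame, ← hlame]
      exact hlammono _ _ (Fin.mk_le_of_le_val (by omega))⟩
  have hf : Function.Injective f := fun a b hab => by
    simpa [f, Fin.ext_iff] using hab
  simpa [Nat.lt_iff_add_one_le] using Fintype.card_le_of_injective f hf
end

section
/- Let k ≥ 2 and n = 2^k − 1. Fix an invertible matrix B ∈ GL_k(F₂) and nonzero vectors x, y ∈ F₂^k. If s is chosen uniformly at random from GL_k(F₂), then P(s·B·s·x = y) ≤ 2/n. -/
open scoped BigOperators

/-- A linear automorphism can carry any finite linearly independent family to any other one. -/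
theorem LinearIndependent.exists_linearEquiv_apply_eq {K V ι : Type*} [DivisionRing K]
    [AddCommGroup V] [Module K V] [FiniteDimensional K V] {v w : ι → V}
    (hv : LinearIndependent K v) (hw : LinearIndependent K w) :
    ∃ g : V ≃ₗ[K] V, ∀ i, g (v i) = w i := by
  obtain ⟨g, hg⟩ := Submodule.exists_linearEquiv_restrict_eq
    (hv.linearCombinationEquiv.symm ≪≫ₗ hw.linearCombinationEquiv)
  refine ⟨g, fun i ↦ ?_⟩
  have key : ∀ {u : ι → V} (hu : LinearIndependent K u),
      (hu.linearCombinationEquiv (Finsupp.single i 1) : V) = u i := fun hu ↦ by simp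
  rw [← key hv, ← hg, ← key hw]
  simp

theorem LinearIndependent.exists_GL_mulVec_eq {K ι m : Type*} [Field K] [Fintype m]
    [DecidableEq m] {v w : ι → m → K}
    (hv : LinearIndependent K v) (hw : LinearIndependent K w) :
    ∃ g : GL m K, ∀ i, (g : Matrix m m K).mulVec (v i) = w i := by
  obtain ⟨g, hg⟩ := hv.exists_linearEquiv_apply_eq hw
  refine ⟨Matrix.GeneralLinearGroup.toLin.symm
    (LinearMap.GeneralLinearGroup.ofLinearEquiv g), fun i ↦ ?_⟩
  rw [← Matrix.mulVecLin_apply, ← Matrix.GeneralLinearGroup.coe_toLin, MulEquiv.apply_symm_apply]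
  exact hg i

theorem linearIndependent_pair_zmod_two {V : Type*} [AddCommGroup V] [Module (ZMod 2) V]
    {u v : V} (hu : u ≠ 0) (hv : v ≠ 0) (huv : u ≠ v) :
    LinearIndependent (ZMod 2) ![u, v] := by
  rw [LinearIndependent.pair_iff' hu]
  intro a
  obtain rfl | rfl : a = 0 ∨ a = 1 := by revert a; decide
  · simpa using hv.symm
  · simpa using huv

/-- If every point of `S` can be reached from `b` by left translation, then the fibre of `f`
over `b` has at most the average size `|G| / |S|`. -/
theorem card_fiber_mul_card_le {G W : Type*} [Group G] [Fintype G] [DecidableEq W]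
    (f : G → W) (S : Finset W) (b : W)
    (h : ∀ c ∈ S, ∃ g : G, ∀ s, f s = b → f (g * s) = c) :
    (Finset.univ.filter fun s ↦ f s = b).card * S.card ≤ Fintype.card G := by
  classical
  calc (Finset.univ.filter fun s ↦ f s = b).card * S.card
      = ∑ _c ∈ S, (Finset.univ.filter fun s ↦ f s = b).card := by
        rw [Finset.sum_const, smul_eq_mul, mul_comm]
    _ ≤ ∑ c ∈ S, (Finset.univ.filter fun s ↦ f s = c).card := by
        refine Finset.sum_le_sum fun c hc ↦ ?_
        obtain ⟨g, hg⟩ := h c hc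
        refine Finset.card_le_card_of_injOn (g * ·) (fun s hs ↦ ?_)
          (mul_right_injective g).injOn
        simpa using hg s (by simpa using hs)
    _ = (S.biUnion fun c ↦ Finset.univ.filter fun s ↦ f s = c).card := by
        refine (Finset.card_biUnion fun c _ d _ hcd ↦ ?_).symm
        exact Finset.disjoint_filter.2 fun s _ hc hd ↦ hcd (hc.symm.trans hd)
    _ ≤ Fintype.card G := Finset.card_le_univ _

theorem card_GL_mulVec_eq_mul_le {k : ℕ} (x : Fin k → ZMod 2) {y : Fin k → ZMod 2}
    (hy : y ≠ 0) :
    (Finset.univ.filter fun s : GL (Fin k) (ZMod 2) ↦ s.1.mulVec x = y).card * (2 ^ k - 1) ≤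
      Fintype.card (GL (Fin k) (ZMod 2)) := by
  have hcard : ({0}ᶜ : Finset (Fin k → ZMod 2)).card = 2 ^ k - 1 := by
    simp [Finset.card_compl, ZMod.card]
  rw [← hcard]
  refine card_fiber_mul_card_le _ _ _ fun c hc ↦ ?_
  obtain ⟨g, hg⟩ := LinearIndependent.exists_GL_mulVec_eq
    (LinearIndependent.of_subsingleton (R := ZMod 2) (v := fun _ : Unit ↦ y) () hy)
    (LinearIndependent.of_subsingleton (R := ZMod 2) (v := fun _ : Unit ↦ c) () (by simpa using hc))
  refine ⟨g, fun s hs ↦ ?_⟩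
  rw [Matrix.GeneralLinearGroup.coe_mul, ← Matrix.mulVec_mulVec, hs, hg ()]

theorem card_GL_mulVec_pair_eq_mul_le {k : ℕ} (x z : Fin k → ZMod 2) {u y : Fin k → ZMod 2}
    (hu : u ≠ 0) (hy : y ≠ 0) (huy : u ≠ y) :
    (Finset.univ.filter fun s : GL (Fin k) (ZMod 2) ↦
        s.1.mulVec x = u ∧ s.1.mulVec z = y).card * ((2 ^ k - 1) * (2 ^ k - 2)) ≤
      Fintype.card (GL (Fin k) (ZMod 2)) := by
  have hcard : ({0}ᶜ : Finset (Fin k → ZMod 2)).offDiag.card = (2 ^ k - 1) * (2 ^ k - 2) := by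
    rw [Finset.offDiag_card, ← Nat.mul_sub_one]
    simp [Finset.card_compl, ZMod.card, Nat.sub_sub]
  rw [← hcard]
  simp_rw [← Prod.mk_inj]
  refine card_fiber_mul_card_le _ _ _ fun c hc ↦ ?_
  simp only [Finset.mem_offDiag, Finset.mem_compl, Finset.mem_singleton] at hc
  obtain ⟨g, hg⟩ := LinearIndependent.exists_GL_mulVec_eq
    (linearIndependent_pair_zmod_two hu hy huy)
    (linearIndependent_pair_zmod_two hc.1 hc.2.1 hc.2.2)
  refine ⟨g, fun s hs ↦ ?_⟩
  obtain ⟨hsx, hsz⟩ := Prod.mk_inj.1 hs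
  simp only [Matrix.GeneralLinearGroup.coe_mul, ← Matrix.mulVec_mulVec, hsx, hsz]
  exact Prod.ext (hg 0) (hg 1)

/-- Let `k ≥ 2`, `n = 2^k − 1`. Fix `B ∈ GL_k(F₂)` and nonzero
`x, y ∈ F₂^k`. If `s` is uniform on `GL_k(F₂)`, then `P(s·B·s·x = y) ≤ 2/n`. -/
theorem stmt9
    {k n : ℕ} (hk : 2 ≤ k) (hn : n = 2 ^ k - 1)
    (B : GL (Fin k) (ZMod 2))
    (x y : Fin k → ZMod 2) (hx : x ≠ 0) (hy : y ≠ 0) :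
    (Nat.card {s : GL (Fin k) (ZMod 2) //
        ((s * B * s : GL (Fin k) (ZMod 2)) : Matrix (Fin k) (Fin k) (ZMod 2)).mulVec x
          = y} : ℝ)
      / (Nat.card (GL (Fin k) (ZMod 2)) : ℝ) ≤ 2 / n := by
  set a := (Finset.univ.filter fun s : GL (Fin k) (ZMod 2) ↦ s.1.mulVec x = y).card
  set c : (Fin k → ZMod 2) → ℕ := fun u ↦ (Finset.univ.filter fun s : GL (Fin k) (ZMod 2) ↦
    s.1.mulVec x = u ∧ s.1.mulVec (B.1.mulVec u) = y).card
  have hpow : 4 ≤ 2 ^ k := by simpa using Nat.pow_le_pow_right (n := 2) (by norm_num) hk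
  have hcover : Nat.card {s : GL (Fin k) (ZMod 2) //
      ((s * B * s : GL (Fin k) (ZMod 2)) : Matrix (Fin k) (Fin k) (ZMod 2)).mulVec x = y} ≤
      a + ∑ u ∈ ({0, y}ᶜ : Finset (Fin k → ZMod 2)), c u := by
    rw [Nat.card_eq_fintype_card, Fintype.card_subtype]
    refine le_trans (Finset.card_le_card fun s hs ↦ ?_) ((Finset.card_union_le _ _).trans
      (Nat.add_le_add_left Finset.card_biUnion_le _))
    simp only [Finset.mem_filter, Finset.mem_univ, true_and, Matrix.GeneralLinearGroup.coe_mul,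
      ← Matrix.mulVec_mulVec] at hs
    simp only [Finset.mem_union, Finset.mem_biUnion, Finset.mem_filter, Finset.mem_univ,
      true_and, Finset.mem_compl, Finset.mem_insert, Finset.mem_singleton]
    by_cases hsx : s.1.mulVec x = y
    · exact Or.inl hsx
    · refine Or.inr ⟨_, not_or.2 ⟨fun h0 ↦ hy ?_, hsx⟩, rfl, hs⟩
      rw [← hs, h0, Matrix.mulVec_zero, Matrix.mulVec_zero]
  have hfirst : a * (2 ^ k - 1) ≤ Fintype.card (GL (Fin k) (ZMod 2)) :=
    card_GL_mulVec_eq_mul_le x hy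
  have hsum : (∑ u ∈ ({0, y}ᶜ : Finset (Fin k → ZMod 2)), c u) * (2 ^ k - 1) ≤
      Fintype.card (GL (Fin k) (ZMod 2)) := by
    refine Nat.le_of_mul_le_mul_right (c := 2 ^ k - 2) ?_ (by omega)
    rw [mul_assoc, Finset.sum_mul]
    refine (Finset.sum_le_card_nsmul _ _ (Fintype.card (GL (Fin k) (ZMod 2)))
      fun u hu ↦ ?_).trans_eq ?_
    · simp only [Finset.mem_compl, Finset.mem_insert, Finset.mem_singleton, not_or] at hu
      exact card_GL_mulVec_pair_eq_mul_le _ _ hu.1 hy hu.2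
    · rw [Finset.card_compl, Finset.card_pair hy.symm, smul_eq_mul, mul_comm]
      simp [ZMod.card]
  have hn0 : (0 : ℝ) < n := by
    rw [hn]; exact_mod_cast (show 0 < 2 ^ k - 1 by omega)
  rw [Nat.card_eq_fintype_card (α := GL (Fin k) (ZMod 2)),
    div_le_div_iff₀ (by exact_mod_cast Fintype.card_pos) hn0]
  subst hn
  have := Nat.mul_le_mul_right (2 ^ k - 1) hcover
  rw [add_mul] at this
  exact_mod_cast this.trans (by omega)
end

section
/- Let k ≥ 2 and n = 2^k − 1. Fix invertible matrices B₁, B₂ ∈ GL_k(F₂) and nonzero vectors x, y ∈ F₂^k. If s and t are chosen independently and uniformly at random from GL_k(F₂), then P( s·B₁·t·B₂·s⁻¹·x = y ) = 1/n, and the same equality holds with t replaced by t⁻¹ and/or with the signs of the two occurrences of s swapped (i.e., for s⁻¹·B₁·t^{±1}·B₂·s·x = y). -/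
open scoped BigOperators

open Matrix

/-- The general linear group acts transitively on the nonzero vectors. -/
theorem Matrix.GeneralLinearGroup.exists_mulVec_eq {ι K : Type*} [Fintype ι] [DecidableEq ι]
    [Field K] {x y : ι → K} (hx : x ≠ 0) (hy : y ≠ 0) :
    ∃ g : GL ι K, (g : Matrix ι ι K) *ᵥ x = y := by
  obtain ⟨f, hf⟩ := Submodule.exists_linearEquiv_restrict_eq
    ((LinearEquiv.toSpanNonzeroSingleton K _ x hx).symm ≪≫ₗ
      LinearEquiv.toSpanNonzeroSingleton K _ y hy)
  refine ⟨GeneralLinearGroup.toLin.symm (LinearMap.GeneralLinearGroup.ofLinearEquiv f), ?_⟩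
  have hfx : f x = y := by
    have h := hf (LinearEquiv.toSpanNonzeroSingleton K _ x hx 1)
    rw [LinearEquiv.trans_apply, LinearEquiv.symm_apply_apply] at h
    simpa using h.symm
  rw [← Matrix.mulVecLin_apply, ← GeneralLinearGroup.coe_toLin, MulEquiv.apply_symm_apply]
  exact hfx

/-- The matrices sending a fixed nonzero vector `x` to a fixed nonzero vector `y` form a
proportion `1 / (|K| ^ |ι| - 1)` of the general linear group. -/
theorem Matrix.GeneralLinearGroup.card_mulVec_eq {ι K : Type*} [Fintype ι] [DecidableEq ι]
    [Field K] [Finite K] {x y : ι → K} (hx : x ≠ 0) (hy : y ≠ 0) :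
    Nat.card {v : ι → K // v ≠ 0} * Nat.card {g : GL ι K // (g : Matrix ι ι K) *ᵥ x = y} =
      Nat.card (GL ι K) := by
  choose h hh using fun v : {v : ι → K // v ≠ 0} ↦ exists_mulVec_eq hy v.2
  have hinv (g : GL ι K) (u v : ι → K) (hg : (g : Matrix ι ι K) *ᵥ u = v) :
      ((g⁻¹ : GL ι K) : Matrix ι ι K) *ᵥ v = u := by
    rw [← hg, mulVec_mulVec, ← Units.val_mul, inv_mul_cancel, Units.val_one, one_mulVec]
  have hne (g : GL ι K) : (g : Matrix ι ι K) *ᵥ x ≠ 0 := fun h0 ↦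
    hx (by simpa using (hinv g x 0 h0).symm)
  rw [← Nat.card_prod]
  refine Nat.card_congr
    { toFun := fun p ↦ h p.1 * p.2
      invFun := fun g ↦ (⟨(g : Matrix ι ι K) *ᵥ x, hne g⟩,
        ⟨(h ⟨(g : Matrix ι ι K) *ᵥ x, hne g⟩)⁻¹ * g, ?_⟩)
      left_inv := ?_
      right_inv := fun g ↦ mul_inv_cancel_left _ _ }
  · rw [Units.val_mul, ← mulVec_mulVec]
    exact hinv _ _ _ (hh _)
  · rintro ⟨v, g, hg⟩
    have hv : ((h v : Matrix ι ι K) * (g : Matrix ι ι K)) *ᵥ x = v := by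
      rw [← mulVec_mulVec, hg, hh]
    simp [hv]

theorem card_pi_zmod_two_ne_zero (k : ℕ) :
    Nat.card {v : Fin k → ZMod 2 // v ≠ 0} = 2 ^ k - 1 := by
  rw [Nat.card_eq_fintype_card, Fintype.card_subtype_compl]
  simp

/-- If `w s` is a bijection of the group for every `s`, then for uniform independent `s, t` the
matrix `w s t` maps `x` to `y` with probability `1 / (2 ^ k - 1)`. -/
theorem card_pairs_mulVec_eq_div {k n : ℕ} (hn : n = 2 ^ k - 1)
    {x y : Fin k → ZMod 2} (hx : x ≠ 0) (hy : y ≠ 0)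
    (w : GL (Fin k) (ZMod 2) → Equiv.Perm (GL (Fin k) (ZMod 2))) :
    (Nat.card {p : GL (Fin k) (ZMod 2) × GL (Fin k) (ZMod 2) //
        (w p.1 p.2 : Matrix (Fin k) (Fin k) (ZMod 2)) *ᵥ x = y} : ℝ)
      / ((Nat.card (GL (Fin k) (ZMod 2)) : ℝ) ^ 2) = 1 / n := by
  have hcard : Nat.card {p : GL (Fin k) (ZMod 2) × GL (Fin k) (ZMod 2) //
        (w p.1 p.2 : Matrix (Fin k) (Fin k) (ZMod 2)) *ᵥ x = y} =
      Nat.card (GL (Fin k) (ZMod 2)) *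
        Nat.card {g : GL (Fin k) (ZMod 2) //
          (g : Matrix (Fin k) (Fin k) (ZMod 2)) *ᵥ x = y} := by
    rw [← Nat.card_prod]
    exact Nat.card_congr
      { toFun := fun p ↦ (p.1.1, ⟨w p.1.1 p.1.2, p.2⟩)
        invFun := fun q ↦ ⟨(q.1, (w q.1).symm q.2.1), by simpa using q.2.2⟩
        left_inv := fun p ↦ by simp
        right_inv := fun q ↦ by simp }
  have hfib := Matrix.GeneralLinearGroup.card_mulVec_eq hx hy
  rw [card_pi_zmod_two_ne_zero, ← hn] at hfib
  have hpos : (Nat.card (GL (Fin k) (ZMod 2)) : ℝ) ≠ 0 := by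
    exact_mod_cast Nat.card_pos.ne'
  rw [hcard]
  rw [← hfib] at hpos ⊢
  push_cast at hpos ⊢
  have h₁ := left_ne_zero_of_mul hpos
  have h₂ := right_ne_zero_of_mul hpos
  field_simp

/-- Let `k ≥ 2`, `n = 2^k − 1`. Fix `B₁, B₂ ∈ GL_k(F₂)` and nonzero
`x, y ∈ F₂^k`. If `s, t` are independent uniform on `GL_k(F₂)`, then
`P(s·B₁·t·B₂·s⁻¹·x = y) = 1/n`, and the same holds with `t` replaced by `t⁻¹` and/or
with the signs of the two occurrences of `s` swapped. -/
theorem stmt12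
    {k n : ℕ} (hk : 2 ≤ k) (hn : n = 2 ^ k - 1)
    (B₁ B₂ : GL (Fin k) (ZMod 2))
    (x y : Fin k → ZMod 2) (hx : x ≠ 0) (hy : y ≠ 0) :
    ((Nat.card {p : GL (Fin k) (ZMod 2) × GL (Fin k) (ZMod 2) //
        ((p.1 * B₁ * p.2 * B₂ * p.1⁻¹ : GL (Fin k) (ZMod 2)) :
          Matrix (Fin k) (Fin k) (ZMod 2)).mulVec x = y} : ℝ)
      / ((Nat.card (GL (Fin k) (ZMod 2)) : ℝ) ^ 2) = 1 / n) ∧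
    ((Nat.card {p : GL (Fin k) (ZMod 2) × GL (Fin k) (ZMod 2) //
        ((p.1 * B₁ * p.2⁻¹ * B₂ * p.1⁻¹ : GL (Fin k) (ZMod 2)) :
          Matrix (Fin k) (Fin k) (ZMod 2)).mulVec x = y} : ℝ)
      / ((Nat.card (GL (Fin k) (ZMod 2)) : ℝ) ^ 2) = 1 / n) ∧
    ((Nat.card {p : GL (Fin k) (ZMod 2) × GL (Fin k) (ZMod 2) //
        ((p.1⁻¹ * B₁ * p.2 * B₂ * p.1 : GL (Fin k) (ZMod 2)) :
          Matrix (Fin k) (Fin k) (ZMod 2)).mulVec x = y} : ℝ)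
      / ((Nat.card (GL (Fin k) (ZMod 2)) : ℝ) ^ 2) = 1 / n) ∧
    ((Nat.card {p : GL (Fin k) (ZMod 2) × GL (Fin k) (ZMod 2) //
        ((p.1⁻¹ * B₁ * p.2⁻¹ * B₂ * p.1 : GL (Fin k) (ZMod 2)) :
          Matrix (Fin k) (Fin k) (ZMod 2)).mulVec x = y} : ℝ)
      / ((Nat.card (GL (Fin k) (ZMod 2)) : ℝ) ^ 2) = 1 / n) := by
  have key := card_pairs_mulVec_eq_div hn hx hy
  refine ⟨?_, ?_, ?_, ?_⟩
  · simpa [mul_assoc] using key fun s ↦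
      (Equiv.mulLeft (s * B₁)).trans (Equiv.mulRight (B₂ * s⁻¹))
  · simpa [mul_assoc] using key fun s ↦ (Equiv.inv _).trans
      ((Equiv.mulLeft (s * B₁)).trans (Equiv.mulRight (B₂ * s⁻¹)))
  · simpa [mul_assoc] using key fun s ↦
      (Equiv.mulLeft (s⁻¹ * B₁)).trans (Equiv.mulRight (B₂ * s))
  · simpa [mul_assoc] using key fun s ↦ (Equiv.inv _).trans
      ((Equiv.mulLeft (s⁻¹ * B₁)).trans (Equiv.mulRight (B₂ * s)))
end

section
/- For integers p ≥ 1, c ≥ 0, ℓ ≥ 0, d ≥ 0, let N_p(c,ℓ,d) be the number of words of length ℓ over the alphabet {1,…,d}×{±1} (d letters, each usable with sign +1 or −1) such that every letter that occurs in the word occurs at least p times, and at least c letters occur exactly p times (occurrences counted regardless of sign). Then N_p satisfies: N_p(0,0,d) = 1; N_p(c,ℓ,d) = 0 if p > ℓ and (c,ℓ) ≠ (0,0); and otherwise N_p(c,ℓ,d) = Σ_{i=c}^{⌊ℓ/p⌋} C(d,i)·(2^p/p!)^i·(ℓ!/(ℓ−pi)!)·N_{p+1}(0, ℓ−pi, d−i).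 -/
open scoped BigOperators

/-- `wordCount p c ℓ d` is the number of words of length `ℓ` over the alphabet
`{1,…,d}×{±1}` such that every letter that occurs in the word occurs at least `p` times
and at least `c` letters occur exactly `p` times (occurrences counted regardless of
sign). -/
noncomputable def wordCount (p c ℓ d : ℕ) : ℕ :=
  Nat.card {w : Fin ℓ → Fin d × Bool //
    (∀ j : Fin d,
        0 < (Finset.univ.filter fun i : Fin ℓ => (w i).1 = j).card →
        p ≤ (Finset.univ.filter fun i : Fin ℓ => (w i).1 = j).card) ∧
    c ≤ (Finset.univ.filter fun j : Fin d =>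
          (Finset.univ.filter fun i : Fin ℓ => (w i).1 = j).card = p).card}

open Finset

/-- The number of positions of `w` carrying the letter `j`, regardless of sign. -/
abbrev letterCount {ℓ d : ℕ} (w : Fin ℓ → Fin d × Bool) (j : Fin d) : ℕ :=
  #{i : Fin ℓ | (w i).1 = j}

theorem prod_X_letter_eq_monomial {ℓ d : ℕ} (w : Fin ℓ → Fin d × Bool) :
    ∏ i, (MvPolynomial.X (w i).1 : MvPolynomial (Fin d) ℝ) =
      MvPolynomial.monomial (Finsupp.equivFunOnFinite.symm (letterCount w)) 1 := by
  rw [← prod_fiberwise_of_maps_to (t := univ) (g := fun i => (w i).1) (by simp)]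
  rw [MvPolynomial.monomial_eq, Finsupp.prod_fintype _ _ (by simp)]
  simp only [map_one, one_mul]
  refine prod_congr rfl fun j _ => ?_
  rw [prod_congr rfl (g := fun _ => MvPolynomial.X j) (by simp +contextual)]
  simp [letterCount]

/-- The number of words with prescribed letter counts `n`. -/
theorem card_letterCount_eq {ℓ d : ℕ} (n : Fin d →₀ ℕ) (hn : ∑ j, n j = ℓ) :
    (#{w : Fin ℓ → Fin d × Bool | letterCount w = n} : ℝ) =
      ℓ.factorial * ∏ j, (2 : ℝ) ^ n j / (n j).factorial := by
  have key : ∑ w : Fin ℓ → Fin d × Bool,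
      ∏ i, (MvPolynomial.X (w i).1 : MvPolynomial (Fin d) ℝ) =
        (2 : ℝ) ^ ℓ • (∑ j, MvPolynomial.X j) ^ ℓ := by
    have h := sum_pow' (univ : Finset (Fin d × Bool))
      (fun a => (MvPolynomial.X a.1 : MvPolynomial (Fin d) ℝ)) ℓ
    rw [Fintype.piFinset_univ] at h
    rw [← h, ← smul_pow]
    simp [Fintype.sum_prod_type, two_smul, sum_add_distrib]
  have hc := congrArg (MvPolynomial.coeff n) key
  simp only [prod_X_letter_eq_monomial, MvPolynomial.coeff_sum, MvPolynomial.coeff_monomial,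
    MvPolynomial.coeff_smul, MvPolynomial.coeff_sum_X_pow_of_fintype, sum_boole] at hc
  have hs : (n.sum fun _ m => m) = ℓ := by rw [Finsupp.sum_fintype _ _ (by simp), hn]
  rw [if_pos hs, smul_eq_mul,
    Finsupp.multinomial_eq_of_support_subset (subset_univ _)] at hc
  have hspec := Nat.multinomial_spec univ (n : Fin d → ℕ)
  rw [hn] at hspec
  have hfilter : #{w : Fin ℓ → Fin d × Bool | letterCount w = n} =
      #{w : Fin ℓ → Fin d × Bool | Finsupp.equivFunOnFinite.symm (letterCount w) = n} := by
    congr 1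
    ext w
    simp only [mem_filter, mem_univ, true_and, Equiv.symm_apply_eq]
    exact Iff.rfl
  rw [hfilter, hc, ← hspec, prod_div_distrib, prod_pow_eq_pow_sum, hn]
  have : (∏ j, ((n j).factorial : ℝ)) ≠ 0 := prod_ne_zero_iff.2 fun j _ => by positivity
  push_cast
  field_simp

open Classical in
/-- Exponential generating function of words in one signed letter whose length satisfies `a`. -/
noncomputable def letterSeries (a : ℕ → Prop) : PowerSeries ℝ :=
  PowerSeries.mk fun n => if a n then (2 : ℝ) ^ n / n.factorial else 0

open Classical in
theorem card_forall_letterCount {d : ℕ} (a : Fin d → ℕ → Prop) (ℓ : ℕ) :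
    (#{w : Fin ℓ → Fin d × Bool | ∀ j, a j (letterCount w j)} : ℝ) =
      ℓ.factorial * PowerSeries.coeff ℓ (∏ j, letterSeries (a j)) := by
  have hmaps : ∀ w ∈ ({w : Fin ℓ → Fin d × Bool | ∀ j, a j (letterCount w j)} : Finset _),
      Finsupp.equivFunOnFinite.symm (letterCount w) ∈ finsuppAntidiag univ ℓ := by
    intro w _
    have := card_eq_sum_card_fiberwise (f := fun i => (w i).1) (s := univ) (t := univ)
      (by simp)
    simpa [letterCount] using this.symm
  rw [card_eq_sum_card_fiberwise hmaps, PowerSeries.coeff_prod, mul_sum]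
  push_cast
  refine sum_congr rfl fun n hn => ?_
  have hsum : ∑ j, n j = ℓ := (mem_finsuppAntidiag.1 hn).1
  simp only [letterSeries, PowerSeries.coeff_mk]
  by_cases h : ∀ j, a j (n j)
  · simp only [h, if_true]
    rw [← card_letterCount_eq n hsum]
    congr 2
    ext w
    simp only [mem_filter, mem_univ, true_and, Equiv.symm_apply_eq]
    exact ⟨fun hw => hw.2, fun hw => ⟨fun j => hw ▸ h j, hw⟩⟩
  · obtain ⟨j, hj⟩ := not_forall.1 h
    rw [prod_eq_zero (mem_univ j) (by simp [hj]), mul_zero, Nat.cast_eq_zero, card_eq_zero,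
      filter_eq_empty_iff]
    intro w hw hwn
    rw [Equiv.symm_apply_eq] at hwn
    have hwj : letterCount w j = n j := congrFun hwn j
    exact hj (hwj ▸ (mem_filter.1 hw).2 j)

open Classical in
theorem wordCount_zero_eq_coeff (p ℓ d : ℕ) :
    (wordCount p 0 ℓ d : ℝ) =
      ℓ.factorial * PowerSeries.coeff ℓ (letterSeries (fun n => 0 < n → p ≤ n) ^ d) := by
  have h := card_forall_letterCount (fun (_ : Fin d) n => 0 < n → p ≤ n) ℓ
  rw [prod_const, card_univ, Fintype.card_fin] at h
  rw [← h, wordCount, Nat.card_eq_fintype_card, Fintype.card_subtype]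
  congr 2
  ext w
  simp [letterCount]

theorem letterSeries_eq_C_mul_X_pow (p : ℕ) :
    letterSeries (fun n => n = p) =
      PowerSeries.C ((2 : ℝ) ^ p / p.factorial) * PowerSeries.X ^ p := by
  ext n
  rw [letterSeries, PowerSeries.coeff_mk, PowerSeries.coeff_C_mul, PowerSeries.coeff_X_pow]
  split_ifs with h <;> simp [h]

open Classical in
/-- The number of words in which exactly the letters of `S` occur `p` times and every other
letter occurs more than `p` times or not at all. -/
theorem card_letterCount_eq_iff_mem (p ℓ d : ℕ) (S : Finset (Fin d)) :
    (#{w : Fin ℓ → Fin d × Bool | ∀ j, if j ∈ S then letterCount w j = p else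
      0 < letterCount w j → p + 1 ≤ letterCount w j} : ℝ) =
      if p * #S ≤ ℓ then ((2 : ℝ) ^ p / p.factorial) ^ #S *
        ((ℓ.factorial : ℝ) / (ℓ - p * #S).factorial) *
          wordCount (p + 1) 0 (ℓ - p * #S) (d - #S) else 0 := by
  have h := card_forall_letterCount
    (fun (j : Fin d) n => if j ∈ S then n = p else 0 < n → p + 1 ≤ n) ℓ
  have hprod : ∏ j : Fin d, letterSeries
      (fun n => if j ∈ S then n = p else 0 < n → p + 1 ≤ n) =
      PowerSeries.C (((2 : ℝ) ^ p / p.factorial) ^ #S) * (PowerSeries.X ^ (p * #S) *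
        letterSeries (fun n => 0 < n → p + 1 ≤ n) ^ (d - #S)) := by
    rw [← prod_mul_prod_compl S,
      prod_congr rfl (g := fun _ => letterSeries fun n => n = p)
        fun j hj => by simp only [hj, if_true],
      prod_congr (s₁ := Sᶜ) rfl (g := fun _ => letterSeries fun n => 0 < n → p + 1 ≤ n)
        fun j hj => by simp only [mem_compl.1 hj, if_false],
      prod_const, prod_const, card_compl, Fintype.card_fin, letterSeries_eq_C_mul_X_pow, mul_pow, ← pow_mul,
      map_pow, mul_assoc]
  rw [hprod, PowerSeries.coeff_C_mul, PowerSeries.coeff_X_pow_mul'] at h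
  refine (congrArg Nat.cast (by congr!)).trans (h.trans ?_)
  split_ifs with hle
  · rw [wordCount_zero_eq_coeff]
    field_simp
  · simp

open Classical in
theorem wordCount_eq_sum (p c ℓ d : ℕ) (hp : 1 ≤ p) :
    wordCount p c ℓ d = ∑ S : Finset (Fin d), if c ≤ #S then
      #{w : Fin ℓ → Fin d × Bool | ∀ j, if j ∈ S then letterCount w j = p else
        0 < letterCount w j → p + 1 ≤ letterCount w j} else 0 := by
  rw [wordCount, Nat.card_eq_fintype_card, Fintype.card_subtype,
    card_eq_sum_card_fiberwise (t := univ)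
      (f := fun w : Fin ℓ → Fin d × Bool => ({j | letterCount w j = p} : Finset (Fin d)))
      (by simp)]
  refine sum_congr rfl fun S _ => ?_
  split_ifs with hc
  · congr 1
    ext w
    simp only [mem_filter, mem_univ, true_and, Finset.ext_iff]
    constructor
    · rintro ⟨⟨h, -⟩, hS⟩ j
      have hj := h j
      have hSj := hS j
      split_ifs <;> grind
    · intro h
      have hS : ∀ j, letterCount w j = p ↔ j ∈ S := by
        intro j
        have := h j
        split_ifs at this <;> grind
      refine ⟨⟨fun j hj => ?_, ?_⟩, hS⟩
      · have := h j
        split_ifs at this <;> grind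
      · rwa [filter_congr fun j _ => hS j, filter_univ_mem]
  · rw [card_eq_zero, filter_eq_empty_iff]
    intro w hw hS
    subst hS
    exact hc (mem_filter.1 hw).2.2

theorem wordCount_eq_zero {p c ℓ d : ℕ} (hp : 1 ≤ p) (hlt : ℓ < p) (h0 : ¬(c = 0 ∧ ℓ = 0)) :
    wordCount p c ℓ d = 0 := by
  rw [wordCount, Nat.card_eq_zero]
  refine Or.inl ⟨fun ⟨w, hw, hc⟩ => ?_⟩
  have hle : ∀ j, letterCount w j ≤ ℓ := fun j => (card_le_univ _).trans (by simp)
  rcases Nat.eq_zero_or_pos ℓ with hℓ | hℓ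
  · rw [filter_false_of_mem fun j _ hj => by have := hle j; grind, card_empty] at hc
    omega
  · have hpos : 0 < letterCount w (w ⟨0, hℓ⟩).1 := card_pos.2 ⟨⟨0, hℓ⟩, by simp⟩
    exact absurd ((hw _ hpos).trans (hle _)) (by omega)

/-- For integers `p ≥ 1`, `c, ℓ, d ≥ 0`, the count `N_p(c,ℓ,d)` of
words of length `ℓ` over `{1,…,d}×{±1}` in which every occurring letter occurs at least
`p` times and at least `c` letters occur exactly `p` times satisfies: `N_p(0,0,d) = 1`;
`N_p(c,ℓ,d) = 0` if `p > ℓ` and `(c,ℓ) ≠ (0,0)`; and otherwise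
`N_p(c,ℓ,d) = Σ_{i=c}^{⌊ℓ/p⌋} C(d,i)·(2^p/p!)^i·(ℓ!/(ℓ−p·i)!)·N_{p+1}(0, ℓ−p·i, d−i)`. -/
theorem stmt14 (p c ℓ d : ℕ) (hp : 1 ≤ p) :
    (wordCount p 0 0 d = 1) ∧
    (p > ℓ → ¬(c = 0 ∧ ℓ = 0) → wordCount p c ℓ d = 0) ∧
    (¬(c = 0 ∧ ℓ = 0) → p ≤ ℓ →
      (wordCount p c ℓ d : ℝ) = ∑ i ∈ Finset.Icc c (ℓ / p),
        (d.choose i : ℝ) * ((2 : ℝ) ^ p / (Nat.factorial p : ℝ)) ^ i *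
          ((Nat.factorial ℓ : ℝ) / (Nat.factorial (ℓ - p * i) : ℝ)) *
          (wordCount (p + 1) 0 (ℓ - p * i) (d - i) : ℝ)) := by
  classical
  refine ⟨?_, fun hlt h0 => wordCount_eq_zero hp hlt h0, fun _ _ => ?_⟩
  · have : (wordCount p 0 0 d : ℝ) = 1 := by
      rw [wordCount_zero_eq_coeff]
      rw [PowerSeries.coeff_zero_eq_constantCoeff_apply, map_pow,
        ← PowerSeries.coeff_zero_eq_constantCoeff_apply, letterSeries, PowerSeries.coeff_mk]
      simp
    exact_mod_cast this
  · set F : ℕ → ℝ := fun i => ((2 : ℝ) ^ p / p.factorial) ^ i *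
      ((ℓ.factorial : ℝ) / (ℓ - p * i).factorial) *
        wordCount (p + 1) 0 (ℓ - p * i) (d - i) with hF
    have hsum : (wordCount p c ℓ d : ℝ) = ∑ S ∈ (univ : Finset (Fin d)).powerset,
        (fun i => if c ≤ i ∧ p * i ≤ ℓ then F i else 0) #S := by
      rw [wordCount_eq_sum p c ℓ d hp, powerset_univ]
      push_cast
      refine sum_congr rfl fun S _ => ?_
      rw [card_letterCount_eq_iff_mem, ite_and]
    rw [hsum, sum_powerset_apply_card (fun i => if c ≤ i ∧ p * i ≤ ℓ then F i else 0),
      card_univ, Fintype.card_fin]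
    simp only [nsmul_eq_mul, mul_ite, mul_zero]
    rw [← sum_filter]
    refine (sum_subset (fun i hi => ?_) fun i hi hni => ?_).trans
      (sum_congr rfl fun i _ => by rw [hF]; ring)
    · simp only [mem_filter, mem_range, mem_Icc] at hi ⊢
      exact ⟨hi.2.1, (Nat.le_div_iff_mul_le hp).2 (by linarith [hi.2.2])⟩
    · simp only [mem_filter, mem_range, mem_Icc, Nat.le_div_iff_mul_le hp] at hi hni
      rw [Nat.choose_eq_zero_of_lt (by grind), Nat.cast_zero, zero_mul]
end
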